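/- arXiv:2310.16418 — 5 statements merged into one kernel-verified Lean document; each statement's English description precedes it below -/
import Mathlib

section
/- Write n = k+1 and let 1 ≤ i ≤ n−1. Assume U^{(n+j)}(0) = 0 for all 1 ≤ j ≤ i−1. Then for every t ∈ ℝ, the (n,n+i)-cuspidal curvature of Ψ at (0,t), namely ‖Ψ_t‖^{(n+i)/n}·det(Ψ_t, ∂_s^{n}Ψ, ∂_s^{n+i}Ψ)/‖Ψ_t × ∂_s^{n}Ψ‖^{(2n+i)/n} evaluated at (0,t), equals ε₁·ε₂·m²·U(0)·U^{(n+i)}(0)/(((n−1)!)^{(n+i)/n}·ρ(0)). -/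
noncomputable section

open Real

/-- Dot product on `ℝ³ = Fin 3 → ℝ`. -/
def dot3 (a b : Fin 3 → ℝ) : ℝ := a 0 * b 0 + a 1 * b 1 + a 2 * b 2

/-- Cross product on `ℝ³ = Fin 3 → ℝ`. -/
def cross3 (a b : Fin 3 → ℝ) : Fin 3 → ℝ :=
  ![a 1 * b 2 - a 2 * b 1, a 2 * b 0 - a 0 * b 2, a 0 * b 1 - a 1 * b 0]

/-- Euclidean norm on `ℝ³ = Fin 3 → ℝ`. -/
def norm3 (a : Fin 3 → ℝ) : ℝ := Real.sqrt (dot3 a a)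

/-- Determinant of the 3×3 matrix with columns `a`, `b`, `c`. -/
def det3 (a b c : Fin 3 → ℝ) : ℝ :=
  a 0 * (b 1 * c 2 - b 2 * c 1) - b 0 * (a 1 * c 2 - a 2 * c 1) + c 0 * (a 1 * b 2 - a 2 * b 1)

/-- `ρ(s) = √(m²U(s)² − h² − m⁴U(s)²V(s)²)`. -/
def rhoB (U V : ℝ → ℝ) (m h : ℝ) (s : ℝ) : ℝ :=
  Real.sqrt (m ^ 2 * U s ^ 2 - h ^ 2 - m ^ 4 * U s ^ 2 * V s ^ 2)

/-- `x(s) = ε₀ √(m²U(s)² − h²)`. -/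
def xB (U : ℝ → ℝ) (m h ε₀ : ℝ) (s : ℝ) : ℝ :=
  ε₀ * Real.sqrt (m ^ 2 * U s ^ 2 - h ^ 2)

/-- `z(s) = ε₂ m ∫₀^s ζ^k U(ζ) ρ(ζ)/(m²U(ζ)² − h²) dζ`. -/
def zB (U V : ℝ → ℝ) (k : ℕ) (m h ε₂ : ℝ) (s : ℝ) : ℝ :=
  ε₂ * m * ∫ ζ in (0:ℝ)..s, ζ ^ k * U ζ * rhoB U V m h ζ / (m ^ 2 * U ζ ^ 2 - h ^ 2)

/-- `θ(s,t) = (1/m)(ε₁ t − ε₂ h ∫₀^s ζ^k ρ(ζ)/(U(ζ)(m²U(ζ)² − h²)) dζ)`. -/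
def thetaB (U V : ℝ → ℝ) (k : ℕ) (m h ε₁ ε₂ : ℝ) (s t : ℝ) : ℝ :=
  (1 / m) * (ε₁ * t -
    ε₂ * h * ∫ ζ in (0:ℝ)..s, ζ ^ k * rhoB U V m h ζ / (U ζ * (m ^ 2 * U ζ ^ 2 - h ^ 2)))

/-- The generic helicoidal `(k+1)`-type edge
`Ψ(s,t) = (x(s) cos θ(s,t), x(s) sin θ(s,t), z(s) + h θ(s,t))` of Bour's representation. -/
def PsiB (U V : ℝ → ℝ) (k : ℕ) (m h ε₀ ε₁ ε₂ : ℝ) (s t : ℝ) : Fin 3 → ℝ :=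
  ![xB U m h ε₀ s * Real.cos (thetaB U V k m h ε₁ ε₂ s t),
    xB U m h ε₀ s * Real.sin (thetaB U V k m h ε₁ ε₂ s t),
    zB U V k m h ε₂ s + h * thetaB U V k m h ε₁ ε₂ s t]

open scoped ContDiff in
/-- derivatives below order `p` vanish, and the `p`-th one is `c` -/
def Van (p : ℕ) (g : ℝ → ℝ) (c : ℝ) : Prop :=
  ∀ j ≤ p, iteratedDeriv j g 0 = if j = p then c else 0

open scoped ContDiff in
lemma iter_mul {n : ℕ} {f g : ℝ → ℝ} (hf : ContDiffAt ℝ ∞ f 0) (hg : ContDiffAt ℝ ∞ g 0) :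
    iteratedDeriv n (fun s => f s * g s) 0 = ∑ i ∈ Finset.range (n + 1),
      n.choose i * iteratedDeriv i f 0 * iteratedDeriv (n - i) g 0 :=
  iteratedDeriv_fun_mul (hf.of_le (by exact_mod_cast le_top)) (hg.of_le (by exact_mod_cast le_top))

open scoped ContDiff in
lemma Van.mul {p : ℕ} {G g : ℝ → ℝ} {c : ℝ} (h : Van p g c)
    (hG : ContDiffAt ℝ ∞ G 0) (hg : ContDiffAt ℝ ∞ g 0) :
    Van p (fun s => G s * g s) (G 0 * c) := by
  intro j hj
  rw [iter_mul hG hg, Finset.sum_eq_single 0]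
  · simp only [Nat.choose_zero_right, Nat.cast_one, iteratedDeriv_zero, one_mul, Nat.sub_zero]
    rw [h j hj]
    split_ifs <;> simp
  · intro b hb hb0
    rw [h (j - b) (by omega), if_neg (by simp at hb; omega)]
    simp
  · simp

open scoped ContDiff in
lemma Van.add {p : ℕ} {f g : ℝ → ℝ} {c d : ℝ} (hf : Van p f c) (hg : Van p g d)
    (hG : ContDiffAt ℝ ∞ f 0) (hg' : ContDiffAt ℝ ∞ g 0) :
    Van p (fun s => f s + g s) (c + d) := by
  intro j hj
  rw [iteratedDeriv_fun_add (hG.of_le (by exact_mod_cast le_top))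
    (hg'.of_le (by exact_mod_cast le_top)), hf j hj, hg j hj]
  split_ifs <;> simp

open scoped ContDiff in
lemma iter_pow_mul {k : ℕ} {g : ℝ → ℝ} (hg : ContDiffAt ℝ ∞ g 0) (j : ℕ) :
    iteratedDeriv (k + j) (fun s => s ^ k * g s) 0
      = (k + j).choose k * k.factorial * iteratedDeriv j g 0 := by
  rw [iter_mul (by fun_prop) hg, Finset.sum_eq_single k]
  · rw [iteratedDeriv_fun_pow_zero]; simp
  · intro b hb hb0
    rw [iteratedDeriv_fun_pow_zero, if_neg hb0]; simp
  · intro h; simp at h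

open scoped ContDiff in
lemma Van.pow_mul {p k : ℕ} {g : ℝ → ℝ} (hg : ContDiffAt ℝ ∞ g 0) (hpk : p < k) :
    Van p (fun s => s ^ k * g s) 0 := by
  intro j hj
  rw [iter_mul (by fun_prop) hg, Finset.sum_eq_zero]
  · simp
  · intro b hb
    rw [iteratedDeriv_fun_pow_zero, if_neg (by simp at hb; omega)]; simp

open scoped ContDiff in
lemma smooth_of_deriv {J : Set ℝ} (hJo : IsOpen J) {f g : ℝ → ℝ}
    (h : ∀ s ∈ J, HasDerivAt f (g s) s) (hg : ContDiffOn ℝ ∞ g J) : ContDiffOn ℝ ∞ f J := by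
  rw [contDiffOn_infty_iff_deriv_of_isOpen hJo]
  exact ⟨fun s hs => (h s hs).differentiableAt.differentiableWithinAt,
    hg.congr fun s hs => (h s hs).deriv⟩

open scoped ContDiff in
/-- `f` is smooth on `J`, its derivatives of orders `1..p` vanish at `0`, the next one is `c` -/
def Fl (J : Set ℝ) (p : ℕ) (f : ℝ → ℝ) (c : ℝ) : Prop :=
  ∃ g : ℝ → ℝ, (∀ s ∈ J, HasDerivAt f (g s) s) ∧ ContDiffOn ℝ ∞ g J ∧ Van p g c

open scoped ContDiff in
lemma Fl.smooth {J : Set ℝ} (hJo : IsOpen J) {p : ℕ} {f : ℝ → ℝ} {c : ℝ} (h : Fl J p f c) :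
    ContDiffOn ℝ ∞ f J := by
  obtain ⟨g, h1, h2, _⟩ := h
  exact smooth_of_deriv hJo h1 h2

lemma iter_succ_of_deriv {J : Set ℝ} (hJo : IsOpen J) (hJ0 : (0 : ℝ) ∈ J) {f g : ℝ → ℝ}
    (h : ∀ s ∈ J, HasDerivAt f (g s) s) (n : ℕ) :
    iteratedDeriv (n + 1) f 0 = iteratedDeriv n g 0 := by
  rw [iteratedDeriv_succ']
  apply Filter.EventuallyEq.iteratedDeriv_eq
  filter_upwards [hJo.mem_nhds hJ0] with s hs
  exact (h s hs).deriv

lemma Fl.iter {J : Set ℝ} (hJo : IsOpen J) (hJ0 : (0 : ℝ) ∈ J) {p : ℕ} {f : ℝ → ℝ} {c : ℝ}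
    (h : Fl J p f c) : iteratedDeriv (p + 1) f 0 = c := by
  obtain ⟨g, h1, h2, h3⟩ := h
  rw [iter_succ_of_deriv hJo hJ0 h1, h3 p le_rfl, if_pos rfl]

open scoped ContDiff in
lemma Fl.ofpow {J : Set ℝ} (hJo : IsOpen J) (hJ0 : (0 : ℝ) ∈ J) {p k : ℕ} (hpk : p < k)
    {f g : ℝ → ℝ} (h : ∀ s ∈ J, HasDerivAt f (s ^ k * g s) s) (hg : ContDiffOn ℝ ∞ g J) :
    Fl J p f 0 :=
  ⟨_, h, ContDiffOn.mul (by fun_prop) hg,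
    Van.pow_mul (hg.contDiffAt (hJo.mem_nhds hJ0)) hpk⟩

open scoped ContDiff in
lemma Fl.const {J : Set ℝ} {p : ℕ} (a : ℝ) : Fl J p (fun _ => a) 0 := by
  refine ⟨fun _ => 0, fun s _ => hasDerivAt_const s a, contDiffOn_const, ?_⟩
  intro j hj
  simp [iteratedDeriv_const]

open scoped ContDiff in
lemma Fl.add {J : Set ℝ} (hJo : IsOpen J) (hJ0 : (0 : ℝ) ∈ J) {p : ℕ} {f₁ f₂ : ℝ → ℝ}
    {c₁ c₂ : ℝ} (h₁ : Fl J p f₁ c₁) (h₂ : Fl J p f₂ c₂) :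
    Fl J p (fun s => f₁ s + f₂ s) (c₁ + c₂) := by
  obtain ⟨g₁, a₁, b₁, v₁⟩ := h₁
  obtain ⟨g₂, a₂, b₂, v₂⟩ := h₂
  exact ⟨fun s => g₁ s + g₂ s, fun s hs => (a₁ s hs).add (a₂ s hs), b₁.add b₂,
    v₁.add v₂ (b₁.contDiffAt (hJo.mem_nhds hJ0)) (b₂.contDiffAt (hJo.mem_nhds hJ0))⟩

open scoped ContDiff in
lemma Fl.mul {J : Set ℝ} (hJo : IsOpen J) (hJ0 : (0 : ℝ) ∈ J) {p : ℕ} {f₁ f₂ : ℝ → ℝ}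
    {c₁ c₂ : ℝ} (h₁ : Fl J p f₁ c₁) (h₂ : Fl J p f₂ c₂) :
    Fl J p (fun s => f₁ s * f₂ s) (f₂ 0 * c₁ + f₁ 0 * c₂) := by
  have s₁ := h₁.smooth hJo
  have s₂ := h₂.smooth hJo
  obtain ⟨g₁, a₁, b₁, v₁⟩ := h₁
  obtain ⟨g₂, a₂, b₂, v₂⟩ := h₂
  have hn := hJo.mem_nhds hJ0
  refine ⟨fun s => f₂ s * g₁ s + f₁ s * g₂ s, fun s hs => ?_, (s₂.mul b₁).add (s₁.mul b₂), ?_⟩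
  · exact ((a₁ s hs).mul (a₂ s hs)).congr_deriv (by ring)
  · exact (v₁.mul (s₂.contDiffAt hn) (b₁.contDiffAt hn)).add
      (v₂.mul (s₁.contDiffAt hn) (b₂.contDiffAt hn))
      ((s₂.mul b₁).contDiffAt hn) ((s₁.mul b₂).contDiffAt hn)

open scoped ContDiff in
lemma Fl.comp {J : Set ℝ} (hJo : IsOpen J) (hJ0 : (0 : ℝ) ∈ J) {p : ℕ} {f F F' : ℝ → ℝ}
    {c : ℝ} (h : Fl J p f c) (hF : ∀ s ∈ J, HasDerivAt F (F' (f s)) (f s))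
    (hF' : ContDiffOn ℝ ∞ (fun s => F' (f s)) J) :
    Fl J p (fun s => F (f s)) (F' (f 0) * c) := by
  obtain ⟨g, a, b, v⟩ := h
  have hn := hJo.mem_nhds hJ0
  exact ⟨fun s => F' (f s) * g s, fun s hs => (hF s hs).comp s (a s hs), hF'.mul b,
    v.mul (hF'.contDiffAt hn) (b.contDiffAt hn)⟩

open scoped ContDiff in
lemma Fl.inv {J : Set ℝ} (hJo : IsOpen J) (hJ0 : (0 : ℝ) ∈ J) {p : ℕ} {f : ℝ → ℝ}
    {c : ℝ} (h : Fl J p f c) (h0 : ∀ s ∈ J, f s ≠ 0) :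
    Fl J p (fun s => (f s)⁻¹) (-(f 0 ^ 2)⁻¹ * c) :=
  Fl.comp (F := fun y => y⁻¹) (F' := fun y => -(y ^ 2)⁻¹) hJo hJ0 h
    (fun s hs => hasDerivAt_inv (h0 s hs))
    ((((h.smooth hJo).pow 2).inv (fun s hs => pow_ne_zero 2 (h0 s hs))).neg)

open scoped ContDiff in
lemma Fl.sqrt {J : Set ℝ} (hJo : IsOpen J) (hJ0 : (0 : ℝ) ∈ J) {p : ℕ} {f : ℝ → ℝ}
    {c : ℝ} (h : Fl J p f c) (h0 : ∀ s ∈ J, 0 < f s) :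
    Fl J p (fun s => √(f s)) (1 / (2 * √(f 0)) * c) := by
  refine Fl.comp (F := fun y => √y) (F' := fun y => 1 / (2 * √y)) hJo hJ0 h
    (fun s hs => Real.hasDerivAt_sqrt (h0 s hs).ne') ?_
  refine ContDiffOn.div contDiffOn_const
    (contDiffOn_const.mul ((h.smooth hJo).sqrt (fun s hs => (h0 s hs).ne'))) ?_
  intro s hs
  have := Real.sqrt_pos.2 (h0 s hs)
  positivity

open scoped ContDiff in
lemma hasDeriv_int {J : Set ℝ} (hJo : IsOpen J) (hJc : Convex ℝ J) (hJ0 : (0 : ℝ) ∈ J)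
    {f : ℝ → ℝ} (hf : ContinuousOn f J) {s : ℝ} (hs : s ∈ J) :
    HasDerivAt (fun u => ∫ x in (0 : ℝ)..u, f x) (f s) s := by
  have hsub : Set.uIcc 0 s ⊆ J := by
    rw [← segment_eq_uIcc]
    exact hJc.segment_subset hJ0 hs
  exact intervalIntegral.integral_hasDerivAt_right (hf.mono hsub).intervalIntegrable
    (hf.stronglyMeasurableAtFilter hJo s hs) (hf.continuousAt (hJo.mem_nhds hs))

open scoped ContDiff in
lemma iter_comp {N : ℕ} {f : ℝ → Fin 3 → ℝ} (hf : ContDiffAt ℝ ∞ f 0) (j : Fin 3) :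
    iteratedDeriv N f 0 j = iteratedDeriv N (fun s => f s j) 0 := by
  have := (ContinuousLinearMap.proj (R := ℝ) (φ := fun _ : Fin 3 => ℝ) j).iteratedFDeriv_comp_left
    hf (i := N) (by exact_mod_cast le_top)
  rw [iteratedDeriv_eq_iteratedFDeriv, iteratedDeriv_eq_iteratedFDeriv]
  have e : (fun s => f s j) = (ContinuousLinearMap.proj (R := ℝ) (φ := fun _ : Fin 3 => ℝ) j) ∘ f := rfl
  rw [e, this]
  rfl

open scoped ContDiff in
/-- The two relevant derivatives of a component. -/
lemma iter_two {J : Set ℝ} (hJo : IsOpen J) (hJ0 : (0 : ℝ) ∈ J) {p k : ℕ}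
    {ψ Φ : ℝ → ℝ} {c : ℝ} (h : ∀ s ∈ J, HasDerivAt ψ (s ^ k * Φ s) s) (hΦ : Fl J p Φ c) :
    iteratedDeriv (k + 1) ψ 0 = k.factorial * Φ 0 ∧
    iteratedDeriv (k + 1 + (p + 1)) ψ 0
      = (k + (p + 1)).choose k * k.factorial * c := by
  have hn := hJo.mem_nhds hJ0
  have hs := (hΦ.smooth hJo).contDiffAt hn
  constructor
  · rw [iter_succ_of_deriv hJo hJ0 h]
    have := iter_pow_mul (k := k) hs 0
    simpa using this
  · rw [show k + 1 + (p + 1) = (k + (p + 1)) + 1 by ring, iter_succ_of_deriv hJo hJ0 h,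
      iter_pow_mul hs, hΦ.iter hJo hJ0]

/-- Final algebra: determinant. -/
lemma alg_det (m h ε₁ ε₂ X u v w R C S K M : ℝ) (hm : m ≠ 0) (hX : X ≠ 0) (hu : u ≠ 0)
    (hR : R ≠ 0) (he0 : X ^ 2 = m ^ 2 * u ^ 2 - h ^ 2)
    (hR2 : R ^ 2 = X ^ 2 - m ^ 4 * u ^ 2 * v ^ 2) (hCS : C ^ 2 + S ^ 2 = 1)
    (T P Q : Fin 3 → ℝ) (a b c a' b' c' : ℝ)
    (ha : a = m ^ 2 * u * v / X) (ha' : a' = m ^ 2 * u * w / X)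
    (hc : c = ε₂ * m * u * R / X ^ 2) (hc' : c' = ε₂ * m * u / X ^ 2 * (-(m ^ 4 * u ^ 2 * v * w) / R))
    (T0 : T 0 = -(X * S * (ε₁ / m))) (T1 : T 1 = X * C * (ε₁ / m)) (T2 : T 2 = h * (ε₁ / m))
    (P0 : P 0 = K * (a * C - b * X * S)) (P1 : P 1 = K * (a * S + b * X * C))
    (P2 : P 2 = K * (c + h * b))
    (Q0 : Q 0 = M * (a' * C - b' * X * S)) (Q1 : Q 1 = M * (a' * S + b' * X * C))
    (Q2 : Q 2 = M * (c' + h * b')) :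
    det3 T P Q = ε₁ * ε₂ * m ^ 2 * u ^ 2 * K * (M * w) / R := by
  have e1 : det3 T P Q = (ε₁ / m) * K * M * X * (c * a' - a * c') := by
    simp only [det3, T0, T1, T2, P0, P1, P2, Q0, Q1, Q2]
    linear_combination (ε₁ / m) * K * M * X * (c * a' - a * c') * hCS
  rw [e1, ha, ha', hc, hc']
  field_simp
  linear_combination (ε₁ * ε₂ * w) * K * M * hR2

/-- Final algebra: norm of the cross product. -/
lemma alg_cross (m h ε₁ ε₂ X u v R C S K : ℝ) (hm : m ≠ 0) (hX : X ≠ 0) (hu : 0 < u)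
    (hK : 0 < K) (he0 : X ^ 2 = m ^ 2 * u ^ 2 - h ^ 2) (h1 : ε₁ ^ 2 = 1) (h2 : ε₂ ^ 2 = 1)
    (hR2 : R ^ 2 = X ^ 2 - m ^ 4 * u ^ 2 * v ^ 2) (hCS : C ^ 2 + S ^ 2 = 1)
    (T P : Fin 3 → ℝ) (a b c : ℝ)
    (ha : a = m ^ 2 * u * v / X) (hc : c = ε₂ * m * u * R / X ^ 2)
    (T0 : T 0 = -(X * S * (ε₁ / m))) (T1 : T 1 = X * C * (ε₁ / m)) (T2 : T 2 = h * (ε₁ / m))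
    (P0 : P 0 = K * (a * C - b * X * S)) (P1 : P 1 = K * (a * S + b * X * C))
    (P2 : P 2 = K * (c + h * b)) :
    norm3 (cross3 T P) = K * u := by
  have hS : S ^ 2 = 1 - C ^ 2 := by linarith
  have c0 : cross3 T P 0 = K * (ε₁ / m) * (X * C * c - h * a * S) := by
    simp [cross3, T0, T1, T2, P0, P1, P2]; ring
  have c1 : cross3 T P 1 = K * (ε₁ / m) * (h * a * C + X * S * c) := by
    simp [cross3, T0, T1, T2, P0, P1, P2]; ring
  have c2 : cross3 T P 2 = -(K * (ε₁ / m) * (X * a)) := by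
    simp [cross3, T0, T1, T2, P0, P1, P2]
    linear_combination -(K * (ε₁ / m) * (X * a)) * hCS
  have e : dot3 (cross3 T P) (cross3 T P) = (K * u) ^ 2 := by
    have e1 : dot3 (cross3 T P) (cross3 T P)
        = (K * (ε₁ / m)) ^ 2 * (X ^ 2 * c ^ 2 + (h ^ 2 + X ^ 2) * a ^ 2) := by
      simp only [dot3, c0, c1, c2]
      linear_combination (K * (ε₁ / m)) ^ 2 * (X ^ 2 * c ^ 2 + h ^ 2 * a ^ 2) * hCS
    rw [e1, show h ^ 2 + X ^ 2 = m ^ 2 * u ^ 2 by linarith]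
    have e2 : (K * (ε₁ / m)) ^ 2 = K ^ 2 / m ^ 2 := by
      rw [mul_pow, div_pow, h1]; ring
    have e3 : c ^ 2 = m ^ 2 * u ^ 2 * R ^ 2 / X ^ 4 := by
      rw [hc, div_pow, mul_pow, mul_pow, mul_pow, h2]; ring
    rw [e2, e3, ha, hR2]
    field_simp
    ring
  rw [norm3, e, Real.sqrt_sq (by positivity)]

/-- Final algebra: norm of the tangent. -/
lemma alg_T (m h ε₁ X u C S : ℝ) (hm : 0 < m) (hu : 0 < u)
    (he0 : X ^ 2 = m ^ 2 * u ^ 2 - h ^ 2) (h1 : ε₁ ^ 2 = 1) (hCS : C ^ 2 + S ^ 2 = 1)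
    (T : Fin 3 → ℝ)
    (T0 : T 0 = -(X * S * (ε₁ / m))) (T1 : T 1 = X * C * (ε₁ / m)) (T2 : T 2 = h * (ε₁ / m)) :
    norm3 T = u := by
  have e : dot3 T T = u ^ 2 := by
    have e1 : dot3 T T = ε₁ ^ 2 / m ^ 2 * (X ^ 2 + h ^ 2) := by
      simp only [dot3, T0, T1, T2]
      linear_combination ε₁ ^ 2 / m ^ 2 * X ^ 2 * hCS
    rw [e1, h1, he0]; field_simp; ring
  rw [norm3, e, Real.sqrt_sq hu.le]

/-- Final algebra: real powers. -/
lemma alg_pow (u K α E W R : ℝ) (hu : 0 < u) (hK : 0 < K) (hR : R ≠ 0) :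
    u ^ α * (E * u ^ 2 * K * W / R) / (K * u) ^ (α + 1) = E * u * W / (K ^ α * R) := by
  have hua := Real.rpow_pos_of_pos hu α
  have hKa := Real.rpow_pos_of_pos hK α
  rw [Real.mul_rpow hK.le hu.le, Real.rpow_add hK, Real.rpow_add hu, Real.rpow_one, Real.rpow_one]
  field_simp

/-- With `n = k+1` and `1 ≤ i ≤ n−1`, if `U^{(n+j)}(0) = 0` for `1 ≤ j ≤ i−1`, then the
`(n,n+i)`-cuspidal curvature of `Ψ` at `(0,t)` equals
`ε₁ε₂ m² U(0) U^{(n+i)}(0)/(((n−1)!)^{(n+i)/n} ρ(0))`. -/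
theorem stmt10
    (k : ℕ) (hk : 1 ≤ k)
    (J : Set ℝ) (hJo : IsOpen J) (hJc : Convex ℝ J) (hJ0 : (0:ℝ) ∈ J)
    (U V : ℝ → ℝ) (hU : ContDiff ℝ (⊤ : ℕ∞) U) (hV : ContDiff ℝ (⊤ : ℕ∞) V)
    (hUpos : ∀ s ∈ J, 0 < U s) (hU' : ∀ s ∈ J, deriv U s = s ^ k * V s)
    (m h : ℝ) (hm : 0 < m)
    (h1 : ∀ s ∈ J, 0 < m ^ 2 * U s ^ 2 - h ^ 2)
    (h2 : ∀ s ∈ J, 0 < m ^ 2 * U s ^ 2 - h ^ 2 - m ^ 4 * U s ^ 2 * V s ^ 2)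
    (ε₀ ε₁ ε₂ : ℝ) (he0 : ε₀ = 1 ∨ ε₀ = -1) (he1 : ε₁ = 1 ∨ ε₁ = -1)
    (he2 : ε₂ = 1 ∨ ε₂ = -1)
    (i : ℕ) (hi1 : 1 ≤ i) (hik : i ≤ k)
    (hvanish : ∀ j : ℕ, 1 ≤ j → j ≤ i - 1 → iteratedDeriv (k + 1 + j) U 0 = 0) :
    ∀ t : ℝ,
      norm3 (deriv (fun t' => PsiB U V k m h ε₀ ε₁ ε₂ 0 t') t)
            ^ (((k : ℝ) + 1 + (i : ℝ)) / ((k : ℝ) + 1))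
          * det3 (deriv (fun t' => PsiB U V k m h ε₀ ε₁ ε₂ 0 t') t)
              (iteratedDeriv (k + 1) (fun s' => PsiB U V k m h ε₀ ε₁ ε₂ s' t) 0)
              (iteratedDeriv (k + 1 + i) (fun s' => PsiB U V k m h ε₀ ε₁ ε₂ s' t) 0)
          / norm3 (cross3 (deriv (fun t' => PsiB U V k m h ε₀ ε₁ ε₂ 0 t') t)
              (iteratedDeriv (k + 1) (fun s' => PsiB U V k m h ε₀ ε₁ ε₂ s' t) 0))
            ^ ((2 * (k : ℝ) + 2 + (i : ℝ)) / ((k : ℝ) + 1))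
        = ε₁ * ε₂ * m ^ 2 * U 0 * iteratedDeriv (k + 1 + i) U 0
            / ((k.factorial : ℝ) ^ (((k : ℝ) + 1 + (i : ℝ)) / ((k : ℝ) + 1))
              * rhoB U V m h 0) := by
  intro t
  obtain ⟨p, rfl⟩ : ∃ p, i = p + 1 := ⟨i - 1, by omega⟩
  have hpk : p < k := by omega
  have hn := hJo.mem_nhds hJ0
  have dU : ∀ s ∈ J, HasDerivAt U (s ^ k * V s) s := fun s hs => by
    rw [← hU' s hs]; exact (hU.differentiable (by simp) s).hasDerivAt
  have hUs : ContDiffOn ℝ (⊤ : ℕ∞) U J := hU.contDiffOn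
  have hVs : ContDiffOn ℝ (⊤ : ℕ∞) V J := hV.contDiffOn
  set M : ℝ := ((k + (p + 1)).choose k : ℝ) * k.factorial with hM
  set w : ℝ := iteratedDeriv (p + 1) V 0 with hw
  have iU : ∀ j, iteratedDeriv (k + 1 + j) U 0
      = (k + j).choose k * k.factorial * iteratedDeriv j V 0 := fun j => by
    rw [show k + 1 + j = (k + j) + 1 by ring, iter_succ_of_deriv hJo hJ0 dU,
      iter_pow_mul hV.contDiffAt]
  have hW : iteratedDeriv (k + 1 + (p + 1)) U 0 = M * w := iU (p + 1)
  -- flatness of the ingredients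
  have FV : Fl J p V w := by
    refine ⟨deriv V, fun s _ => (hV.differentiable (by simp) s).hasDerivAt,
      ((contDiff_infty_iff_deriv.1 hV).2).contDiffOn, fun j hj => ?_⟩
    rw [← iteratedDeriv_succ']
    split_ifs with hjp
    · rw [hjp]
    · have h0 := hvanish (j + 1) (by omega) (by omega)
      rw [iU] at h0
      have hc : ((k + (j + 1)).choose k : ℝ) ≠ 0 := by
        exact_mod_cast (Nat.choose_pos (by omega)).ne'
      have hf : (k.factorial : ℝ) ≠ 0 := by exact_mod_cast k.factorial_ne_zero
      exact (mul_eq_zero.1 h0).resolve_left (mul_ne_zero hc hf)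
  have FU : Fl J p U 0 := Fl.ofpow hJo hJ0 hpk dU hVs
  set D : ℝ → ℝ := fun s => m ^ 2 * U s ^ 2 - h ^ 2 with hD
  have Dpos : ∀ s ∈ J, 0 < D s := h1
  have Dne : ∀ s ∈ J, D s ≠ 0 := fun s hs => (Dpos s hs).ne'
  have dD : ∀ s ∈ J, HasDerivAt D (s ^ k * (2 * m ^ 2 * U s * V s)) s := fun s hs => by
    have := (((dU s hs).pow 2).const_mul (m ^ 2)).sub_const (h ^ 2)
    exact this.congr_deriv (by simp; ring)
  have FD : Fl J p D 0 := Fl.ofpow hJo hJ0 hpk dD (by fun_prop)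
  have hDs := FD.smooth hJo
  set X : ℝ → ℝ := xB U m h ε₀ with hX
  have e02 : ε₀ ^ 2 = 1 := by rcases he0 with rfl | rfl <;> norm_num
  have e12 : ε₁ ^ 2 = 1 := by rcases he1 with rfl | rfl <;> norm_num
  have e22 : ε₂ ^ 2 = 1 := by rcases he2 with rfl | rfl <;> norm_num
  have e0ne : ε₀ ≠ 0 := by rcases he0 with rfl | rfl <;> norm_num
  have X2 : ∀ s ∈ J, X s ^ 2 = D s := fun s hs => by
    simp only [hX, xB, mul_pow, e02, one_mul]
    exact Real.sq_sqrt (Dpos s hs).le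
  have Xne : ∀ s ∈ J, X s ≠ 0 := fun s hs => by
    have e1 := X2 s hs
    have e2 := Dpos s hs
    intro h0
    rw [h0] at e1
    rw [← e1] at e2
    norm_num at e2
  have hXs : ContDiffOn ℝ (⊤ : ℕ∞) X J := contDiffOn_const.mul (hDs.sqrt Dne)
  set a : ℝ → ℝ := fun s => m ^ 2 * (U s * (V s * (X s)⁻¹)) with ha
  have has : ContDiffOn ℝ (⊤ : ℕ∞) a J :=
    contDiffOn_const.mul (hUs.mul (hVs.mul (hXs.inv Xne)))
  have dX : ∀ s ∈ J, HasDerivAt X (s ^ k * a s) s := fun s hs => by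
    have := ((dD s hs).sqrt (Dne s hs)).const_mul ε₀
    refine this.congr_deriv ?_
    have hs0 : √(D s) ≠ 0 := (Real.sqrt_pos.2 (Dpos s hs)).ne'
    have : X s = ε₀ * √(D s) := rfl
    simp only [ha, this]
    field_simp
    linear_combination (s ^ k * U s * V s) * e02
  have FX : Fl J p X 0 := Fl.ofpow hJo hJ0 hpk dX has
  set R : ℝ → ℝ := rhoB U V m h with hR
  have Rpos : ∀ s ∈ J, 0 < R s := fun s hs => Real.sqrt_pos.2 (h2 s hs)
  have R2 : R 0 ^ 2 = X 0 ^ 2 - m ^ 4 * U 0 ^ 2 * V 0 ^ 2 := by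
    rw [X2 0 hJ0]; exact Real.sq_sqrt (h2 0 hJ0).le
  have FR : ∃ r, Fl J p R r ∧ r = -(m ^ 4 * U 0 ^ 2 * V 0 * w) / R 0 := by
    have FUV := Fl.mul hJo hJ0 FU FV
    have FQ := Fl.add hJo hJ0 FD (Fl.mul hJo hJ0 (Fl.const (-m ^ 4)) (Fl.mul hJo hJ0 FUV FUV))
    have eQ : (fun s => D s + -m ^ 4 * (U s * V s * (U s * V s)))
        = fun s => m ^ 2 * U s ^ 2 - h ^ 2 - m ^ 4 * U s ^ 2 * V s ^ 2 := by
      funext s; simp only [hD]; ring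
    rw [eQ] at FQ
    refine ⟨_, Fl.sqrt hJo hJ0 FQ h2, ?_⟩
    have : √(m ^ 2 * U 0 ^ 2 - h ^ 2 - m ^ 4 * U 0 ^ 2 * V 0 ^ 2) = R 0 := rfl
    rw [this]
    have := (Rpos 0 hJ0).ne'
    field_simp
    ring
  obtain ⟨r, FR, hr⟩ := FR
  have hRs := FR.smooth hJo
  have FD' := Fl.inv hJo hJ0 FD Dne
  have FU' := Fl.inv hJo hJ0 FU (fun s hs => (hUpos s hs).ne')
  have FX' := Fl.inv hJo hJ0 FX Xne
  have Fa := Fl.mul hJo hJ0 (Fl.const (m ^ 2)) (Fl.mul hJo hJ0 FU (Fl.mul hJo hJ0 FV FX'))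
  have Fb := Fl.mul hJo hJ0 (Fl.const (-(ε₂ * h / m)))
    (Fl.mul hJo hJ0 FR (Fl.mul hJo hJ0 FU' FD'))
  have Fc := Fl.mul hJo hJ0 (Fl.const (ε₂ * m)) (Fl.mul hJo hJ0 FU (Fl.mul hJo hJ0 FR FD'))
  set b : ℝ → ℝ := fun s => -(ε₂ * h / m) * (R s * ((U s)⁻¹ * (D s)⁻¹)) with hb
  set c : ℝ → ℝ := fun s => ε₂ * m * (U s * (R s * (D s)⁻¹)) with hc
  obtain ⟨a', ha', Fa⟩ : ∃ a', a' = m ^ 2 * U 0 * w / X 0 ∧ Fl J p a a' :=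
    ⟨_, by rw [div_eq_mul_inv]; ring, Fa⟩
  obtain ⟨b', Fb⟩ : ∃ b', Fl J p b b' := ⟨_, Fb⟩
  obtain ⟨c', hc', Fc⟩ : ∃ c', c' = ε₂ * m * U 0 / X 0 ^ 2 * (-(m ^ 4 * U 0 ^ 2 * V 0 * w) / R 0)
      ∧ Fl J p c c' :=
    ⟨_, by rw [X2 0 hJ0, ← hr, div_eq_mul_inv]; ring, Fc⟩
  have hbs := Fb.smooth hJo
  have hcs := Fc.smooth hJo
  -- theta and z
  set θ : ℝ → ℝ := fun s => thetaB U V k m h ε₁ ε₂ s t with hθ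
  have dθ : ∀ s ∈ J, HasDerivAt θ (s ^ k * b s) s := fun s hs => by
    have hcont : ContinuousOn (fun ζ => ζ ^ k * R ζ / (U ζ * D ζ)) J :=
      (ContinuousOn.mul (by fun_prop) hRs.continuousOn).div (hUs.continuousOn.mul hDs.continuousOn)
        (fun s hs => mul_ne_zero (hUpos s hs).ne' (Dne s hs))
    have := (((hasDeriv_int hJo hJc hJ0 hcont hs).const_mul (ε₂ * h)).const_sub
      (ε₁ * t)).const_mul (1 / m)
    refine this.congr_deriv ?_
    have := (hUpos s hs).ne'
    have := Dne s hs
    simp only [hb]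
    field_simp
  set z : ℝ → ℝ := zB U V k m h ε₂ with hz
  have dz : ∀ s ∈ J, HasDerivAt z (s ^ k * c s) s := fun s hs => by
    have hcont : ContinuousOn (fun ζ => ζ ^ k * U ζ * R ζ / D ζ) J :=
      ((ContinuousOn.mul (by fun_prop) hUs.continuousOn).mul hRs.continuousOn).div
        hDs.continuousOn Dne
    have := (hasDeriv_int hJo hJc hJ0 hcont hs).const_mul (ε₂ * m)
    refine this.congr_deriv ?_
    have := Dne s hs
    simp only [hc]
    field_simp
  have hθs : ContDiffOn ℝ (⊤ : ℕ∞) θ J :=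
    smooth_of_deriv hJo dθ (ContDiffOn.mul (by fun_prop) hbs)
  have FC : Fl J p (fun s => Real.cos (θ s)) 0 := by
    refine Fl.ofpow (g := fun s => -Real.sin (θ s) * b s) hJo hJ0 hpk
      (fun s hs => (dθ s hs).cos.congr_deriv (by ring)) (hθs.sin.neg.mul hbs)
  have FS : Fl J p (fun s => Real.sin (θ s)) 0 := by
    refine Fl.ofpow (g := fun s => Real.cos (θ s) * b s) hJo hJ0 hpk
      (fun s hs => (dθ s hs).sin.congr_deriv (by ring)) (hθs.cos.mul hbs)
  -- components
  have d0 : ∀ s ∈ J, HasDerivAt (fun s => X s * Real.cos (θ s))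
      (s ^ k * (a s * Real.cos (θ s) + -1 * (b s * (X s * Real.sin (θ s))))) s := fun s hs =>
    ((dX s hs).mul (dθ s hs).cos).congr_deriv (by ring)
  have d1 : ∀ s ∈ J, HasDerivAt (fun s => X s * Real.sin (θ s))
      (s ^ k * (a s * Real.sin (θ s) + b s * (X s * Real.cos (θ s)))) s := fun s hs =>
    ((dX s hs).mul (dθ s hs).sin).congr_deriv (by ring)
  have d2 : ∀ s ∈ J, HasDerivAt (fun s => z s + h * θ s)
      (s ^ k * (c s + h * b s)) s := fun s hs =>
    ((dz s hs).add ((dθ s hs).const_mul h)).congr_deriv (by ring)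
  have F0 := Fl.add hJo hJ0 (Fl.mul hJo hJ0 Fa FC) (Fl.mul hJo hJ0 (Fl.const (-1))
    (Fl.mul hJo hJ0 Fb (Fl.mul hJo hJ0 FX FS)))
  have F1 := Fl.add hJo hJ0 (Fl.mul hJo hJ0 Fa FS)
    (Fl.mul hJo hJ0 Fb (Fl.mul hJo hJ0 FX FC))
  have F2 := Fl.add hJo hJ0 Fc (Fl.mul hJo hJ0 (Fl.const h) Fb)
  obtain ⟨P0, Q0⟩ := iter_two hJo hJ0 d0 F0
  obtain ⟨P1, Q1⟩ := iter_two hJo hJ0 d1 F1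
  obtain ⟨P2, Q2⟩ := iter_two hJo hJ0 d2 F2
  have hΨ : ContDiffAt ℝ (⊤ : ℕ∞) (fun s' => PsiB U V k m h ε₀ ε₁ ε₂ s' t) 0 := by
    have s0 := (smooth_of_deriv hJo d0 (ContDiffOn.mul (by fun_prop) (F0.smooth hJo))).contDiffAt hn
    have s1 := (smooth_of_deriv hJo d1 (ContDiffOn.mul (by fun_prop) (F1.smooth hJo))).contDiffAt hn
    have s2 := (smooth_of_deriv hJo d2 (ContDiffOn.mul (by fun_prop) (F2.smooth hJo))).contDiffAt hn
    rw [contDiffAt_pi]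
    intro j
    fin_cases j
    · exact s0
    · exact s1
    · exact s2
  have hT : HasDerivAt (fun t' => PsiB U V k m h ε₀ ε₁ ε₂ 0 t')
      ![-(X 0 * Real.sin (θ 0) * (ε₁ / m)), X 0 * Real.cos (θ 0) * (ε₁ / m), h * (ε₁ / m)] t := by
    have dt : HasDerivAt (fun t' => thetaB U V k m h ε₁ ε₂ 0 t') (ε₁ / m) t := by
      have := (((hasDerivAt_id t).const_mul ε₁).sub_const
        (ε₂ * h * ∫ ζ in (0:ℝ)..0, ζ ^ k * rhoB U V m h ζ / (U ζ * (m ^ 2 * U ζ ^ 2 - h ^ 2)))).const_mul (1 / m)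
      exact this.congr_deriv (by ring)
    rw [hasDerivAt_pi]
    intro j
    fin_cases j
    · exact (dt.cos.const_mul (X 0)).congr_deriv (by simp [hθ]; ring)
    · exact (dt.sin.const_mul (X 0)).congr_deriv (by simp [hθ]; ring)
    · exact ((dt.const_mul h).const_add (z 0)).congr_deriv (by simp)
  rw [hT.deriv]
  set T : Fin 3 → ℝ :=
    ![-(X 0 * Real.sin (θ 0) * (ε₁ / m)), X 0 * Real.cos (θ 0) * (ε₁ / m), h * (ε₁ / m)] with hTdef
  set P := iteratedDeriv (k + 1) (fun s' => PsiB U V k m h ε₀ ε₁ ε₂ s' t) 0 with hP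
  set Q := iteratedDeriv (k + 1 + (p + 1)) (fun s' => PsiB U V k m h ε₀ ε₁ ε₂ s' t) 0 with hQ
  have P0' : P 0 = k.factorial * (a 0 * Real.cos (θ 0) - b 0 * X 0 * Real.sin (θ 0)) :=
    (iter_comp hΨ 0).trans (P0.trans (by ring))
  have P1' : P 1 = k.factorial * (a 0 * Real.sin (θ 0) + b 0 * X 0 * Real.cos (θ 0)) :=
    (iter_comp hΨ 1).trans (P1.trans (by ring))
  have P2' : P 2 = k.factorial * (c 0 + h * b 0) :=
    (iter_comp hΨ 2).trans P2
  have Q0' : Q 0 = M * (a' * Real.cos (θ 0) - b' * X 0 * Real.sin (θ 0)) :=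
    (iter_comp hΨ 0).trans (Q0.trans (by ring))
  have Q1' : Q 1 = M * (a' * Real.sin (θ 0) + b' * X 0 * Real.cos (θ 0)) :=
    (iter_comp hΨ 1).trans (Q1.trans (by ring))
  have Q2' : Q 2 = M * (c' + h * b') :=
    (iter_comp hΨ 2).trans (Q2.trans (by ring))
  have T0 : T 0 = -(X 0 * Real.sin (θ 0) * (ε₁ / m)) := rfl
  have T1 : T 1 = X 0 * Real.cos (θ 0) * (ε₁ / m) := rfl
  have T2 : T 2 = h * (ε₁ / m) := rfl
  have ha0 : a 0 = m ^ 2 * U 0 * V 0 / X 0 := by simp only [ha, div_eq_mul_inv]; ring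
  have hc0 : c 0 = ε₂ * m * U 0 * R 0 / X 0 ^ 2 := by
    rw [X2 0 hJ0]; simp only [hc, div_eq_mul_inv]; ring
  have X20 : X 0 ^ 2 = m ^ 2 * U 0 ^ 2 - h ^ 2 := X2 0 hJ0
  have hCS : Real.cos (θ 0) ^ 2 + Real.sin (θ 0) ^ 2 = 1 := by
    rw [add_comm]; exact Real.sin_sq_add_cos_sq _
  have hu := hUpos 0 hJ0
  have hK : (0 : ℝ) < k.factorial := by exact_mod_cast k.factorial_pos
  have hR0 := (Rpos 0 hJ0).ne'
  rw [alg_T m h ε₁ (X 0) (U 0) _ _ hm hu X20 e12 hCS T T0 T1 T2,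
    alg_cross m h ε₁ ε₂ (X 0) (U 0) (V 0) (R 0) _ _ k.factorial hm.ne' (Xne 0 hJ0) hu hK X20 e12 e22
      R2 hCS T P _ _ _ ha0 hc0 T0 T1 T2 P0' P1' P2',
    alg_det m h ε₁ ε₂ (X 0) (U 0) (V 0) w (R 0) _ _ k.factorial M hm.ne' (Xne 0 hJ0) hu.ne' hR0 X20
      R2 hCS T P Q _ _ _ _ _ _ ha0 ha' hc0 hc' T0 T1 T2 P0' P1' P2' Q0' Q1' Q2', hW]
  have hexp : (2 * (k : ℝ) + 2 + ((p + 1 : ℕ) : ℝ)) / ((k : ℝ) + 1)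
      = ((k : ℝ) + 1 + ((p + 1 : ℕ) : ℝ)) / ((k : ℝ) + 1) + 1 := by
    have : (k : ℝ) + 1 ≠ 0 := by positivity
    field_simp
    ring
  rw [hexp]
  exact alg_pow _ _ _ _ _ _ hu hK hR0


end
end

section
/- Write n = k+1 and assume U^{(n+j)}(0) = 0 for all 1 ≤ j ≤ n−1 (i.e. U^{(n+1)}(0) = … = U^{(2n−1)}(0) = 0). Then for every t ∈ ℝ, the (n,2n)-bias of Ψ at (0,t), namely ‖Ψ_t‖²·det(Ψ_t, ∂_s^{n}Ψ, ∂_s^{2n}Ψ)/‖Ψ_t × ∂_s^{n}Ψ‖³ evaluated at (0,t), equals (ε₁·ε₂/ρ(0))·(m²·U(0)·U^{(2n)}(0)/((n−1)!)² − C(2n−1, n)·h²/(m²·U(0)²)), where C(2n−1, n) is the binomial coefficient. -/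
noncomputable section

open Real

open Filter Topology Set

/-- First-order expansion of `f` at `0` in the variable `w = s ^ n`. -/
structure QExp (n : ℕ) (f : ℝ → ℝ) (a d : ℝ) : Prop where
  val : f 0 = a
  cont : Tendsto f (𝓝[≠] 0) (𝓝 a)
  lim : Tendsto (fun s => (f s - a) / s ^ n) (𝓝[≠] 0) (𝓝 d)

lemma QExp.mul {n : ℕ} {f g : ℝ → ℝ} {a d b e : ℝ} (hf : QExp n f a d) (hg : QExp n g b e) :
    QExp n (fun s => f s * g s) (a * b) (d * b + a * e) := by
  refine ⟨by simp [hf.val, hg.val], hf.cont.mul hg.cont, ?_⟩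
  refine ((hf.lim.mul hg.cont).add (hg.lim.const_mul a)).congr fun s => ?_
  ring

lemma QExp.add {n : ℕ} {f g : ℝ → ℝ} {a d b e : ℝ} (hf : QExp n f a d) (hg : QExp n g b e) :
    QExp n (fun s => f s + g s) (a + b) (d + e) := by
  refine ⟨by simp [hf.val, hg.val], hf.cont.add hg.cont, ?_⟩
  refine (hf.lim.add hg.lim).congr fun s => ?_
  ring

lemma QExp.sub {n : ℕ} {f g : ℝ → ℝ} {a d b e : ℝ} (hf : QExp n f a d) (hg : QExp n g b e) :
    QExp n (fun s => f s - g s) (a - b) (d - e) := by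
  refine ⟨by simp [hf.val, hg.val], hf.cont.sub hg.cont, ?_⟩
  refine (hf.lim.sub hg.lim).congr fun s => ?_
  ring

lemma QExp.const (n : ℕ) (c : ℝ) : QExp n (fun _ => c) c 0 := by
  refine ⟨rfl, tendsto_const_nhds, ?_⟩
  simp

lemma QExp.comp {n : ℕ} {f : ℝ → ℝ} {a d : ℝ} (hf : QExp n f a d) {φ : ℝ → ℝ} {φ' : ℝ}
    (hφ : HasDerivAt φ φ' a) : QExp n (fun s => φ (f s)) (φ a) (φ' * d) := by
  refine ⟨by simp [hf.val], hφ.continuousAt.tendsto.comp hf.cont, ?_⟩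
  have h1 : ContinuousAt (dslope φ a) a := continuousAt_dslope_same.2 hφ.differentiableAt
  have h2 : Tendsto (fun s => dslope φ a (f s)) (𝓝[≠] 0) (𝓝 φ') := by
    have := h1.tendsto.comp hf.cont
    rwa [dslope_same, hφ.deriv] at this
  refine (h2.mul hf.lim).congr fun s => ?_
  have := sub_smul_dslope φ a (f s)
  simp only [smul_eq_mul] at this
  rw [← this]; ring

lemma taylor_lim {J : Set ℝ} (hJo : IsOpen J) (hJc : Convex ℝ J) (hJ0 : (0:ℝ) ∈ J)
    {f : ℝ → ℝ} (hf : ContDiffOn ℝ (⊤ : ℕ∞) f J) {n : ℕ} (hn : 1 ≤ n)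
    (hz : ∀ j, 1 ≤ j → j < n → iteratedDeriv j f 0 = 0) :
    QExp n f (f 0) (iteratedDeriv n f 0 / n.factorial) := by
  refine ⟨rfl, ((hf.continuousOn.continuousAt (hJo.mem_nhds hJ0)).tendsto.mono_left
    nhdsWithin_le_nhds), ?_⟩
  have h := Real.taylor_tendsto (n := n) hJc hJ0 (hf.of_le (by exact_mod_cast le_top))
  rw [hJo.nhdsWithin_eq hJ0] at h
  have h' := (h.mono_left (nhdsWithin_le_nhds (s := {0}ᶜ))).add_const
    (iteratedDeriv n f 0 / n.factorial)
  rw [zero_add] at h'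
  refine h'.congr' ?_
  filter_upwards [self_mem_nhdsWithin] with s hs
  have hs : s ≠ 0 := hs
  rw [taylor_within_apply, Finset.sum_range_succ, Finset.sum_eq_single_of_mem 0
    (Finset.mem_range.2 (by omega))]
  · rw [iteratedDerivWithin_of_isOpen (n := n) hJo hJ0]
    have := n.factorial_ne_zero
    simp
    field_simp
    ring
  · intro j hj hj0
    rw [iteratedDerivWithin_of_isOpen hJo hJ0, hz j (by omega) (Finset.mem_range.1 hj), smul_zero]

lemma QExp.iteratedDeriv_eq {J : Set ℝ} (hJo : IsOpen J) (hJc : Convex ℝ J) (hJ0 : (0:ℝ) ∈ J)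
    {f : ℝ → ℝ} (hf : ContDiffOn ℝ (⊤ : ℕ∞) f J) {n : ℕ} (hn : 1 ≤ n) {a d : ℝ}
    (hq : QExp n f a d) : iteratedDeriv n f 0 = n.factorial * d := by
  have hz : ∀ j, 1 ≤ j → j < n → iteratedDeriv j f 0 = 0 := by
    intro j
    induction j using Nat.strong_induction_on with
    | _ j ih =>
      intro hj1 hjn
      have h := (taylor_lim hJo hJc hJ0 hf hj1 (fun i hi hij => ih i hij hi (by omega))).lim
      have h2 : Tendsto (fun s : ℝ => s ^ (n - j)) (𝓝[≠] 0) (𝓝 0) := by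
        have : Tendsto (fun s : ℝ => s ^ (n - j)) (𝓝 0) (𝓝 (0 ^ (n - j))) :=
          (continuous_pow (n - j)).tendsto 0
        rw [zero_pow (by omega)] at this
        exact this.mono_left nhdsWithin_le_nhds
      have h3 := hq.lim.mul h2
      rw [mul_zero] at h3
      have h4 := tendsto_nhds_unique (h.congr' ?_) h3
      · have := j.factorial_ne_zero
        field_simp at h4
        simpa using h4
      · filter_upwards [self_mem_nhdsWithin] with s hs
        have hs : s ≠ 0 := hs
        have : s ^ n = s ^ j * s ^ (n - j) := by rw [← pow_add]; congr 1; omega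
        rw [this, hq.val]
        field_simp
  have h := (taylor_lim hJo hJc hJ0 hf hn hz).lim
  rw [hq.val] at h
  have h4 := tendsto_nhds_unique h hq.lim
  have := n.factorial_ne_zero
  field_simp at h4
  exact h4

lemma iteratedDeriv_pow_mul {k : ℕ} {g : ℝ → ℝ} (hg : ContDiffAt ℝ (⊤ : ℕ∞) g 0) (j : ℕ) :
    iteratedDeriv j (fun s => s ^ k * g s) 0
      = if k ≤ j then (j.choose k : ℝ) * k.factorial * iteratedDeriv (j - k) g 0 else 0 := by
  rw [iteratedDeriv_fun_mul (f := fun s : ℝ => s ^ k) (contDiff_id.pow k).contDiffAt (hg.of_le (by exact_mod_cast le_top))]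
  simp only [iteratedDeriv_fun_pow_zero]
  split_ifs with h
  · rw [Finset.sum_eq_single_of_mem k (Finset.mem_range.2 (by omega))]
    · simp
    · intro b _ hb
      simp [hb]
  · refine Finset.sum_eq_zero fun b hb => ?_
    have : b ≠ k := by have := Finset.mem_range.1 hb; omega
    simp [this]

lemma iteratedDeriv_of_deriv {J : Set ℝ} (hJo : IsOpen J) (hJ0 : (0:ℝ) ∈ J) {k : ℕ}
    {f g : ℝ → ℝ} (hg : ContDiffOn ℝ (⊤ : ℕ∞) g J) (hf : ∀ s ∈ J, deriv f s = s ^ k * g s)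
    (j : ℕ) :
    iteratedDeriv (j + 1) f 0
      = if k ≤ j then (j.choose k : ℝ) * k.factorial * iteratedDeriv (j - k) g 0 else 0 := by
  rw [iteratedDeriv_succ', ← iteratedDeriv_pow_mul (hg.contDiffAt (hJo.mem_nhds hJ0))]
  refine Filter.EventuallyEq.iteratedDeriv_eq _ ?_
  filter_upwards [hJo.mem_nhds hJ0] with s hs using hf s hs

lemma contDiffOn_of_deriv {J : Set ℝ} (hJo : IsOpen J) {k : ℕ}
    {f g : ℝ → ℝ} (hg : ContDiffOn ℝ (⊤ : ℕ∞) g J)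
    (hf : ∀ s ∈ J, HasDerivAt f (s ^ k * g s) s) : ContDiffOn ℝ (⊤ : ℕ∞) f J := by
  rw [contDiffOn_infty_iff_deriv_of_isOpen hJo]
  refine ⟨fun s hs => (hf s hs).differentiableAt.differentiableWithinAt, ?_⟩
  exact ((contDiff_id.pow k).contDiffOn.mul hg).congr fun s hs => (hf s hs).deriv

lemma QExp.of_deriv {J : Set ℝ} (hJo : IsOpen J) (hJc : Convex ℝ J) (hJ0 : (0:ℝ) ∈ J) {k : ℕ}
    {f g : ℝ → ℝ} (hg : ContDiffOn ℝ (⊤ : ℕ∞) g J)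
    (hf : ∀ s ∈ J, HasDerivAt f (s ^ k * g s) s) : QExp (k + 1) f (f 0) (g 0 / (k + 1)) := by
  have h := taylor_lim hJo hJc hJ0 (contDiffOn_of_deriv hJo hg hf) (n := k + 1) (by omega) ?_
  · rw [iteratedDeriv_of_deriv hJo hJ0 hg (fun s hs => (hf s hs).deriv)] at h
    convert h using 1
    have := k.factorial_ne_zero
    simp [Nat.factorial_succ]
    field_simp
  · intro j hj hjk
    obtain ⟨i, rfl⟩ := Nat.exists_eq_add_of_le' hj
    rw [iteratedDeriv_of_deriv hJo hJ0 hg (fun s hs => (hf s hs).deriv), if_neg (by omega)]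

lemma hasDerivAt_int {J : Set ℝ} (hJo : IsOpen J) (hJc : Convex ℝ J) (hJ0 : (0:ℝ) ∈ J)
    {f : ℝ → ℝ} (hf : ContinuousOn f J) {s : ℝ} (hs : s ∈ J) :
    HasDerivAt (fun s => ∫ ζ in (0:ℝ)..s, f ζ) (f s) s := by
  have hsub : uIcc 0 s ⊆ J := hJc.ordConnected.uIcc_subset hJ0 hs
  exact intervalIntegral.integral_hasDerivAt_right
    ((hf.mono hsub).intervalIntegrable) (hf.stronglyMeasurableAtFilter hJo s hs)
    (hf.continuousAt (hJo.mem_nhds hs))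

lemma iteratedDeriv_apply3 {f : ℝ → Fin 3 → ℝ} (hf : ContDiffAt ℝ (⊤ : ℕ∞) f 0) (n : ℕ)
    (i : Fin 3) : iteratedDeriv n f 0 i = iteratedDeriv n (fun s => f s i) 0 := by
  have := (ContinuousLinearMap.proj (R := ℝ) (φ := fun _ : Fin 3 => ℝ) i).iteratedFDeriv_comp_left
    hf (i := n) (by exact_mod_cast le_top)
  simp only [iteratedDeriv]
  have h2 := congrArg (fun M => M (fun _ : Fin n => (1:ℝ))) this
  exact h2.symm

lemma bias_alg {u v x r m h e2 N v1 u1 x1 r1 t1 a0 a1 T0 T1 G0 G1 : ℝ} (hu : u ≠ 0)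
    (hx : x ≠ 0) (hr : r ≠ 0) (hm : m ≠ 0) (hN : N ≠ 0)
    (he2 : e2 ^ 2 = 1)
    (hx2 : x ^ 2 = m ^ 2 * u ^ 2 - h ^ 2) (hr2 : r ^ 2 = x ^ 2 - m ^ 4 * u ^ 2 * v ^ 2)
    (ha0 : a0 = m ^ 2 * (u * v * x⁻¹)) (hT0 : T0 = -(e2 * h / m) * (r * u⁻¹ * x⁻¹))
    (hG0 : G0 = e2 / m * (r * u⁻¹))
    (hu1 : u1 = v / N) (hx1 : x1 = a0 / N) (ht1 : t1 = T0 * x⁻¹ / N)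
    (hr1 : r1 = (m ^ 2 * u * u1 - m ^ 4 * u * v * (u1 * v + u * v1)) / r)
    (ha1 : a1 = m ^ 2 * (u1 * v * x⁻¹ + u * v1 * x⁻¹ - u * v * x1 / x ^ 2))
    (hT1 : T1 = -(e2 * h / m) * (r1 * u⁻¹ * x⁻¹ - r * u1 / u ^ 2 * x⁻¹ - r * u⁻¹ * x1 / x ^ 2))
    (hG1 : G1 = e2 / m * (r1 * u⁻¹ - r * u1 / u ^ 2)) :
    x * (G0 * (a1 - T0 * t1) - a0 * G1) + h * (a0 * (T1 + a0 * t1) - T0 * (a1 - T0 * t1))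
      = e2 * m * u / r * (m ^ 2 * u * v1 - h ^ 2 / (N * (m ^ 2 * u ^ 2))) := by
  have hh : h ^ 2 = m ^ 2 * u ^ 2 - x ^ 2 := by linarith
  subst hu1 ht1 hx1 hr1 ha1 hT1 hG1 ha0 hT0 hG0
  field_simp
  grind

lemma bias_final {u x m e1 e2 c d r h v1 N F K T0 a0 G0 a1 T1 t1 G1 : ℝ} {A B C : Fin 3 → ℝ}
    (hu : 0 < u) (hm : m ≠ 0) (hF : 0 < F) (he1 : e1 ^ 2 = 1)
    (hcd : c ^ 2 + d ^ 2 = 1)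
    (hx2 : x ^ 2 = m ^ 2 * u ^ 2 - h ^ 2)
    (hort : x * T0 + h * G0 = 0) (hunit : a0 ^ 2 + T0 ^ 2 + G0 ^ 2 = 1)
    (A0 : A 0 = -(e1 / m * x * d)) (A1 : A 1 = e1 / m * x * c) (A2 : A 2 = e1 / m * h)
    (B0 : B 0 = F * (a0 * c - T0 * d)) (B1 : B 1 = F * (a0 * d + T0 * c)) (B2 : B 2 = F * G0)
    (C0 : C 0 = K * ((a1 * c + a0 * (-d * t1)) - (T1 * d + T0 * (c * t1))))
    (C1 : C 1 = K * ((a1 * d + a0 * (c * t1)) + (T1 * c + T0 * (-d * t1))))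
    (C2 : C 2 = K * G1)
    (key : x * (G0 * (a1 - T0 * t1) - a0 * G1) + h * (a0 * (T1 + a0 * t1) - T0 * (a1 - T0 * t1))
      = e2 * m * u / r * (m ^ 2 * u * v1 - h ^ 2 / (N * (m ^ 2 * u ^ 2)))) :
    norm3 A ^ 2 * det3 A B C / norm3 (cross3 A B) ^ 3
      = e1 * e2 / r * (m ^ 2 * u * (K * v1) / F ^ 2 - K / (N * F ^ 2) * h ^ 2 / (m ^ 2 * u ^ 2)) := by
  have hd : d ^ 2 = 1 - c ^ 2 := by linarith
  have hA : dot3 A A = u ^ 2 := by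
    simp only [dot3, A0, A1, A2]
    field_simp
    rw [he1, hd]
    linear_combination hx2
  have hAB : dot3 A B = 0 := by
    simp only [dot3, A0, A1, A2, B0, B1, B2]
    linear_combination (e1 / m * F) * hort + (e1 / m * F * x * T0) * hcd
  have hB : dot3 B B = F ^ 2 := by
    simp only [dot3, B0, B1, B2]
    linear_combination F ^ 2 * hunit + F ^ 2 * (a0 ^ 2 + T0 ^ 2) * hcd
  have hX : dot3 (cross3 A B) (cross3 A B) = (F * u) ^ 2 := by
    have : dot3 (cross3 A B) (cross3 A B) = dot3 A A * dot3 B B - dot3 A B ^ 2 := by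
      simp [dot3, cross3]; ring
    rw [this, hA, hAB, hB]; ring
  have hdet : det3 A B C = e1 / m * F * K *
      (e2 * m * u / r * (m ^ 2 * u * v1 - h ^ 2 / (N * (m ^ 2 * u ^ 2)))) := by
    rw [← key]
    simp only [det3, A0, A1, A2, B0, B1, B2, C0, C1, C2]
    grind
  rw [norm3, norm3, hA, hX, Real.sqrt_sq hu.le, Real.sqrt_sq (by positivity), hdet]
  have := hu.ne'
  have := hF.ne'
  by_cases hr : r = 0
  · simp [hr]
  by_cases hN : N = 0
  · simp [hN]
    field_simp
  field_simp

lemma unit_alg {u v x r m h e2 : ℝ} (hu : u ≠ 0) (hx : x ≠ 0) (hm : m ≠ 0)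
    (he2 : e2 ^ 2 = 1) (hx2 : x ^ 2 = m ^ 2 * u ^ 2 - h ^ 2)
    (hr2 : r ^ 2 = x ^ 2 - m ^ 4 * u ^ 2 * v ^ 2) :
    (m ^ 2 * (u * v * x⁻¹)) ^ 2 + (-(e2 * h / m) * (r * u⁻¹ * x⁻¹)) ^ 2
      + (e2 / m * (r * u⁻¹)) ^ 2 = 1 := by
  have hh : h ^ 2 = m ^ 2 * u ^ 2 - x ^ 2 := by linarith
  field_simp
  rw [he2, hh, hr2]
  ring

set_option maxHeartbeats 1000000

/-- With `n = k+1`, if `U^{(n+1)}(0) = ⋯ = U^{(2n−1)}(0) = 0`, then the `(n,2n)`-bias of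
`Ψ` at `(0,t)`, namely `‖Ψ_t‖² det(Ψ_t, ∂_s^nΨ, ∂_s^{2n}Ψ)/‖Ψ_t × ∂_s^nΨ‖³`, equals
`(ε₁ε₂/ρ(0)) (m²U(0)U^{(2n)}(0)/((n−1)!)² − C(2n−1,n) h²/(m²U(0)²))`. -/
theorem stmt11
    (k : ℕ) (hk : 1 ≤ k)
    (J : Set ℝ) (hJo : IsOpen J) (hJc : Convex ℝ J) (hJ0 : (0:ℝ) ∈ J)
    (U V : ℝ → ℝ) (hU : ContDiff ℝ (⊤ : ℕ∞) U) (hV : ContDiff ℝ (⊤ : ℕ∞) V)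
    (hUpos : ∀ s ∈ J, 0 < U s) (hU' : ∀ s ∈ J, deriv U s = s ^ k * V s)
    (m h : ℝ) (hm : 0 < m)
    (h1 : ∀ s ∈ J, 0 < m ^ 2 * U s ^ 2 - h ^ 2)
    (h2 : ∀ s ∈ J, 0 < m ^ 2 * U s ^ 2 - h ^ 2 - m ^ 4 * U s ^ 2 * V s ^ 2)
    (ε₀ ε₁ ε₂ : ℝ) (he0 : ε₀ = 1 ∨ ε₀ = -1) (he1 : ε₁ = 1 ∨ ε₁ = -1)
    (he2 : ε₂ = 1 ∨ ε₂ = -1)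
    (hvanish : ∀ j : ℕ, 1 ≤ j → j ≤ k → iteratedDeriv (k + 1 + j) U 0 = 0) :
    ∀ t : ℝ,
      norm3 (deriv (fun t' => PsiB U V k m h ε₀ ε₁ ε₂ 0 t') t) ^ 2
          * det3 (deriv (fun t' => PsiB U V k m h ε₀ ε₁ ε₂ 0 t') t)
              (iteratedDeriv (k + 1) (fun s' => PsiB U V k m h ε₀ ε₁ ε₂ s' t) 0)
              (iteratedDeriv (2 * (k + 1)) (fun s' => PsiB U V k m h ε₀ ε₁ ε₂ s' t) 0)
          / norm3 (cross3 (deriv (fun t' => PsiB U V k m h ε₀ ε₁ ε₂ 0 t') t)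
              (iteratedDeriv (k + 1) (fun s' => PsiB U V k m h ε₀ ε₁ ε₂ s' t) 0)) ^ 3
        = (ε₁ * ε₂ / rhoB U V m h 0)
            * (m ^ 2 * U 0 * iteratedDeriv (2 * (k + 1)) U 0 / (k.factorial : ℝ) ^ 2
              - (Nat.choose (2 * (k + 1) - 1) (k + 1) : ℝ) * h ^ 2 / (m ^ 2 * U 0 ^ 2)) := by
  intro t
  have hn : (1:ℕ) ≤ k + 1 := by omega
  have hmne := hm.ne'
  have hUS : ContDiffOn ℝ (⊤ : ℕ∞) U J := hU.contDiffOn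
  have hVS : ContDiffOn ℝ (⊤ : ℕ∞) V J := hV.contDiffOn
  have hUne : ∀ s ∈ J, U s ≠ 0 := fun s hs => (hUpos s hs).ne'
  have he0' : ε₀ * ε₀ = 1 := by rcases he0 with h | h <;> simp [h]
  have he1' : ε₁ ^ 2 = 1 := by rcases he1 with h | h <;> simp [h]
  have he2' : ε₂ ^ 2 = 1 := by rcases he2 with h | h <;> simp [h]
  set x := xB U m h ε₀ with hxdef
  set ρ := rhoB U V m h with hρdef
  set θ := fun s => thetaB U V k m h ε₁ ε₂ s t with hθdef
  set z := zB U V k m h ε₂ with hzdef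
  have hpS : ContDiffOn ℝ (⊤ : ℕ∞) (fun s => m ^ 2 * U s ^ 2 - h ^ 2) J := by fun_prop
  have hxS : ContDiffOn ℝ (⊤ : ℕ∞) x J :=
    contDiffOn_const.mul (hpS.sqrt fun s hs => (h1 s hs).ne')
  have hρS : ContDiffOn ℝ (⊤ : ℕ∞) ρ J := by
    refine ContDiffOn.sqrt (f := fun s => m ^ 2 * U s ^ 2 - h ^ 2 - m ^ 4 * U s ^ 2 * V s ^ 2)
      (by fun_prop) fun s hs => (h2 s hs).ne'
  have hx2 : ∀ s ∈ J, x s ^ 2 = m ^ 2 * U s ^ 2 - h ^ 2 := by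
    intro s hs
    simp only [hxdef, xB]
    rw [mul_pow, Real.sq_sqrt (h1 s hs).le]
    linear_combination (m ^ 2 * U s ^ 2 - h ^ 2) * he0'
  have hxne : ∀ s ∈ J, x s ≠ 0 := by
    intro s hs h0
    have := hx2 s hs
    rw [h0] at this
    have := h1 s hs
    simp_all
  have hρ2 : ∀ s ∈ J, ρ s ^ 2 = x s ^ 2 - m ^ 4 * U s ^ 2 * V s ^ 2 := by
    intro s hs
    simp only [hρdef, rhoB]
    rw [Real.sq_sqrt (h2 s hs).le, hx2 s hs]
  have hρne : ∀ s ∈ J, ρ s ≠ 0 := fun s hs => (Real.sqrt_pos.2 (h2 s hs)).ne'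
  set a : ℝ → ℝ := fun s => m ^ 2 * (U s * V s * (x s)⁻¹) with ha
  set T : ℝ → ℝ := fun s => -(ε₂ * h / m) * (ρ s * (U s)⁻¹ * (x s)⁻¹) with hT
  set G : ℝ → ℝ := fun s => ε₂ / m * (ρ s * (U s)⁻¹) with hG
  have hxiS := hxS.inv hxne
  have hUiS := hUS.inv hUne
  have haS : ContDiffOn ℝ (⊤ : ℕ∞) a J := contDiffOn_const.mul ((hUS.mul hVS).mul hxiS)
  have hTS : ContDiffOn ℝ (⊤ : ℕ∞) T J := contDiffOn_const.mul ((hρS.mul hUiS).mul hxiS)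
  have hGS : ContDiffOn ℝ (⊤ : ℕ∞) G J := contDiffOn_const.mul (hρS.mul hUiS)
  have hΘS : ContDiffOn ℝ (⊤ : ℕ∞) (fun s => T s * (x s)⁻¹) J := hTS.mul hxiS
  have hUd : ∀ s ∈ J, HasDerivAt U (s ^ k * V s) s := by
    intro s hs
    rw [← hU' s hs]
    exact (hU.differentiable (by simp)).differentiableAt.hasDerivAt
  have hxd : ∀ s ∈ J, HasDerivAt x (s ^ k * a s) s := by
    intro s hs
    have hp : HasDerivAt (fun s => m ^ 2 * U s ^ 2 - h ^ 2)
        (m ^ 2 * (2 * U s * (s ^ k * V s))) s := by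
      simpa using (((hUd s hs).pow 2).const_mul (m ^ 2)).sub_const (h ^ 2)
    have := (hp.sqrt (h1 s hs).ne').const_mul ε₀
    refine this.congr_deriv ?_
    have hq : √(m ^ 2 * U s ^ 2 - h ^ 2) ≠ 0 := (Real.sqrt_pos.2 (h1 s hs)).ne'
    have he : ε₀ ≠ 0 := by rintro rfl; simp at he0'
    simp only [ha, hxdef, xB]
    field_simp
    linear_combination (U s * s ^ k * V s) * he0'
  have hθd : ∀ s ∈ J, HasDerivAt θ (s ^ k * (T s * (x s)⁻¹)) s := by
    intro s hs
    have hc : ContinuousOn (fun ζ => ζ ^ k * rhoB U V m h ζ / (U ζ * (m ^ 2 * U ζ ^ 2 - h ^ 2))) J :=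
      ((continuous_pow k).continuousOn.mul hρS.continuousOn).div
        (hUS.continuousOn.mul hpS.continuousOn)
        (fun s hs => mul_ne_zero (hUne s hs) (h1 s hs).ne')
    have := (((hasDerivAt_int hJo hJc hJ0 hc hs).const_mul (ε₂ * h)).const_sub (ε₁ * t)).const_mul
      (1 / m)
    refine this.congr_deriv ?_
    have := hUne s hs
    have := hxne s hs
    rw [← hx2 s hs]
    simp only [hT, ← hρdef]
    field_simp
  have hzd : ∀ s ∈ J, HasDerivAt z (s ^ k * (ε₂ * m * (U s * ρ s * (x s)⁻¹ * (x s)⁻¹))) s := by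
    intro s hs
    have hc : ContinuousOn (fun ζ => ζ ^ k * U ζ * rhoB U V m h ζ / (m ^ 2 * U ζ ^ 2 - h ^ 2)) J :=
      (((continuous_pow k).continuousOn.mul hUS.continuousOn).mul hρS.continuousOn).div
        hpS.continuousOn (fun s hs => (h1 s hs).ne')
    have := (hasDerivAt_int hJo hJc hJ0 hc hs).const_mul (ε₂ * m)
    refine this.congr_deriv ?_
    have := hxne s hs
    rw [← hx2 s hs]
    simp only [← hρdef]
    field_simp
  have hθS := contDiffOn_of_deriv hJo hΘS hθd
  have hcosS : ContDiffOn ℝ (⊤ : ℕ∞) (fun s => Real.cos (θ s)) J := hθS.cos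
  have hsinS : ContDiffOn ℝ (⊤ : ℕ∞) (fun s => Real.sin (θ s)) J := hθS.sin
  set g0 : ℝ → ℝ := fun s => a s * Real.cos (θ s) - T s * Real.sin (θ s) with hg0
  set g1 : ℝ → ℝ := fun s => a s * Real.sin (θ s) + T s * Real.cos (θ s) with hg1
  have hg0S : ContDiffOn ℝ (⊤ : ℕ∞) g0 J := (haS.mul hcosS).sub (hTS.mul hsinS)
  have hg1S : ContDiffOn ℝ (⊤ : ℕ∞) g1 J := (haS.mul hsinS).add (hTS.mul hcosS)
  have hP0 : ∀ s ∈ J, HasDerivAt (fun s => x s * Real.cos (θ s)) (s ^ k * g0 s) s := by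
    intro s hs
    refine ((hxd s hs).mul (hθd s hs).cos).congr_deriv ?_
    have := hxne s hs
    simp only [hg0]
    field_simp
    ring
  have hP1 : ∀ s ∈ J, HasDerivAt (fun s => x s * Real.sin (θ s)) (s ^ k * g1 s) s := by
    intro s hs
    refine ((hxd s hs).mul (hθd s hs).sin).congr_deriv ?_
    have := hxne s hs
    simp only [hg1]
    field_simp
  have hP2 : ∀ s ∈ J, HasDerivAt (fun s => z s + h * θ s) (s ^ k * G s) s := by
    intro s hs
    refine ((hzd s hs).add ((hθd s hs).const_mul h)).congr_deriv ?_
    have := hxne s hs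
    have := hUne s hs
    have := hx2 s hs
    simp only [hT, hG]
    field_simp
    linear_combination (-(s ^ k * ε₂ * ρ s)) * this
  have hΨ : (fun s' => PsiB U V k m h ε₀ ε₁ ε₂ s' t)
      = fun s => ![x s * Real.cos (θ s), x s * Real.sin (θ s), z s + h * θ s] := rfl
  have hΨS : ContDiffAt ℝ (⊤ : ℕ∞)
      (fun s => ![x s * Real.cos (θ s), x s * Real.sin (θ s), z s + h * θ s]) 0 := by
    rw [contDiffAt_pi]
    intro i
    have hJn := hJo.mem_nhds hJ0
    fin_cases i
    · exact (contDiffOn_of_deriv hJo hg0S hP0).contDiffAt hJn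
    · exact (contDiffOn_of_deriv hJo hg1S hP1).contDiffAt hJn
    · exact (contDiffOn_of_deriv hJo hGS hP2).contDiffAt hJn
  have hfac : ((2 * k + 1).choose k : ℝ) * k.factorial * (k + 1).factorial
      = (2 * k + 1).factorial := by
    have := Nat.choose_mul_factorial_mul_factorial (show k ≤ 2 * k + 1 by omega)
    rw [show 2 * k + 1 - k = k + 1 by omega] at this
    exact_mod_cast this
  have low : ∀ (f g : ℝ → ℝ), ContDiffOn ℝ (⊤ : ℕ∞) g J →
      (∀ s ∈ J, HasDerivAt f (s ^ k * g s) s) →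
      iteratedDeriv (k + 1) f 0 = k.factorial * g 0 := by
    intro f g hg hf
    rw [iteratedDeriv_of_deriv hJo hJ0 hg (fun s hs => (hf s hs).deriv)]
    simp
  have high : ∀ (f g : ℝ → ℝ), ContDiffOn ℝ (⊤ : ℕ∞) g J →
      (∀ s ∈ J, HasDerivAt f (s ^ k * g s) s) →
      iteratedDeriv (2 * (k + 1)) f 0
        = ((2 * k + 1).choose k : ℝ) * k.factorial * iteratedDeriv (k + 1) g 0 := by
    intro f g hg hf
    rw [show 2 * (k + 1) = (2 * k + 1) + 1 by ring,
      iteratedDeriv_of_deriv hJo hJ0 hg (fun s hs => (hf s hs).deriv), if_pos (by omega),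
      show 2 * k + 1 - k = k + 1 by omega]
  have high' : ∀ (f g : ℝ → ℝ) (b d : ℝ), ContDiffOn ℝ (⊤ : ℕ∞) g J →
      (∀ s ∈ J, HasDerivAt f (s ^ k * g s) s) → QExp (k + 1) g b d →
      iteratedDeriv (2 * (k + 1)) f 0 = (2 * k + 1).factorial * d := by
    intro f g b d hg hf hq
    rw [high f g hg hf, hq.iteratedDeriv_eq hJo hJc hJ0 hg hn, ← hfac]
    ring
  have qV : QExp (k + 1) V (V 0) (iteratedDeriv (k + 1) V 0 / (k + 1).factorial) := by
    refine taylor_lim hJo hJc hJ0 hVS hn ?_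
    intro j hj hjk
    have hv := hvanish j hj (by omega)
    rw [show k + 1 + j = (k + j) + 1 by ring, iteratedDeriv_of_deriv hJo hJ0 hVS hU',
      if_pos (by omega), show k + j - k = j by omega] at hv
    have c1 : ((k + j).choose k : ℝ) ≠ 0 := by
      exact_mod_cast (Nat.choose_pos (by omega)).ne'
    have c2 : (k.factorial : ℝ) ≠ 0 := by exact_mod_cast k.factorial_ne_zero
    simpa [c1, c2] using hv
  set v1 := iteratedDeriv (k + 1) V 0 / (k + 1).factorial with hv1
  have hU2 := high' U V _ _ hVS hUd qV
  have qU := QExp.of_deriv hJo hJc hJ0 hVS hUd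
  have qx := QExp.of_deriv hJo hJc hJ0 haS hxd
  have qθ := QExp.of_deriv hJo hJc hJ0 hΘS hθd
  have qUi := qU.comp (hasDerivAt_inv (hUne 0 hJ0))
  have qxi := qx.comp (hasDerivAt_inv (hxne 0 hJ0))
  have qcos := qθ.comp (Real.hasDerivAt_cos (θ 0))
  have qsin := qθ.comp (Real.hasDerivAt_sin (θ 0))
  have qUV := qU.mul qV
  have qr := (((QExp.const (k + 1) (m ^ 2)).mul (qU.mul qU)).sub (QExp.const (k + 1) (h ^ 2))).sub
    ((QExp.const (k + 1) (m ^ 4)).mul (qUV.mul qUV))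
  have hr0 : m ^ 2 * (U 0 * U 0) - h ^ 2 - m ^ 4 * (U 0 * V 0 * (U 0 * V 0)) ≠ 0 := by
    have := (h2 0 hJ0).ne'
    convert this using 1
    ring
  have qρ' := qr.comp (Real.hasDerivAt_sqrt hr0)
  have hρe : (fun s => √(m ^ 2 * (U s * U s) - h ^ 2 - m ^ 4 * (U s * V s * (U s * V s)))) = ρ := by
    funext s
    simp only [hρdef, rhoB]
    congr 1
    ring
  have hρe0 := congrFun hρe 0
  rw [hρe, hρe0] at qρ'
  obtain ⟨u1, hu1⟩ : ∃ u1, u1 = V 0 / ((k:ℝ) + 1) := ⟨_, rfl⟩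
  obtain ⟨x1, hx1⟩ : ∃ x1, x1 = a 0 / ((k:ℝ) + 1) := ⟨_, rfl⟩
  rw [← hu1] at qρ' qUi
  rw [← hx1] at qxi
  obtain ⟨r1, qρ, hr1⟩ : ∃ r1, QExp (k + 1) ρ (ρ 0) r1 ∧
      r1 = (m ^ 2 * U 0 * u1 - m ^ 4 * U 0 * V 0 * (u1 * V 0 + U 0 * v1)) / ρ 0 :=
    ⟨_, qρ', by ring⟩
  rw [← hu1] at qU
  obtain ⟨a1, qa, ha1⟩ : ∃ a1, QExp (k + 1) a (a 0) a1 ∧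
      a1 = m ^ 2 * (u1 * V 0 * (x 0)⁻¹ + U 0 * v1 * (x 0)⁻¹ - U 0 * V 0 * x1 / x 0 ^ 2) :=
    ⟨_, (QExp.const (k + 1) (m ^ 2)).mul ((qU.mul qV).mul qxi), by ring⟩
  obtain ⟨T1, qT, hT1⟩ : ∃ T1, QExp (k + 1) T (T 0) T1 ∧
      T1 = -(ε₂ * h / m) * (r1 * (U 0)⁻¹ * (x 0)⁻¹ - ρ 0 * u1 / U 0 ^ 2 * (x 0)⁻¹
        - ρ 0 * (U 0)⁻¹ * x1 / x 0 ^ 2) :=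
    ⟨_, (QExp.const (k + 1) (-(ε₂ * h / m))).mul ((qρ.mul qUi).mul qxi), by ring⟩
  obtain ⟨G1, qG, hG1⟩ : ∃ G1, QExp (k + 1) G (G 0) G1 ∧
      G1 = ε₂ / m * (r1 * (U 0)⁻¹ - ρ 0 * u1 / U 0 ^ 2) :=
    ⟨_, (QExp.const (k + 1) (ε₂ / m)).mul (qρ.mul qUi), by ring⟩
  have qg0 := (qa.mul qcos).sub (qT.mul qsin)
  have qg1 := (qa.mul qsin).add (qT.mul qcos)
  have hθt : ∀ t', thetaB U V k m h ε₁ ε₂ 0 t' = ε₁ / m * t' := by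
    intro t'
    simp only [thetaB, intervalIntegral.integral_same]
    ring
  have hAd : HasDerivAt (fun t' => PsiB U V k m h ε₀ ε₁ ε₂ 0 t')
      ![-(ε₁ / m * x 0 * Real.sin (θ 0)), ε₁ / m * x 0 * Real.cos (θ 0), ε₁ / m * h] t := by
    have hl : HasDerivAt (fun t' => thetaB U V k m h ε₁ ε₂ 0 t') (ε₁ / m) t := by
      simp only [hθt]
      simpa using (hasDerivAt_id t).const_mul (ε₁ / m)
    rw [hasDerivAt_pi]
    intro i
    fin_cases i
    · refine (hl.cos.const_mul (x 0)).congr_deriv ?_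
      simp [hθdef]; ring
    · refine (hl.sin.const_mul (x 0)).congr_deriv ?_
      simp [hθdef]; ring
    · refine ((hl.const_mul h).const_add (z 0)).congr_deriv ?_
      simp; ring
  rw [hAd.deriv, hΨ, hU2]
  have hN : ((k:ℝ) + 1) ≠ 0 := by positivity
  have hchoose : ((2 * (k + 1) - 1).choose (k + 1) : ℝ)
      = (2 * k + 1).factorial / (((k:ℝ) + 1) * (k.factorial : ℝ) ^ 2) := by
    rw [show 2 * (k + 1) - 1 = 2 * k + 1 by omega,
      Nat.choose_symm_of_eq_add (show 2 * k + 1 = (k + 1) + k by ring), ← hfac,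
      Nat.factorial_succ]
    have := k.factorial_ne_zero
    push_cast
    field_simp
  rw [hchoose]
  have hx0 := hxne 0 hJ0
  have hu0 := hUne 0 hJ0
  have hρ0 := hρne 0 hJ0
  have e1 := hx2 0 hJ0
  have e2 := hρ2 0 hJ0
  refine bias_final (x := x 0) (c := Real.cos (θ 0)) (d := Real.sin (θ 0)) (a0 := a 0) (T0 := T 0)
    (G0 := G 0) (t1 := T 0 * (x 0)⁻¹ / (k + 1))
    (hUpos 0 hJ0) hmne (by positivity) he1' (Real.cos_sq_add_sin_sq _) e1 ?_ ?_ rfl rfl rfl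
    ?_ ?_ ?_ ?_ ?_ ?_ ?_ (a1 := a1) (T1 := T1) (G1 := G1)
  · simp only [hT, hG]
    field_simp
    ring
  · exact unit_alg hu0 hx0 hmne he2' e1 e2
  · rw [iteratedDeriv_apply3 hΨS]
    exact low _ _ hg0S hP0
  · rw [iteratedDeriv_apply3 hΨS]
    exact low _ _ hg1S hP1
  · rw [iteratedDeriv_apply3 hΨS]
    exact low _ _ hGS hP2
  · rw [iteratedDeriv_apply3 hΨS]
    exact high' _ _ _ _ hg0S hP0 qg0
  · rw [iteratedDeriv_apply3 hΨS]
    exact high' _ _ _ _ hg1S hP1 qg1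
  · rw [iteratedDeriv_apply3 hΨS]
    exact high' _ _ _ _ hGS hP2 qG
  · exact bias_alg hu0 hx0 hρ0 hmne hN he2' e1 e2 rfl rfl rfl hu1 hx1 rfl hr1 ha1 hT1 hG1

end
end

section
/- Suppose k = 1. Then γ'(0) = 0, and: (i) det(γ''(0), γ'''(0)) = −U(0)²·U'''(0)/Δ; (ii) if U'''(0) = 0, then γ'''(0) = 0 and det(γ''(0), γ^{(5)}(0)) = −U(0)²·U^{(5)}(0)/Δ; (iii) if U'''(0) = 0 and U^{(5)}(0) = 0, then γ^{(5)}(0) = 0 and det(γ''(0), γ^{(7)}(0)) = −U(0)²·U^{(7)}(0)/Δ. -/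
noncomputable section

open Real

/-- Determinant of the 2×2 matrix with columns `a`, `b`. -/
def det2 (a b : ℝ × ℝ) : ℝ := a.1 * b.2 - a.2 * b.1

/-- `λ(s) = √(U(s)² − α)`. -/
def lamC (U : ℝ → ℝ) (α : ℝ) (s : ℝ) : ℝ := Real.sqrt (U s ^ 2 - α)

/-- The profile curve
`γ(s) = (λ(s), ∫₀^s ζ^k U(ζ) √(λ(ζ)² − m²U(ζ)²V(ζ)²)/λ(ζ)² dζ)`. -/
def gamC (U V : ℝ → ℝ) (k : ℕ) (m α : ℝ) (s : ℝ) : ℝ × ℝ :=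
  (lamC U α s,
   ∫ ζ in (0:ℝ)..s,
     ζ ^ k * U ζ * Real.sqrt (lamC U α ζ ^ 2 - m ^ 2 * U ζ ^ 2 * V ζ ^ 2) / lamC U α ζ ^ 2)

open Filter Topology Asymptotics in
theorem aux_taylor {E : Type*} [NormedAddCommGroup E] [NormedSpace ℝ E] (g : ℝ → E) (n : ℕ)
    (hg : ContDiffAt ℝ (⊤ : ℕ∞) g 0) (h0 : ∀ j < n, iteratedDeriv j g 0 = 0) :
    (fun s => g s - (((n.factorial : ℝ)⁻¹ * s ^ n) • iteratedDeriv n g 0)) =o[𝓝 0]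
      fun s : ℝ => s ^ n := by
  have hgn : ContDiffAt ℝ (n : ℕ∞) g 0 := hg.of_le (by exact_mod_cast le_top)
  obtain ⟨u, hu, hgu⟩ := hgn.contDiffOn le_rfl (by simp)
  obtain ⟨r, hr, hru⟩ := Metric.mem_nhds_iff.1 hu
  have h := taylor_isLittleO (convex_ball (0:ℝ) r) (Metric.mem_ball_self hr)
    (hgu.mono hru)
  rw [Metric.isOpen_ball.nhdsWithin_eq (Metric.mem_ball_self hr)] at h
  refine (h.congr_left ?_).congr_right (by simp)
  intro s
  rw [taylor_within_apply, Finset.sum_range_succ, Finset.sum_eq_zero, zero_add,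
    iteratedDerivWithin_of_isOpen Metric.isOpen_ball (Metric.mem_ball_self hr), sub_zero]
  intro j hj
  rw [iteratedDerivWithin_of_isOpen Metric.isOpen_ball (Metric.mem_ball_self hr),
    h0 j (Finset.mem_range.1 hj), smul_zero]

open Filter Topology Asymptotics in
theorem aux_bigO {E : Type*} [NormedAddCommGroup E] [NormedSpace ℝ E] (g : ℝ → E) (n : ℕ)
    (hg : ContDiffAt ℝ (⊤ : ℕ∞) g 0) (h0 : ∀ j < n, iteratedDeriv j g 0 = 0) :
    g =O[𝓝 0] fun s : ℝ => s ^ n := by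
  have h := (aux_taylor g n hg h0).isBigO
  have h2 : (fun s : ℝ => (((n.factorial : ℝ)⁻¹ * s ^ n) • iteratedDeriv n g 0)) =O[𝓝 0]
      fun s : ℝ => s ^ n := by
    refine IsBigO.of_bound (‖(n.factorial : ℝ)⁻¹‖ * ‖iteratedDeriv n g 0‖) ?_
    filter_upwards with s
    rw [norm_smul, norm_mul]
    apply le_of_eq; ring
  simpa using h.add h2

open Filter Topology Asymptotics in
theorem aux_littleo {E : Type*} [NormedAddCommGroup E] [NormedSpace ℝ E] (g : ℝ → E) (n : ℕ)
    (hg : ContDiffAt ℝ (⊤ : ℕ∞) g 0) (h0 : ∀ j ≤ n, iteratedDeriv j g 0 = 0) :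
    g =o[𝓝 0] fun s : ℝ => s ^ n := by
  have h := (aux_taylor g n hg (fun j hj => h0 j hj.le))
  simpa [h0 n le_rfl] using h

open Filter Topology Asymptotics in
theorem aux_zero {E : Type*} [NormedAddCommGroup E] [NormedSpace ℝ E] (g : ℝ → E) (n : ℕ)
    (hg : ContDiffAt ℝ (⊤ : ℕ∞) g 0) (ho : g =o[𝓝 0] fun s : ℝ => s ^ n) :
    ∀ j ≤ n, iteratedDeriv j g 0 = 0 := by
  intro j
  induction j using Nat.strong_induction_on with
  | _ j ih =>
    intro hj
    have h := aux_taylor g j hg (fun i hi => ih i hi (by omega))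
    have h1 : (fun s : ℝ => s ^ n) =O[𝓝 0] fun s : ℝ => s ^ j := by
      obtain ⟨d, rfl⟩ := Nat.exists_eq_add_of_le hj
      have : (fun s : ℝ => s ^ d) =O[𝓝 0] fun _ : ℝ => (1:ℝ) :=
        (continuous_pow d).continuousAt.norm.isBoundedUnder_le.isBigO_one ℝ
      simpa [pow_add] using (isBigO_refl (fun s : ℝ => s ^ j) (𝓝 0)).mul this
    have h2 := (ho.trans_isBigO h1).sub h
    simp only [sub_sub_cancel] at h2
    by_contra hne
    have h3 : (fun s : ℝ => s ^ j) =O[𝓝 0]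
        (fun s : ℝ => (((j.factorial : ℝ)⁻¹ * s ^ j) • iteratedDeriv j g 0)) := by
      refine IsBigO.of_bound (‖(j.factorial : ℝ)⁻¹‖ * ‖iteratedDeriv j g 0‖)⁻¹ ?_
      filter_upwards with s
      rw [norm_smul, norm_mul]
      have hfac : ‖(j.factorial : ℝ)⁻¹‖ ≠ 0 := by
        simp [Nat.factorial_ne_zero]
      generalize ‖(j.factorial : ℝ)⁻¹‖ = y at hfac ⊢
      have : ‖iteratedDeriv j g 0‖ ≠ 0 := by simpa using hne
      apply le_of_eq; field_simp
    have h4 := h3.trans_isLittleO h2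
    have h5 : ∃ᶠ s : ℝ in 𝓝 0, s ^ j ≠ 0 := by
      have : ∃ᶠ s : ℝ in 𝓝[≠] 0, s ^ j ≠ 0 := by
        apply Eventually.frequently
        filter_upwards [self_mem_nhdsWithin] with s hs
        exact pow_ne_zero _ hs
      exact this.filter_mono nhdsWithin_le_nhds
    exact isLittleO_irrefl h5 h4

theorem aux_odd {E : Type*} [NormedAddCommGroup E] [NormedSpace ℝ E] (g : ℝ → E) 
    (hg : ContDiffAt ℝ (⊤ : ℕ∞) g 0) :
    ContDiffAt ℝ (⊤ : ℕ∞) (fun s => g s - g (-s)) 0 ∧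
    ∀ j, iteratedDeriv j (fun s => g s - g (-s)) 0 =
      iteratedDeriv j g 0 - (-1 : ℝ) ^ j • iteratedDeriv j g 0 := by
  have h1 : ContDiffAt ℝ (⊤ : ℕ∞) (fun s : ℝ => g (-s)) 0 := by
    refine ContDiffAt.comp (0:ℝ) (g := g) (f := fun s : ℝ => -s) ?_ contDiffAt_id.neg
    simpa using hg
  refine ⟨hg.sub h1, fun j => ?_⟩
  have := iteratedDeriv_fun_sub (n := j) (hg.of_le (by exact_mod_cast le_top))
    (h1.of_le (by exact_mod_cast le_top))
  rw [this, iteratedDeriv_comp_neg, neg_zero]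

open Filter Topology Asymptotics in
theorem aux_main (U V : ℝ → ℝ) (hU : ContDiff ℝ (⊤ : ℕ∞) U) (hV : ContDiff ℝ (⊤ : ℕ∞) V)
    (F : ℝ × ℝ → ℝ × ℝ) (hF : ContDiffAt ℝ (⊤ : ℕ∞) F (U 0, V 0)) (c : ℝ × ℝ)
    (hc : HasDerivAt (fun v => F (U 0, v)) c (V 0)) (n : ℕ)
    (h1 : ∀ j ≤ n, Odd j → iteratedDeriv j U 0 = 0)
    (h2 : ∀ j < n, Odd j → iteratedDeriv j V 0 = 0) :
    ∀ j ≤ n, Odd j → iteratedDeriv j (fun s => F (U s, V s)) 0 = iteratedDeriv j V 0 • c := by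
  have hUo := aux_odd U hU.contDiffAt
  have hVo := aux_odd V hV.contDiffAt
  have hf : ContDiffAt ℝ (⊤ : ℕ∞) (fun s => F (U s, V s)) 0 :=
    ContDiffAt.comp (0:ℝ) (g := F) (f := fun s => (U s, V s)) hF
      (hU.contDiffAt.prodMk hV.contDiffAt)
  have hfo := aux_odd _ hf
  have hodd : ∀ (g : ℝ → ℝ) (j : ℕ), (Odd j → iteratedDeriv j g 0 = 0) →
      iteratedDeriv j g 0 - (-1 : ℝ) ^ j • iteratedDeriv j g 0 = 0 := by
    intro g j h
    rcases Nat.even_or_odd j with hj | hj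
    · simp [hj.neg_one_pow]
    · simp [h hj]
  have oU : (fun s => U s - U (-s)) =o[𝓝 0] fun s : ℝ => s ^ n :=
    aux_littleo _ n hUo.1 (fun j hj => by rw [hUo.2 j]; exact hodd U j (h1 j hj))
  have oV : (fun s => V s - V (-s)) =O[𝓝 0] fun s : ℝ => s ^ n :=
    aux_bigO _ n hVo.1 (fun j hj => by rw [hVo.2 j]; exact hodd V j (h2 j hj))
  have hs : HasStrictFDerivAt F (fderiv ℝ F (U 0, V 0)) (U 0, V 0) :=
    hF.hasStrictFDerivAt (by simp)
  have hcc : fderiv ℝ F (U 0, V 0) (0, 1) = c := by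
    have h := hs.hasFDerivAt.comp_hasDerivAt (V 0)
      ((hasDerivAt_const (V 0) (U 0)).prodMk (hasDerivAt_id (V 0)))
    exact h.unique hc
  have ht : Tendsto (fun s : ℝ => ((U s, V s), (U (-s), V (-s)))) (𝓝 0)
      (𝓝 ((U 0, V 0), (U 0, V 0))) := by
    have hcU := hU.continuous
    have hcV := hV.continuous
    have : Continuous (fun s : ℝ => ((U s, V s), (U (-s), V (-s)))) := by fun_prop
    simpa using this.tendsto 0
  have h3 := hs.isLittleO.comp_tendsto ht
  have h4 : (fun s : ℝ => (U s, V s) - (U (-s), V (-s))) =O[𝓝 0] fun s : ℝ => s ^ n :=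
    oU.isBigO.prod_left oV
  have h5 := h3.trans_isBigO (g := fun s : ℝ => (U s, V s) - (U (-s), V (-s))) h4
  have h6 : (fun s : ℝ => fderiv ℝ F (U 0, V 0) (U s - U (-s), 0)) =o[𝓝 0] fun s : ℝ => s ^ n :=
    ((fderiv ℝ F (U 0, V 0)).isBigO_comp _ _).trans_isLittleO
      (oU.prod_left (isLittleO_zero _ _))
  have h7 := h5.add h6
  have hVc : ContDiffAt ℝ (⊤ : ℕ∞) (fun s => (V s - V (-s)) • c) 0 := hVo.1.smul contDiffAt_const
  have h8 : ((fun s => F (U s, V s) - F (U (-s), V (-s))) - (fun s => (V s - V (-s)) • c))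
      =o[𝓝 0] fun s : ℝ => s ^ n := by
    refine h7.congr_left fun s => ?_
    simp only [Function.comp, Pi.sub_apply]
    rw [← hcc, ← map_smul, sub_add, ← map_sub]
    simp
  have h9 := aux_zero _ n (hfo.1.sub hVc) h8
  intro j hj hjo
  have h10 := h9 j hj
  rw [iteratedDeriv_fun_sub (hfo.1.of_le (by exact_mod_cast le_top))
    (hVc.of_le (by exact_mod_cast le_top)), hfo.2 j, iteratedDeriv_smul_const
    (hVo.1.of_le (by exact_mod_cast le_top)), hVo.2 j, hjo.neg_one_pow] at h10
  have h11 : (2:ℝ) • (iteratedDeriv j (fun s => F (U s, V s)) 0 - iteratedDeriv j V 0 • c) = 0 := by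
    rw [← h10]
    module
  simpa [sub_eq_zero] using h11

theorem aux_smul {E : Type*} [NormedAddCommGroup E] [NormedSpace ℝ E] (g : ℝ → E) (n : ℕ)
    (hg : ContDiffAt ℝ (⊤ : ℕ∞) g 0) :
    iteratedDeriv (n + 1) (fun s : ℝ => s • g s) 0 = ((n : ℝ) + 1) • iteratedDeriv n g 0 := by
  have h := iteratedDerivWithin_smul (n := n + 1) (f := fun s : ℝ => s) (g := g)
    (Set.mem_univ (0:ℝ)) uniqueDiffOn_univ
    (contDiffAt_id.contDiffWithinAt)
    ((hg.of_le (by exact_mod_cast le_top)).contDiffWithinAt)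
  simp only [iteratedDerivWithin_univ] at h
  have h' : iteratedDeriv (n + 1) (fun s : ℝ => s • g s) 0 = _ := h
  rw [h', Finset.sum_eq_single 1]
  · rw [iteratedDeriv_fun_id]; simp
    norm_cast
  · intro i _ hi
    rw [iteratedDeriv_fun_id]; simp [hi]
  · simp

/-- The map with `γ'(s) = s • F (U s, V s)`. -/
def auxF (m α : ℝ) (p : ℝ × ℝ) : ℝ × ℝ :=
  (p.1 * p.2 / Real.sqrt (p.1 ^ 2 - α),
   p.1 * Real.sqrt (p.1 ^ 2 - m ^ 2 * p.1 ^ 2 * p.2 ^ 2 - α) / (p.1 ^ 2 - α))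

theorem auxF_contDiffAt (m α u v : ℝ) (h1 : 0 < u ^ 2 - α)
    (h2 : 0 < u ^ 2 - m ^ 2 * u ^ 2 * v ^ 2 - α) :
    ContDiffAt ℝ (⊤ : ℕ∞) (auxF m α) (u, v) := by
  have c1 : ContDiffAt ℝ (⊤ : ℕ∞) (fun p : ℝ × ℝ => p.1 ^ 2 - α) (u, v) := by fun_prop
  have c2 : ContDiffAt ℝ (⊤ : ℕ∞)
      (fun p : ℝ × ℝ => p.1 ^ 2 - m ^ 2 * p.1 ^ 2 * p.2 ^ 2 - α) (u, v) := by fun_prop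
  have c3 := c1.sqrt h1.ne'
  have c4 := c2.sqrt h2.ne'
  refine ContDiffAt.prodMk ?_ ?_
  · exact (contDiffAt_fst.mul contDiffAt_snd).div c3 (Real.sqrt_pos.2 h1).ne'
  · exact (contDiffAt_fst.mul c4).div c1 h1.ne'

theorem auxF_hasDerivAt (m α u v : ℝ) (h2 : 0 < u ^ 2 - m ^ 2 * u ^ 2 * v ^ 2 - α) :
    HasDerivAt (fun v => auxF m α (u, v))
      (u / Real.sqrt (u ^ 2 - α),
        u * (-(m ^ 2 * u ^ 2 * (2 * v)) / (2 * Real.sqrt (u ^ 2 - m ^ 2 * u ^ 2 * v ^ 2 - α)))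
          / (u ^ 2 - α)) v := by
  refine HasDerivAt.prodMk ?_ ?_
  · simpa using ((hasDerivAt_id v).const_mul u).div_const (Real.sqrt (u ^ 2 - α))
  · have h : HasDerivAt (fun v : ℝ => u ^ 2 - m ^ 2 * u ^ 2 * v ^ 2 - α)
        (-(m ^ 2 * u ^ 2 * (2 * v))) v := by
      simpa using (((hasDerivAt_pow 2 v).const_mul (m ^ 2 * u ^ 2)).const_sub (u ^ 2)).sub_const α
    exact ((h.sqrt h2.ne').const_mul u).div_const (u ^ 2 - α)

theorem auxF_det (m α u v : ℝ) (h1 : 0 < u ^ 2 - α)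
    (h2 : 0 < u ^ 2 - m ^ 2 * u ^ 2 * v ^ 2 - α) (t : ℝ) :
    det2 (auxF m α (u, v)) (t • (u / Real.sqrt (u ^ 2 - α),
        u * (-(m ^ 2 * u ^ 2 * (2 * v)) / (2 * Real.sqrt (u ^ 2 - m ^ 2 * u ^ 2 * v ^ 2 - α)))
          / (u ^ 2 - α))) = -(u ^ 2) * t
            / (Real.sqrt (u ^ 2 - α) * Real.sqrt (u ^ 2 - m ^ 2 * u ^ 2 * v ^ 2 - α)) := by
  have hL := Real.sqrt_pos.2 h1
  have hR := Real.sqrt_pos.2 h2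
  have hL2 := Real.sq_sqrt h1.le
  have hR2 := Real.sq_sqrt h2.le
  simp only [det2, auxF, Prod.smul_mk, smul_eq_mul]
  rw [← hL2]
  rw [Real.sqrt_sq hL.le]
  set L := Real.sqrt (u ^ 2 - α)
  set R := Real.sqrt (u ^ 2 - m ^ 2 * u ^ 2 * v ^ 2 - α)
  have hk : m ^ 2 * u ^ 2 * v ^ 2 = L ^ 2 - R ^ 2 := by rw [hL2, hR2]; ring
  field_simp
  linear_combination (-(u ^ 2 * t)) * hk

theorem aux_gam_deriv (J : Set ℝ) (hJo : IsOpen J) (hJc : Convex ℝ J) (hJ0 : (0:ℝ) ∈ J)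
    (U V : ℝ → ℝ) (hU : ContDiff ℝ (⊤ : ℕ∞) U) (hV : ContDiff ℝ (⊤ : ℕ∞) V)
    (hU' : ∀ s ∈ J, deriv U s = s ^ 1 * V s) (m α : ℝ)
    (hα1 : ∀ s ∈ J, 0 < U s ^ 2 - α) (s : ℝ) (hs : s ∈ J) :
    HasDerivAt (gamC U V 1 m α) (s • auxF m α (U s, V s)) s := by
  refine HasDerivAt.prodMk ?_ ?_
  · have h := (hU.differentiable (by simp) s).hasDerivAt
    have h' := ((h.pow 2).sub_const α).sqrt (hα1 s hs).ne'
    refine h'.congr_deriv ?_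
    have hL := Real.sqrt_pos.2 (hα1 s hs)
    rw [hU' s hs]
    simp only [auxF, Prod.smul_mk, smul_eq_mul, Pi.pow_apply]
    field_simp
    simp
    ring
  · have hcU := hU.continuous
    have hcV := hV.continuous
    have hcL : Continuous (lamC U α) := by unfold lamC; fun_prop
    have hc : ContinuousOn (fun ζ : ℝ => ζ ^ 1 * U ζ *
        Real.sqrt (lamC U α ζ ^ 2 - m ^ 2 * U ζ ^ 2 * V ζ ^ 2) / lamC U α ζ ^ 2) J := by
      refine ContinuousOn.div (by fun_prop) (by fun_prop) ?_
      intro ζ hζ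
      exact pow_ne_zero _ (Real.sqrt_pos.2 (hα1 ζ hζ)).ne'
    have hsub : Set.uIcc 0 s ⊆ J := hJc.ordConnected.uIcc_subset hJ0 hs
    have h := intervalIntegral.integral_hasDerivAt_right
      ((hc.mono hsub).intervalIntegrable) (hc.stronglyMeasurableAtFilter hJo s hs)
      (hc.continuousAt (hJo.mem_nhds hs))
    refine h.congr_deriv ?_
    simp only [auxF, Prod.smul_mk, smul_eq_mul, lamC]
    rw [Real.sq_sqrt (hα1 s hs).le, pow_one]
    rw [show U s ^ 2 - α - m ^ 2 * U s ^ 2 * V s ^ 2 = U s ^ 2 - m ^ 2 * U s ^ 2 * V s ^ 2 - α by ring]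
    ring

/-- For `k = 1`: `γ'(0) = 0`, `det(γ''(0), γ'''(0)) = −U(0)²U'''(0)/Δ`; if moreover
`U'''(0) = 0` then `γ'''(0) = 0` and `det(γ''(0), γ⁽⁵⁾(0)) = −U(0)²U⁽⁵⁾(0)/Δ`; if also
`U⁽⁵⁾(0) = 0` then `γ⁽⁵⁾(0) = 0` and `det(γ''(0), γ⁽⁷⁾(0)) = −U(0)²U⁽⁷⁾(0)/Δ`. -/
theorem stmt12 (k : ℕ) (hk : k = 1)
    (J : Set ℝ) (hJo : IsOpen J) (hJc : Convex ℝ J) (hJ0 : (0:ℝ) ∈ J)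
    (U V : ℝ → ℝ) (hU : ContDiff ℝ (⊤ : ℕ∞) U) (hV : ContDiff ℝ (⊤ : ℕ∞) V)
    (hUpos : ∀ s ∈ J, 0 < U s) (hU' : ∀ s ∈ J, deriv U s = s ^ k * V s)
    (m α : ℝ) (hm : 0 < m)
    (hα1 : ∀ s ∈ J, 0 < U s ^ 2 - α)
    (hα2 : ∀ s ∈ J, 0 < U s ^ 2 - m ^ 2 * U s ^ 2 * V s ^ 2 - α)
     :
    deriv (gamC U V k m α) 0 = 0
    ∧ det2 (iteratedDeriv 2 (gamC U V k m α) 0) (iteratedDeriv 3 (gamC U V k m α) 0)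
        = -(U 0 ^ 2) * iteratedDeriv 3 U 0
            / (Real.sqrt (U 0 ^ 2 - α)
              * Real.sqrt (U 0 ^ 2 - m ^ 2 * U 0 ^ 2 * V 0 ^ 2 - α))
    ∧ (iteratedDeriv 3 U 0 = 0 →
        iteratedDeriv 3 (gamC U V k m α) 0 = 0
        ∧ det2 (iteratedDeriv 2 (gamC U V k m α) 0) (iteratedDeriv 5 (gamC U V k m α) 0)
            = -(U 0 ^ 2) * iteratedDeriv 5 U 0
                / (Real.sqrt (U 0 ^ 2 - α)
                  * Real.sqrt (U 0 ^ 2 - m ^ 2 * U 0 ^ 2 * V 0 ^ 2 - α)))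
    ∧ (iteratedDeriv 3 U 0 = 0 → iteratedDeriv 5 U 0 = 0 →
        iteratedDeriv 5 (gamC U V k m α) 0 = 0
        ∧ det2 (iteratedDeriv 2 (gamC U V k m α) 0) (iteratedDeriv 7 (gamC U V k m α) 0)
            = -(U 0 ^ 2) * iteratedDeriv 7 U 0
                / (Real.sqrt (U 0 ^ 2 - α)
                  * Real.sqrt (U 0 ^ 2 - m ^ 2 * U 0 ^ 2 * V 0 ^ 2 - α))) := by
  subst hk
  have hJn : J ∈ nhds (0:ℝ) := hJo.mem_nhds hJ0
  have p1 := hα1 0 hJ0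
  have p2 := hα2 0 hJ0
  have hF := auxF_contDiffAt m α (U 0) (V 0) p1 p2
  have hf : ContDiffAt ℝ (⊤ : ℕ∞) (fun s => auxF m α (U s, V s)) 0 :=
    ContDiffAt.comp (0:ℝ) (g := auxF m α) (f := fun s => (U s, V s)) hF
      (hU.contDiffAt.prodMk hV.contDiffAt)
  have hgd := aux_gam_deriv J hJo hJc hJ0 U V hU hV hU' m α hα1
  have hge : deriv (gamC U V 1 m α) =ᶠ[nhds 0] fun s => s • auxF m α (U s, V s) := by
    filter_upwards [hJn] with s hs using (hgd s hs).deriv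
  have hUe : deriv U =ᶠ[nhds 0] fun s => s • V s := by
    filter_upwards [hJn] with s hs
    rw [hU' s hs, pow_one, smul_eq_mul]
  have hg : ∀ n, iteratedDeriv (n + 2) (gamC U V 1 m α) 0 =
      ((n : ℝ) + 1) • iteratedDeriv n (fun s => auxF m α (U s, V s)) 0 := by
    intro n
    rw [iteratedDeriv_succ', hge.iteratedDeriv_eq, aux_smul _ n hf]
  have hu : ∀ n, iteratedDeriv (n + 2) U 0 = ((n : ℝ) + 1) • iteratedDeriv n V 0 := by
    intro n
    rw [iteratedDeriv_succ', hUe.iteratedDeriv_eq, aux_smul _ n hV.contDiffAt]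
  have hu1 : iteratedDeriv 1 U 0 = 0 := by
    rw [iteratedDeriv_one, hU' 0 hJ0]; simp
  have hg2 : iteratedDeriv 2 (gamC U V 1 m α) 0 = auxF m α (U 0, V 0) := by
    have := hg 0
    simpa using this
  have key := aux_main U V hU hV (auxF m α) hF _ (auxF_hasDerivAt m α (U 0) (V 0) p2)
  have fin : ∀ n, Odd n → (∀ j ≤ n, Odd j → iteratedDeriv j U 0 = 0) →
      iteratedDeriv (n + 2) (gamC U V 1 m α) 0 = iteratedDeriv (n + 2) U 0 •
        (U 0 / Real.sqrt (U 0 ^ 2 - α),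
        U 0 * (-(m ^ 2 * U 0 ^ 2 * (2 * V 0)) /
          (2 * Real.sqrt (U 0 ^ 2 - m ^ 2 * U 0 ^ 2 * V 0 ^ 2 - α))) / (U 0 ^ 2 - α)) := by
    intro n hn h
    rw [hg n, hu n, key n h ?_ n le_rfl hn, smul_assoc]
    intro j hj hjo
    have h1 : j + 2 ≤ n := by
      obtain ⟨a, rfl⟩ := hn
      obtain ⟨b, rfl⟩ := hjo
      omega
    have h2 := h (j + 2) h1 (by simpa [Nat.odd_add] using hjo)
    rw [hu j, smul_eq_mul] at h2
    have h3 : (j : ℝ) + 1 ≠ 0 := by positivity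
    exact (mul_eq_zero.1 h2).resolve_left h3
  have f1 := fin 1 (by decide) (by
    intro j hj hjo
    interval_cases j
    · simp at hjo
    · exact hu1)
  have f3 : iteratedDeriv 3 U 0 = 0 → _ := fun h3 => fin 3 (by decide) (by
    intro j hj hjo
    interval_cases j
    · simp at hjo
    · exact hu1
    · exact absurd hjo (by decide)
    · exact h3)
  have f5 : iteratedDeriv 3 U 0 = 0 → iteratedDeriv 5 U 0 = 0 → _ :=
    fun h3 h5 => fin 5 (by decide) (by
    intro j hj hjo
    interval_cases j
    · simp at hjo
    · exact hu1
    · exact absurd hjo (by decide)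
    · exact h3
    · exact absurd hjo (by decide)
    · exact h5)
  norm_num only at f1 f3 f5
  refine ⟨?_, ?_, ?_, ?_⟩
  · rw [(hgd 0 hJ0).deriv, zero_smul]
  · rw [hg2, f1, auxF_det m α _ _ p1 p2]
  · intro h3
    refine ⟨by rw [f1, h3, zero_smul], ?_⟩
    rw [hg2, f3 h3, auxF_det m α _ _ p1 p2]
  · intro h3 h5
    refine ⟨by rw [f3 h3, h5, zero_smul], ?_⟩
    rw [hg2, f5 h3 h5, auxF_det m α _ _ p1 p2]

end
end

section
/- Suppose k = 2. Then γ'(0) = 0 and γ''(0) = 0, and: (i) det(γ'''(0), γ^{(4)}(0)) = −2·U(0)²·U^{(4)}(0)/Δ; (ii) if U^{(4)}(0) = 0, then det(γ'''(0), γ^{(5)}(0)) = −2·U(0)²·U^{(5)}(0)/Δ. -/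
noncomputable section

open Real

section helpers

variable {E : Type*} [NormedAddCommGroup E] [NormedSpace ℝ E]

lemma hlp_diff {J : Set ℝ} (hJ : IsOpen J) {F : ℝ → E}
    (hF : ContDiffOn ℝ (⊤ : ℕ∞) F J) {s : ℝ} (hs : s ∈ J) : HasDerivAt F (deriv F s) s :=
  ((hF.differentiableOn (by simp)).differentiableAt (hJ.mem_nhds hs)).hasDerivAt

lemma hlp_deriv {J : Set ℝ} (hJ : IsOpen J) {F : ℝ → E}
    (hF : ContDiffOn ℝ (⊤ : ℕ∞) F J) : ContDiffOn ℝ (⊤ : ℕ∞) (deriv F) J :=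
  hF.deriv_of_isOpen hJ (by simp)

lemma hlp_congr {J : Set ℝ} (hJ : IsOpen J) {f g : ℝ → E} (h : Set.EqOn f g J)
    {s : ℝ} (hs : s ∈ J) {v : E} (hg : HasDerivAt g v s) : deriv f s = v :=
  (hg.congr_of_eventuallyEq (h.eventuallyEq_of_mem (hJ.mem_nhds hs))).deriv

/-- Derivatives at zero of a function whose derivative is `s ^ 2 • F s`. -/
lemma hlp_main {J : Set ℝ} (hJ : IsOpen J) (h0 : (0:ℝ) ∈ J) {f F : ℝ → E}
    (hF : ContDiffOn ℝ (⊤ : ℕ∞) F J) (hf : ∀ s ∈ J, deriv f s = s ^ 2 • F s) :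
    deriv f 0 = 0 ∧ iteratedDeriv 2 f 0 = 0 ∧ iteratedDeriv 3 f 0 = (2:ℝ) • F 0 ∧
    iteratedDeriv 4 f 0 = (6:ℝ) • deriv F 0 ∧
    iteratedDeriv 5 f 0 = (12:ℝ) • deriv (deriv F) 0 := by
  have hF1 := hlp_deriv hJ hF
  have hF2 := hlp_deriv hJ hF1
  have hF3 := hlp_deriv hJ hF2
  have e1 : Set.EqOn (iteratedDeriv 1 f) (fun s => s ^ 2 • F s) J := by
    intro s hs; rw [iteratedDeriv_one]; exact hf s hs
  have e2 : Set.EqOn (iteratedDeriv 2 f) (fun s => (2 * s) • F s + s ^ 2 • deriv F s) J := by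
    intro s hs
    rw [iteratedDeriv_succ]
    refine hlp_congr hJ e1 hs ?_
    refine ((hasDerivAt_pow 2 s).smul (hlp_diff hJ hF hs)).congr_deriv ?_
    norm_num
    module
  have e3 : Set.EqOn (iteratedDeriv 3 f)
      (fun s => (2:ℝ) • F s + (4 * s) • deriv F s + s ^ 2 • deriv (deriv F) s) J := by
    intro s hs
    rw [iteratedDeriv_succ]
    refine hlp_congr hJ e2 hs ?_
    refine ((((hasDerivAt_id s).const_mul 2).smul (hlp_diff hJ hF hs)).add
      ((hasDerivAt_pow 2 s).smul (hlp_diff hJ hF1 hs))).congr_deriv ?_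
    norm_num
    module
  have e4 : Set.EqOn (iteratedDeriv 4 f)
      (fun s => (6:ℝ) • deriv F s + (6 * s) • deriv (deriv F) s
        + s ^ 2 • deriv (deriv (deriv F)) s) J := by
    intro s hs
    rw [iteratedDeriv_succ]
    refine hlp_congr hJ e3 hs ?_
    refine ((((hlp_diff hJ hF hs).const_smul (2:ℝ)).add
      (((hasDerivAt_id s).const_mul 4).smul (hlp_diff hJ hF1 hs))).add
      ((hasDerivAt_pow 2 s).smul (hlp_diff hJ hF2 hs))).congr_deriv ?_
    norm_num
    module
  refine ⟨by rw [hf 0 h0]; simp, by rw [e2 h0]; simp, by rw [e3 h0]; simp,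
    by rw [e4 h0]; simp, ?_⟩
  rw [iteratedDeriv_succ]
  refine hlp_congr hJ e4 h0 ?_
  refine ((((hlp_diff hJ hF1 h0).const_smul (6:ℝ)).add
      (((hasDerivAt_id (0:ℝ)).const_mul 6).smul (hlp_diff hJ hF2 h0))).add
      ((hasDerivAt_pow 2 (0:ℝ)).smul (hlp_diff hJ hF3 h0))).congr_deriv ?_
  norm_num
  module

lemma hlp_prod {J : Set ℝ} (hJ : IsOpen J) (h0 : (0:ℝ) ∈ J) {A B : ℝ → ℝ}
    (hA : ContDiffOn ℝ (⊤ : ℕ∞) A J) (hB : ContDiffOn ℝ (⊤ : ℕ∞) B J) :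
    deriv (fun s => (A s, B s)) 0 = (deriv A 0, deriv B 0) ∧
    deriv (deriv (fun s => (A s, B s))) 0 = (deriv (deriv A) 0, deriv (deriv B) 0) := by
  have e1 : Set.EqOn (deriv (fun s => (A s, B s))) (fun s => (deriv A s, deriv B s)) J :=
    fun s hs => ((hlp_diff hJ hA hs).prodMk (hlp_diff hJ hB hs)).deriv
  exact ⟨e1 h0, hlp_congr hJ e1 h0
    ((hlp_diff hJ (hlp_deriv hJ hA) h0).prodMk (hlp_diff hJ (hlp_deriv hJ hB) h0))⟩

/-- Product with a function `p` that is flat to second order. -/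
lemma hlp_mul {J : Set ℝ} (hJ : IsOpen J) (h0 : (0:ℝ) ∈ J) {p g : ℝ → ℝ}
    (hp : ContDiffOn ℝ (⊤ : ℕ∞) p J) (hg : ContDiffOn ℝ (⊤ : ℕ∞) g J)
    (hp1 : deriv p 0 = 0) (hp2 : deriv (deriv p) 0 = 0) :
    deriv (fun s => p s * g s) 0 = p 0 * deriv g 0 ∧
    deriv (deriv (fun s => p s * g s)) 0 = p 0 * deriv (deriv g) 0 := by
  have e1 : Set.EqOn (deriv (fun s => p s * g s))
      (fun s => deriv p s * g s + p s * deriv g s) J :=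
    fun s hs => ((hlp_diff hJ hp hs).mul (hlp_diff hJ hg hs)).deriv
  refine ⟨by rw [e1 h0]; simp [hp1], ?_⟩
  refine hlp_congr hJ e1 h0 ?_
  refine (((hlp_diff hJ (hlp_deriv hJ hp) h0).mul (hlp_diff hJ hg h0)).add
    ((hlp_diff hJ hp h0).mul (hlp_diff hJ (hlp_deriv hJ hg) h0))).congr_deriv ?_
  simp [hp1, hp2]

/-- Derivatives of `W = √(1 - m² A²)`. -/
lemma hlp_sqrt {J : Set ℝ} (hJ : IsOpen J) (h0 : (0:ℝ) ∈ J) {A W : ℝ → ℝ} {m : ℝ}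
    (hA : ContDiffOn ℝ (⊤ : ℕ∞) A J) (hW : ContDiffOn ℝ (⊤ : ℕ∞) W J)
    (hWpos : ∀ s ∈ J, 0 < W s) (hWA : ∀ s ∈ J, W s ^ 2 = 1 - m ^ 2 * A s ^ 2) :
    W 0 * deriv W 0 = - m ^ 2 * A 0 * deriv A 0 ∧
    (deriv A 0 = 0 → W 0 * deriv (deriv W) 0 = - m ^ 2 * A 0 * deriv (deriv A) 0) := by
  have e0 : Set.EqOn (fun s => W s ^ 2) (fun s => 1 - m ^ 2 * A s ^ 2) J := hWA
  have e1 : Set.EqOn (fun s => W s * deriv W s) (fun s => - m ^ 2 * A s * deriv A s) J := by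
    intro s hs
    have h1 := hlp_congr hJ e0 hs ((((hlp_diff hJ hA hs).pow 2).const_mul (m ^ 2)).const_sub 1)
    have h2 := ((hlp_diff hJ hW hs).pow 2).deriv
    have h3 := h2.symm.trans h1
    norm_num at h3
    simp only
    linarith
  refine ⟨e1 h0, fun hA0 => ?_⟩
  have hW0 : deriv W 0 = 0 := by
    have := e1 h0
    simp only [hA0, mul_zero] at this
    exact (mul_eq_zero.1 this).resolve_left (hWpos 0 h0).ne'
  have h1 := hlp_congr hJ e1 h0 (((hlp_diff hJ hA h0).const_mul (-m ^ 2)).mul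
    (hlp_diff hJ (hlp_deriv hJ hA) h0))
  have h2 := ((hlp_diff hJ hW h0).mul (hlp_diff hJ (hlp_deriv hJ hW) h0)).deriv
  have h3 := h2.symm.trans h1
  rw [hW0, hA0] at h3
  linarith

end helpers

/-- For `k = 2`: `γ'(0) = 0`, `γ''(0) = 0`,
`det(γ'''(0), γ⁽⁴⁾(0)) = −2U(0)²U⁽⁴⁾(0)/Δ`; and if `U⁽⁴⁾(0) = 0`, then
`det(γ'''(0), γ⁽⁵⁾(0)) = −2U(0)²U⁽⁵⁾(0)/Δ`. -/
theorem stmt13 (k : ℕ) (hk : k = 2)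
    (J : Set ℝ) (hJo : IsOpen J) (hJc : Convex ℝ J) (hJ0 : (0:ℝ) ∈ J)
    (U V : ℝ → ℝ) (hU : ContDiff ℝ (⊤ : ℕ∞) U) (hV : ContDiff ℝ (⊤ : ℕ∞) V)
    (hUpos : ∀ s ∈ J, 0 < U s) (hU' : ∀ s ∈ J, deriv U s = s ^ k * V s)
    (m α : ℝ) (hm : 0 < m)
    (hα1 : ∀ s ∈ J, 0 < U s ^ 2 - α)
    (hα2 : ∀ s ∈ J, 0 < U s ^ 2 - m ^ 2 * U s ^ 2 * V s ^ 2 - α)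
     :
    deriv (gamC U V k m α) 0 = 0
    ∧ iteratedDeriv 2 (gamC U V k m α) 0 = 0
    ∧ det2 (iteratedDeriv 3 (gamC U V k m α) 0) (iteratedDeriv 4 (gamC U V k m α) 0)
        = -2 * U 0 ^ 2 * iteratedDeriv 4 U 0
            / (Real.sqrt (U 0 ^ 2 - α)
              * Real.sqrt (U 0 ^ 2 - m ^ 2 * U 0 ^ 2 * V 0 ^ 2 - α))
    ∧ (iteratedDeriv 4 U 0 = 0 →
        det2 (iteratedDeriv 3 (gamC U V k m α) 0) (iteratedDeriv 5 (gamC U V k m α) 0)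
          = -2 * U 0 ^ 2 * iteratedDeriv 5 U 0
              / (Real.sqrt (U 0 ^ 2 - α)
                * Real.sqrt (U 0 ^ 2 - m ^ 2 * U 0 ^ 2 * V 0 ^ 2 - α))) := by
  subst hk
  have hUJ := hU.contDiffOn (s := J)
  have hVJ := hV.contDiffOn (s := J)
  set l : ℝ → ℝ := lamC U α with hl
  have hlpos : ∀ s ∈ J, 0 < l s := fun s hs => Real.sqrt_pos.2 (hα1 s hs)
  have hlsq : ∀ s ∈ J, l s ^ 2 = U s ^ 2 - α := fun s hs => Real.sq_sqrt (hα1 s hs).le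
  have hlJ : ContDiffOn ℝ (⊤ : ℕ∞) l J :=
    ((hUJ.pow 2).sub contDiffOn_const).sqrt (fun s hs => (hα1 s hs).ne')
  set R : ℝ → ℝ := fun s => Real.sqrt (l s ^ 2 - m ^ 2 * U s ^ 2 * V s ^ 2) with hR
  have hRarg : ∀ s ∈ J, 0 < l s ^ 2 - m ^ 2 * U s ^ 2 * V s ^ 2 := fun s hs => by
    rw [hlsq s hs]; linarith [hα2 s hs]
  have hRpos : ∀ s ∈ J, 0 < R s := fun s hs => Real.sqrt_pos.2 (hRarg s hs)
  have hRsq : ∀ s ∈ J, R s ^ 2 = l s ^ 2 - m ^ 2 * U s ^ 2 * V s ^ 2 :=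
    fun s hs => Real.sq_sqrt (hRarg s hs).le
  have hRJ : ContDiffOn ℝ (⊤ : ℕ∞) R J :=
    ((hlJ.pow 2).sub ((contDiffOn_const.mul (hUJ.pow 2)).mul (hVJ.pow 2))).sqrt
      (fun s hs => (hRarg s hs).ne')
  have hlne : ∀ s ∈ J, l s ≠ 0 := fun s hs => (hlpos s hs).ne'
  set p : ℝ → ℝ := fun s => U s / l s with hp
  set W : ℝ → ℝ := fun s => R s / l s with hW
  set A : ℝ → ℝ := fun s => p s * V s with hA
  set B : ℝ → ℝ := fun s => p s * W s with hB
  have hpJ : ContDiffOn ℝ (⊤ : ℕ∞) p J := hUJ.div hlJ hlne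
  have hWJ : ContDiffOn ℝ (⊤ : ℕ∞) W J := hRJ.div hlJ hlne
  have hAJ : ContDiffOn ℝ (⊤ : ℕ∞) A J := hpJ.mul hVJ
  have hBJ : ContDiffOn ℝ (⊤ : ℕ∞) B J := hpJ.mul hWJ
  -- derivative of l
  have hl' : ∀ s ∈ J, deriv l s = s ^ 2 * A s := by
    intro s hs
    have h1 := hlp_congr hJo (f := fun s => l s ^ 2) (g := fun s => U s ^ 2 - α) hlsq hs
      (((hlp_diff hJo hUJ hs).pow 2).sub_const α)
    have h2 := ((hlp_diff hJo hlJ hs).pow 2).deriv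
    have h3 := h2.symm.trans h1
    rw [hU' s hs] at h3
    norm_num at h3
    have := hlne s hs
    simp only [hA, hp]
    field_simp
    linarith
  have hp' : ∀ s ∈ J, deriv p s = s ^ 2 • ((V s * l s - U s * A s) / l s ^ 2) := by
    intro s hs
    have h1 := ((hlp_diff hJo hUJ hs).div (hlp_diff hJo hlJ hs) (hlne s hs)).deriv
    refine h1.trans ?_
    rw [hU' s hs, hl' s hs, smul_eq_mul]
    ring
  obtain ⟨hp1, hp2, -⟩ := hlp_main hJo hJ0 (((hVJ.mul hlJ).sub (hUJ.mul hAJ)).div (hlJ.pow 2)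
    (fun s hs => pow_ne_zero 2 (hlne s hs))) hp'
  rw [iteratedDeriv_succ, iteratedDeriv_one] at hp2
  obtain ⟨hA1, hA2⟩ := hlp_mul hJo hJ0 hpJ hVJ hp1 hp2
  obtain ⟨hB1, hB2⟩ := hlp_mul hJo hJ0 hpJ hWJ hp1 hp2
  have hWpos : ∀ s ∈ J, 0 < W s := fun s hs => div_pos (hRpos s hs) (hlpos s hs)
  obtain ⟨hW1, hW2⟩ := hlp_sqrt (m := m) hJo hJ0 hAJ hWJ hWpos (by
    intro s hs
    have := hlne s hs
    simp only [hW, hA, hp, div_pow, hRsq s hs]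
    field_simp)
  obtain ⟨-, -, -, hU4, hU5⟩ := hlp_main hJo hJ0 hVJ hU'
  have hg' : ∀ s ∈ J, deriv (gamC U V 2 m α) s = s ^ 2 • (A s, B s) := by
    intro s hs
    have hc : ContinuousOn (fun ζ => ζ ^ 2 * U ζ * R ζ / l ζ ^ 2) J :=
      ((((continuousOn_id).pow 2).mul hUJ.continuousOn).mul hRJ.continuousOn).div
        (hlJ.continuousOn.pow 2) (fun s hs => pow_ne_zero 2 (hlne s hs))
    have hsub : Set.uIcc 0 s ⊆ J := hJc.ordConnected.uIcc_subset hJ0 hs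
    have hint := intervalIntegral.integral_hasDerivAt_right
      ((hc.mono hsub).intervalIntegrable)
      (hc.stronglyMeasurableAtFilter hJo s hs) (hc.continuousAt (hJo.mem_nhds hs))
    refine ((hlp_diff hJo hlJ hs).prodMk hint).deriv.trans ?_
    have := hlne s hs
    refine Prod.ext ?_ ?_
    · simp [hl' s hs]
    · simp only [Prod.smul_mk, smul_eq_mul, hB, hp, hW]
      field_simp
  obtain ⟨g1, g2, g3, g4, g5⟩ := hlp_main hJo hJ0 (hAJ.prodMk hBJ) hg'
  obtain ⟨q1, q2⟩ := hlp_prod hJo hJ0 hAJ hBJ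
  have hl0 := hlne 0 hJ0
  have hR0 := (hRpos 0 hJ0).ne'
  have hs1 : Real.sqrt (U 0 ^ 2 - α) = l 0 := rfl
  have hs2 : Real.sqrt (U 0 ^ 2 - m ^ 2 * U 0 ^ 2 * V 0 ^ 2 - α) = R 0 := by
    simp only [hR, hlsq 0 hJ0]
    congr 1
    ring
  -- the common algebraic computation
  have key : ∀ v w : ℝ, W 0 * w = - m ^ 2 * A 0 * (p 0 * v) →
      A 0 * (p 0 * w) - B 0 * (p 0 * v) = - U 0 ^ 2 * v / (l 0 * R 0) := by
    intro v w h
    have hsq := hRsq 0 hJ0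
    have hw : w = - m ^ 2 * A 0 * (p 0 * v) / W 0 := by
      rw [eq_div_iff (hWpos 0 hJ0).ne', ← h]; ring
    rw [hw]
    simp only [hA, hB, hp, hW]
    field_simp
    rw [hsq]
    ring
  refine ⟨g1, g2, ?_, ?_⟩
  · rw [g3, g4, q1, hA1, hB1, hU4, hs1, hs2]
    rw [hA1] at hW1
    have := key _ _ hW1
    simp only [det2, Prod.smul_mk, smul_eq_mul]
    linear_combination 12 * this
  · intro h4
    rw [hU4] at h4
    have hV1 : deriv V 0 = 0 := by simpa using h4
    rw [g3, g5, q2, hA2, hB2, hU5, hs1, hs2]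
    have hW2' := hW2 (by rw [hA1, hV1, mul_zero])
    rw [hA2] at hW2'
    have := key _ _ hW2'
    simp only [det2, Prod.smul_mk, smul_eq_mul]
    linear_combination 24 * this

end
end

section
/- Let γ : ℝ → ℝ² be a smooth curve and c ∈ ℝ. Then γ has a 7/2-cusp at c (i.e. γ is 𝒜-equivalent at c to the standard (2,7)-cusp t ↦ (t², t⁷)) if and only if there exist k, l ∈ ℝ such that γ satisfies the 7/2-cusp conditions at c with constants (k, l). -/
noncomputable section

open Real

/-- `Φ : W → W'` is a smooth diffeomorphism with smooth inverse `Φinv`. -/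
def SmoothDiffeoOn2 (Φ Φinv : ℝ × ℝ → ℝ × ℝ) (W W' : Set (ℝ × ℝ)) : Prop :=
  ContDiffOn ℝ (⊤ : ℕ∞) Φ W ∧ ContDiffOn ℝ (⊤ : ℕ∞) Φinv W' ∧ Set.MapsTo Φ W W' ∧
    Set.MapsTo Φinv W' W ∧ (∀ p ∈ W, Φinv (Φ p) = p) ∧ (∀ p ∈ W', Φ (Φinv p) = p)

/-- `γ` is `𝒜`-equivalent at `c` to the curve `t ↦ (t^p, t^q)`: there are an open interval
`(a,b) ∋ 0`, a smooth `φ` on `(a,b)` with `φ(0) = c` and nowhere vanishing derivative, open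
sets `W ∋ γ(c)`, `W' ∋ 0`, and a smooth diffeomorphism `Φ : W → W'` with `Φ(γ(c)) = 0`,
such that `Φ(γ(φ(t))) = (t^p, t^q)` whenever `t ∈ (a,b)` and `γ(φ(t)) ∈ W`. -/
def AEquivCurveAt (γ : ℝ → ℝ × ℝ) (c : ℝ) (p q : ℕ) : Prop :=
  ∃ (a b : ℝ) (φ : ℝ → ℝ) (W W' : Set (ℝ × ℝ)) (Φ Φinv : ℝ × ℝ → ℝ × ℝ),
    a < 0 ∧ 0 < b ∧
    ContDiffOn ℝ (⊤ : ℕ∞) φ (Set.Ioo a b) ∧ φ 0 = c ∧ (∀ t ∈ Set.Ioo a b, deriv φ t ≠ 0) ∧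
    IsOpen W ∧ IsOpen W' ∧ γ c ∈ W ∧ ((0, 0) : ℝ × ℝ) ∈ W' ∧
    SmoothDiffeoOn2 Φ Φinv W W' ∧ Φ (γ c) = (0, 0) ∧
    (∀ t ∈ Set.Ioo a b, γ (φ t) ∈ W → Φ (γ (φ t)) = (t ^ p, t ^ q))

/-- `γ` satisfies the 7/2-cusp conditions at `c` with constants `(k, l)`:
`γ'(c) = 0`, `γ''(c) ≠ 0`, `γ'''(c) = k γ''(c)`, `γ⁽⁵⁾(c) − (10/3)k γ⁽⁴⁾(c) = l γ''(c)`,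
and `det(γ''(c), γ⁽⁷⁾(c) − 7k γ⁽⁶⁾(c) − (7l − (70/3)k³) γ⁽⁴⁾(c)) ≠ 0`. -/
def SevenHalfCuspCond (γ : ℝ → ℝ × ℝ) (c k l : ℝ) : Prop :=
  deriv γ c = 0 ∧ iteratedDeriv 2 γ c ≠ 0 ∧
  iteratedDeriv 3 γ c = k • iteratedDeriv 2 γ c ∧
  iteratedDeriv 5 γ c - ((10 / 3 : ℝ) * k) • iteratedDeriv 4 γ c
    = l • iteratedDeriv 2 γ c ∧
  det2 (iteratedDeriv 2 γ c)
    (iteratedDeriv 7 γ c - (7 * k) • iteratedDeriv 6 γ c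
      - (7 * l - (70 / 3 : ℝ) * k ^ 3) • iteratedDeriv 4 γ c) ≠ 0

section Helpers

open scoped ContDiff Topology Nat

/-- Taylor series at `0`. -/
def tay (f : ℝ → ℝ) : PowerSeries ℝ := PowerSeries.mk fun n => iteratedDeriv n f 0 / (n ! : ℝ)

lemma coeff_tay (f : ℝ → ℝ) (n : ℕ) :
    PowerSeries.coeff n (tay f) = iteratedDeriv n f 0 / (n ! : ℝ) := by
  simp [tay]

lemma tay_congr {f g : ℝ → ℝ} (h : f =ᶠ[𝓝 0] g) : tay f = tay g := by
  ext n
  rw [coeff_tay, coeff_tay, h.iteratedDeriv_eq n]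

lemma sm_at {f : ℝ → ℝ} (hf : ContDiff ℝ ∞ f) (n : ℕ) (x : ℝ) : ContDiffAt ℝ n f x :=
  (hf.of_le (by exact_mod_cast le_top)).contDiffAt

lemma tay_add {f g : ℝ → ℝ} (hf : ContDiff ℝ ∞ f) (hg : ContDiff ℝ ∞ g) :
    tay (fun x => f x + g x) = tay f + tay g := by
  ext n
  rw [map_add, coeff_tay, coeff_tay, coeff_tay]
  have := iteratedDeriv_add (sm_at hf n 0) (sm_at hg n 0)
  rw [← add_div, ← this]
  rfl

lemma tay_sub {f g : ℝ → ℝ} (hf : ContDiff ℝ ∞ f) (hg : ContDiff ℝ ∞ g) :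
    tay (fun x => f x - g x) = tay f - tay g := by
  ext n
  rw [map_sub, coeff_tay, coeff_tay, coeff_tay]
  have := iteratedDeriv_sub (sm_at hf n 0) (sm_at hg n 0)
  rw [← sub_div, ← this]
  rfl

lemma tay_mul {f g : ℝ → ℝ} (hf : ContDiff ℝ ∞ f) (hg : ContDiff ℝ ∞ g) :
    tay (fun x => f x * g x) = tay f * tay g := by
  ext n
  rw [PowerSeries.coeff_mul, coeff_tay]
  have := iteratedDeriv_mul (sm_at hf n 0) (sm_at hg n 0)
  rw [show (fun x => f x * g x) = f * g from rfl, this,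
    Finset.Nat.sum_antidiagonal_eq_sum_range_succ_mk, Finset.sum_div]
  refine Finset.sum_congr rfl fun i hi => ?_
  have hi' : i ≤ n := by simpa [Nat.lt_succ_iff] using hi
  rw [coeff_tay, coeff_tay, Nat.cast_choose ℝ hi']
  have h1 : (n ! : ℝ) ≠ 0 := by positivity
  have h2 : (i ! : ℝ) ≠ 0 := by positivity
  have h3 : ((n - i) ! : ℝ) ≠ 0 := by positivity
  field_simp

lemma tay_const (c : ℝ) : tay (fun _ => c) = PowerSeries.C c := by
  ext n
  rw [coeff_tay, iteratedDeriv_const, PowerSeries.coeff_C]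
  split_ifs with h
  · subst h; simp
  · simp

lemma tay_id : tay (fun x => x) = PowerSeries.X := by
  ext n
  rw [coeff_tay, iteratedDeriv_fun_id_zero, PowerSeries.coeff_X]
  split_ifs with h
  · subst h; simp
  · simp

lemma tay_pow {f : ℝ → ℝ} (hf : ContDiff ℝ ∞ f) (n : ℕ) :
    tay (fun x => f x ^ n) = tay f ^ n := by
  induction n with
  | zero => simpa using tay_const 1
  | succ n ih =>
    simp only [pow_succ]
    rw [tay_mul (hf.pow n) hf, ih]

lemma tay_sum {ι : Type*} (s : Finset ι) (f : ι → ℝ → ℝ) (hf : ∀ i, ContDiff ℝ ∞ (f i)) :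
    tay (fun x => ∑ i ∈ s, f i x) = ∑ i ∈ s, tay (f i) := by
  classical
  induction s using Finset.induction_on with
  | empty => simpa using tay_const 0
  | insert a s ha ih =>
    simp only [Finset.sum_insert ha]
    rw [tay_add (hf a) (ContDiff.sum fun i _ => hf i), ih]

lemma sm_deriv {f : ℝ → ℝ} (hf : ContDiff ℝ ∞ f) : ContDiff ℝ ∞ (deriv f) :=
  (contDiff_infty_iff_deriv.1 hf).2

lemma sm_hasDerivAt {f : ℝ → ℝ} (hf : ContDiff ℝ ∞ f) (x : ℝ) : HasDerivAt f (deriv f x) x :=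
  ((contDiff_infty_iff_deriv.1 hf).1 x).hasDerivAt

/-- Parametric averages. -/
def avg (k : ℕ) (G : ℝ → ℝ) (t : ℝ) : ℝ := ∫ s in (0:ℝ)..1, s ^ k * G (t * s)

lemma avg_hasDerivAt {G : ℝ → ℝ} (hG : ContDiff ℝ ∞ G) (k : ℕ) (t : ℝ) :
    HasDerivAt (avg k G) (avg (k + 1) (deriv G) t) t := by
  have hc : Continuous (deriv G) := (sm_deriv hG).continuous
  obtain ⟨C, hC⟩ := (isCompact_Icc (a := -(|t| + 1)) (b := |t| + 1)).exists_bound_of_continuousOn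
    hc.continuousOn
  have hGc := hG.continuous
  refine (intervalIntegral.hasDerivAt_integral_of_dominated_loc_of_deriv_le
    (F := fun t s => s ^ k * G (t * s)) (F' := fun t s => s ^ (k + 1) * deriv G (t * s))
    (bound := fun _ => C) (s := Metric.ball t 1) (Metric.ball_mem_nhds t one_pos) ?_ ?_ ?_ ?_ ?_ ?_).2
  · refine Filter.Eventually.of_forall fun x => ?_
    exact (by fun_prop : Continuous fun s => s ^ k * G (x * s)).aestronglyMeasurable
  · exact (by fun_prop : Continuous fun s => s ^ k * G (t * s)).intervalIntegrable _ _
  · exact (by fun_prop : Continuous fun s => s ^ (k + 1) * deriv G (t * s)).aestronglyMeasurable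
  · refine Filter.Eventually.of_forall fun s hs x hx => ?_
    rw [Set.uIoc_of_le zero_le_one] at hs
    have hx' : |x| ≤ |t| + 1 := by
      have := abs_sub_abs_le_abs_sub x t
      rw [Metric.mem_ball, Real.dist_eq] at hx
      linarith
    have hs' : |s| ≤ 1 := abs_le.2 ⟨by linarith [hs.1], hs.2⟩
    have h1 : ‖deriv G (x * s)‖ ≤ C := by
      apply hC
      rw [Set.mem_Icc, ← abs_le, abs_mul]
      nlinarith [abs_nonneg x, abs_nonneg s]
    rw [norm_mul, norm_pow, Real.norm_eq_abs s]
    have h2 : |s| ^ (k + 1) ≤ 1 := pow_le_one₀ (abs_nonneg _) hs'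
    nlinarith [norm_nonneg (deriv G (x * s))]
  · exact intervalIntegrable_const
  · refine Filter.Eventually.of_forall fun s _ x _ => ?_
    have h1 : HasDerivAt (fun y => y * s) s x := by simpa using (hasDerivAt_id x).mul_const s
    have := ((sm_hasDerivAt hG (x * s)).comp x h1).const_mul (s ^ k)
    exact this.congr_deriv (by ring)

lemma avg_contDiff {G : ℝ → ℝ} (hG : ContDiff ℝ ∞ G) (k : ℕ) : ContDiff ℝ ∞ (avg k G) := by
  rw [contDiff_infty]
  intro n
  induction n generalizing G k with
  | zero =>
    exact contDiff_zero.2 (continuous_iff_continuousAt.2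
      fun t => (avg_hasDerivAt hG k t).continuousAt)
  | succ n ih =>
    have : ((n + 1 : ℕ) : WithTop ℕ∞) = (n : WithTop ℕ∞) + 1 := by norm_cast
    rw [this, contDiff_succ_iff_deriv]
    refine ⟨fun t => (avg_hasDerivAt hG k t).differentiableAt, by simp, ?_⟩
    have h : deriv (avg k G) = avg (k + 1) (deriv G) := by
      ext t; exact (avg_hasDerivAt hG k t).deriv
    rw [h]
    exact ih (sm_deriv hG) (k + 1)

/-- Hadamard's lemma. -/
lemma hadamard {f : ℝ → ℝ} (hf : ContDiff ℝ ∞ f) :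
    ∃ m : ℝ → ℝ, ContDiff ℝ ∞ m ∧ ∀ t, f t = f 0 + t * m t := by
  refine ⟨avg 0 (deriv f), avg_contDiff (sm_deriv hf) 0, fun t => ?_⟩
  have h : ∀ s ∈ Set.uIcc (0:ℝ) 1, HasDerivAt (fun s => f (t * s)) (t * deriv f (t * s)) s := by
    intro s _
    have h1 : HasDerivAt (fun y => t * y) t s := by simpa using (hasDerivAt_id s).const_mul t
    have := (sm_hasDerivAt hf (t * s)).comp s h1
    exact this.congr_deriv (by ring)
  have hc : Continuous (deriv f) := (sm_deriv hf).continuous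
  have h2 := intervalIntegral.integral_eq_sub_of_hasDerivAt h
    ((by fun_prop : Continuous fun s => t * deriv f (t * s)).intervalIntegrable _ _)
  simp only [intervalIntegral.integral_const_mul, mul_one, mul_zero] at h2
  simp only [avg, pow_zero, one_mul]
  linarith

lemma tay_zero_eq (f : ℝ → ℝ) : PowerSeries.coeff 0 (tay f) = f 0 := by
  simp [coeff_tay]

lemma tay_poly_rem {τ R : ℝ → ℝ} (hτ : ContDiff ℝ ∞ τ) (hR : ContDiff ℝ ∞ R) (c : ℕ → ℝ) (N : ℕ) :
    tay (fun s => ∑ i ∈ Finset.range N, c i * τ s ^ i + τ s ^ N * R s) =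
      ∑ i ∈ Finset.range N, PowerSeries.C (c i) * tay τ ^ i + tay τ ^ N * tay R := by
  have h1 : ∀ i, ContDiff ℝ ∞ (fun s => c i * τ s ^ i) := fun i => contDiff_const.mul (hτ.pow i)
  have h2 : ContDiff ℝ ∞ (fun s => ∑ i ∈ Finset.range N, c i * τ s ^ i) :=
    ContDiff.sum fun i _ => h1 i
  rw [tay_add h2 ((hτ.pow N).mul hR), tay_sum _ (fun i s => c i * τ s ^ i) h1,
    tay_mul (hτ.pow N) hR, tay_pow hτ]
  congr 1
  refine Finset.sum_congr rfl fun i _ => ?_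
  rw [tay_mul contDiff_const (hτ.pow i), tay_const, tay_pow hτ]

/-- Taylor expansion with smooth remainder. -/
lemma taylor_rem {f : ℝ → ℝ} (hf : ContDiff ℝ ∞ f) (N : ℕ) :
    ∃ R : ℝ → ℝ, ContDiff ℝ ∞ R ∧
      ∀ t, f t = ∑ i ∈ Finset.range N, PowerSeries.coeff i (tay f) * t ^ i + t ^ N * R t := by
  induction N with
  | zero => exact ⟨f, hf, fun t => by simp⟩
  | succ N ih =>
    obtain ⟨R, hR, h⟩ := ih
    obtain ⟨m, hm, hRm⟩ := hadamard hR
    refine ⟨m, hm, fun t => ?_⟩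
    have key : PowerSeries.coeff N (tay f) = R 0 := by
      have h1 : tay f = tay (fun t => ∑ i ∈ Finset.range N, PowerSeries.coeff i (tay f) * t ^ i
          + t ^ N * R t) := by congr 1; ext t; exact h t
      rw [tay_poly_rem contDiff_fun_id hR (fun i => PowerSeries.coeff i (tay f)) N, tay_id] at h1
      have h4 := congrArg (PowerSeries.coeff N) h1
      simp only [map_add, map_sum] at h4
      rw [Finset.sum_eq_zero] at h4
      · rw [zero_add, PowerSeries.coeff_X_pow_mul', if_pos le_rfl, Nat.sub_self, tay_zero_eq] at h4
        exact h4
      · intro i hi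
        rw [PowerSeries.coeff_C_mul, PowerSeries.coeff_X_pow]
        have : N ≠ i := by simp at hi; omega
        simp [this]
    rw [Finset.sum_range_succ, key, h t, hRm t]
    ring

/-- Taylor coefficients of a composition. -/
lemma tay_comp {f τ : ℝ → ℝ} (hf : ContDiff ℝ ∞ f) (hτ : ContDiff ℝ ∞ τ) (h0 : τ 0 = 0)
    {n N : ℕ} (hn : n < N) :
    PowerSeries.coeff n (tay (fun s => f (τ s))) =
      ∑ i ∈ Finset.range N, PowerSeries.coeff i (tay f) * PowerSeries.coeff n (tay τ ^ i) := by
  obtain ⟨R, hR, h⟩ := taylor_rem hf N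
  have h1 : (fun s => f (τ s)) = fun s =>
      ∑ i ∈ Finset.range N, PowerSeries.coeff i (tay f) * τ s ^ i + τ s ^ N * (R ∘ τ) s := by
    ext s; exact h _
  rw [h1, tay_poly_rem hτ (hR.comp hτ) (fun i => PowerSeries.coeff i (tay f)) N, map_add, map_sum]
  have hX : PowerSeries.X ^ N ∣ tay τ ^ N * tay (R ∘ τ) := by
    refine Dvd.dvd.mul_right (pow_dvd_pow_of_dvd ?_ N) _
    rw [PowerSeries.X_dvd_iff, ← PowerSeries.coeff_zero_eq_constantCoeff_apply, tay_zero_eq, h0]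
  rw [PowerSeries.X_pow_dvd_iff.1 hX n hn, add_zero]
  refine Finset.sum_congr rfl fun i _ => ?_
  rw [PowerSeries.coeff_C_mul]

/-- Germs extend to global smooth functions. -/
lemma extend_smooth {f : ℝ → ℝ} {U : Set ℝ} (hU : IsOpen U) (h0 : (0:ℝ) ∈ U)
    (hf : ContDiffOn ℝ ∞ f U) : ∃ F : ℝ → ℝ, ContDiff ℝ ∞ F ∧ F =ᶠ[𝓝 0] f := by
  obtain ⟨ε, hε, hball⟩ := Metric.isOpen_iff.1 hU 0 h0
  let χ : ContDiffBump (0:ℝ) := ⟨ε / 4, ε / 2, by positivity, by linarith⟩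
  refine ⟨fun x => χ x * f x, ?_, ?_⟩
  · rw [contDiff_iff_contDiffAt]
    intro x
    by_cases hx : x ∈ U
    · exact χ.contDiff.contDiffAt.mul (hf.contDiffAt (hU.mem_nhds hx))
    · have hx2 : x ∈ (tsupport χ)ᶜ := by
        intro h
        rw [χ.tsupport_eq] at h
        exact hx (hball (Metric.closedBall_subset_ball (by show ε / 2 < ε; linarith) h))
      have : (fun x => χ x * f x) =ᶠ[𝓝 x] fun _ => 0 := by
        filter_upwards [(isClosed_tsupport χ).isOpen_compl.mem_nhds hx2] with y hy
        rw [image_eq_zero_of_notMem_tsupport hy, zero_mul]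
      exact contDiffAt_const.congr_of_eventuallyEq this
  · filter_upwards [χ.eventuallyEq_one] with x hx
    rw [hx]; simp

lemma flat_factor {r : ℝ → ℝ} (hr : ContDiff ℝ ∞ r) (h : tay r = 0) :
    ∃ q : ℝ → ℝ, ContDiff ℝ ∞ q ∧ tay q = 0 ∧ ∀ t, r t = t * q t := by
  obtain ⟨q, hq, hqr⟩ := hadamard hr
  have h0 : r 0 = 0 := by rw [← tay_zero_eq r, h]; simp
  have h1 : ∀ t, r t = t * q t := fun t => by rw [hqr t, h0, zero_add]
  refine ⟨q, hq, ?_, h1⟩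
  have h2 : r = fun t => t * q t := funext h1
  rw [h2, tay_mul contDiff_fun_id hq, tay_id] at h
  exact (mul_eq_zero.1 h).resolve_left PowerSeries.X_ne_zero

lemma tay_deriv_flat {r : ℝ → ℝ} (h : tay r = 0) : tay (deriv r) = 0 := by
  ext n
  have := congrArg (PowerSeries.coeff (n + 1)) h
  rw [coeff_tay, iteratedDeriv_succ'] at this
  have hn : ((n + 1) ! : ℝ) ≠ 0 := by positivity
  rw [coeff_tay]
  rw [map_zero, div_eq_zero_iff] at this
  rw [this.resolve_right hn]; simp

lemma flat_at_zero {r : ℝ → ℝ} (h : tay r = 0) : r 0 = 0 := by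
  rw [← tay_zero_eq r, h]; simp

lemma flat_sqrt_deriv {r : ℝ → ℝ} (hr : ContDiff ℝ ∞ r) (h : tay r = 0) :
    ∃ r1 : ℝ → ℝ, ContDiff ℝ ∞ r1 ∧ tay r1 = 0 ∧
      ∀ x, HasDerivAt (fun x => r (√x)) (r1 (√x)) x := by
  obtain ⟨q, hq, hq0, hqr⟩ := flat_factor (sm_deriv hr) (tay_deriv_flat h)
  obtain ⟨p, hp, hp0, hpr⟩ := flat_factor hr h
  obtain ⟨u, hu, hu0, hur⟩ := flat_factor hp hp0
  refine ⟨fun t => (1/2) * q t, contDiff_const.mul hq, ?_, ?_⟩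
  · rw [tay_mul contDiff_const hq, hq0, mul_zero]
  intro x
  by_cases hx : x = 0
  · subst hx
    have h1 : (fun x => r (√x)) = fun x => x * u (√x) := by
      ext x
      rcases le_total 0 x with h | h
      · rw [hpr, hur, ← mul_assoc, Real.mul_self_sqrt h]
      · rw [Real.sqrt_eq_zero_of_nonpos h, flat_at_zero hu0, hpr]; simp
    rw [h1, hasDerivAt_iff_tendsto_slope]
    have h2 : Filter.Tendsto (fun x => u (√x)) (𝓝[≠] 0) (𝓝 (u (√0))) :=
      ((hu.continuous.comp Real.continuous_sqrt).tendsto 0).mono_left nhdsWithin_le_nhds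
    have h3 : (1/2) * q (√0) = u (√0) := by
      rw [Real.sqrt_zero, flat_at_zero hu0, flat_at_zero hq0, mul_zero]
    change Filter.Tendsto _ _ (𝓝 ((1/2) * q (√0)))
    rw [h3]
    refine h2.congr' ?_
    filter_upwards [self_mem_nhdsWithin] with y hy
    have hy : y ≠ 0 := hy
    rw [slope_def_field]; field_simp; ring
  · have := (sm_hasDerivAt hr (√x)).comp x (Real.hasDerivAt_sqrt hx)
    refine this.congr_deriv ?_
    rw [hqr]
    rcases le_or_gt x 0 with h | h
    · rw [Real.sqrt_eq_zero_of_nonpos h]; simp [flat_at_zero hq0]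
    · have := (Real.sqrt_pos.2 h).ne'
      field_simp

lemma flat_sqrt_smooth {r : ℝ → ℝ} (hr : ContDiff ℝ ∞ r) (h : tay r = 0) :
    ContDiff ℝ ∞ (fun x => r (√x)) := by
  rw [contDiff_infty]
  intro n
  induction n generalizing r with
  | zero => exact contDiff_zero.2 (hr.continuous.comp Real.continuous_sqrt)
  | succ n ih =>
    have : ((n + 1 : ℕ) : WithTop ℕ∞) = (n : WithTop ℕ∞) + 1 := by norm_cast
    obtain ⟨r1, h1, h10, hd⟩ := flat_sqrt_deriv hr h
    rw [this, contDiff_succ_iff_deriv]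
    refine ⟨fun t => (hd t).differentiableAt, by simp, ?_⟩
    have h : deriv (fun x => r (√x)) = fun x => r1 (√x) := by
      ext t; exact (hd t).deriv
    rw [h]
    exact ih h1 h10

/-- A bump function equal to one near zero. -/
def chi : ContDiffBump (0:ℝ) := ⟨1, 2, by norm_num, by norm_num⟩

def psi (n : ℕ) (y : ℝ) : ℝ := y ^ n * chi y

lemma psi_smooth (n : ℕ) : ContDiff ℝ ∞ (psi n) := (contDiff_id.pow n).mul chi.contDiff

lemma psi_bound (n k : ℕ) : ∃ C, ∀ y, ‖iteratedDeriv k (psi n) y‖ ≤ C := by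
  have hc : HasCompactSupport (psi n) := chi.hasCompactSupport.mul_left
  have h1 : HasCompactSupport (iteratedDeriv k (psi n)) := by
    rw [iteratedDeriv_eq_iterate]
    induction k with
    | zero => exact hc
    | succ k ih => rw [Function.iterate_succ_apply']; exact ih.deriv
  have h2 : Continuous (iteratedDeriv k (psi n)) :=
    (psi_smooth n).continuous_iteratedDeriv k (by exact_mod_cast le_top)
  exact h2.bounded_above_of_compact_support h1

lemma psi_bound' (n : ℕ) : ∃ C, 0 ≤ C ∧ ∀ k ≤ n, ∀ y, ‖iteratedDeriv k (psi n) y‖ ≤ C := by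
  choose C hC using psi_bound n
  refine ⟨∑ k ∈ Finset.range (n + 1), |C k|, Finset.sum_nonneg fun _ _ => abs_nonneg _, ?_⟩
  intro k hk y
  refine (hC k y).trans ((le_abs_self _).trans ?_)
  exact Finset.single_le_sum (f := fun k => |C k|) (fun _ _ => abs_nonneg _) (by simp; omega)

lemma borel_term (a : ℝ) (n : ℕ) : ∃ f : ℝ → ℝ, ContDiff ℝ ∞ f ∧
    tay f = PowerSeries.C a * PowerSeries.X ^ n ∧
    ∀ k < n, ∀ x, ‖iteratedDeriv k f x‖ ≤ (1/2 : ℝ) ^ n := by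
  obtain ⟨C, hC0, hC⟩ := psi_bound' n
  set L : ℝ := 1 + 2 ^ n * |a| * C with hL
  have hL1 : 1 ≤ L := by rw [hL]; have : 0 ≤ 2 ^ n * |a| * C := by positivity
                         linarith
  have hL0 : 0 < L := by linarith
  have hs : ContDiff ℝ ∞ (fun x => psi n (L * x)) :=
    (psi_smooth n).comp (contDiff_const.mul contDiff_id)
  refine ⟨fun x => (a / L ^ n) * psi n (L * x), contDiff_const.mul hs, ?_, ?_⟩
  · have : (fun x => (a / L ^ n) * psi n (L * x)) =ᶠ[𝓝 0] fun x => a * x ^ n := by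
      have h1 : Filter.Tendsto (fun x : ℝ => L * x) (𝓝 0) (𝓝 0) := by
        have : Continuous fun x : ℝ => L * x := by fun_prop
        simpa using this.tendsto 0
      filter_upwards [h1.eventually chi.eventuallyEq_one] with x hx
      rw [psi, hx, mul_pow]
      simp only [Pi.one_apply]
      field_simp
    rw [tay_congr this, tay_mul contDiff_const (contDiff_fun_id.pow n), tay_const,
      tay_pow contDiff_fun_id, tay_id]
  · intro k hk x
    rw [iteratedDeriv_const_mul_field]
    have h1 := iteratedDeriv_comp_const_mul (n := k)
      ((psi_smooth n).of_le (by exact_mod_cast le_top)) L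
    rw [h1]
    simp only [norm_mul, norm_div, norm_pow, Real.norm_eq_abs, abs_of_pos hL0]
    have h2 := hC k hk.le (L * x)
    rw [Real.norm_eq_abs] at h2
    obtain ⟨d, rfl⟩ : ∃ d, n = k + 1 + d := ⟨n - (k + 1), by omega⟩
    set n := k + 1 + d
    have h3 : |a| / L ^ n * (L ^ k * |iteratedDeriv k (psi n) (L * x)|) ≤ |a| * C / L := by
      have : |a| / L ^ n * (L ^ k * |iteratedDeriv k (psi n) (L * x)|) =
        |a| * |iteratedDeriv k (psi n) (L * x)| / L * (1 / L ^ d) := by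
        simp only [n, pow_add, pow_one]; field_simp
      rw [this]
      have h4 : 1 / L ^ d ≤ 1 := by
        rw [div_le_one (by positivity)]; exact one_le_pow₀ hL1
      calc _ ≤ |a| * |iteratedDeriv k (psi n) (L * x)| / L * 1 := by gcongr
        _ ≤ _ := by rw [mul_one]; gcongr
    refine h3.trans ?_
    rw [div_le_iff₀ hL0, hL]
    have h5 : (1/2 : ℝ) ^ n * 2 ^ n = 1 := by rw [← mul_pow]; norm_num
    have h6 : (0:ℝ) ≤ (1/2 : ℝ) ^ n := by positivity
    calc |a| * C = ((1/2 : ℝ) ^ n * 2 ^ n) * (|a| * C) := by rw [h5, one_mul]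
      _ ≤ _ := by nlinarith

/-- Borel's lemma. -/
lemma borel_lemma (P : PowerSeries ℝ) : ∃ g : ℝ → ℝ, ContDiff ℝ ∞ g ∧ tay g = P := by
  choose f hf hft hfb using fun n => borel_term (PowerSeries.coeff n P) n
  have hsum : Summable (fun n : ℕ => (1/2 : ℝ) ^ n) := summable_geometric_two
  have hG : ContDiff ℝ ∞ (fun x => ∑' n, f n x) := by
    refine contDiff_tsum_of_eventually (v := fun _ n => (1/2 : ℝ) ^ n) hf (fun _ _ => hsum) ?_
    intro k _
    rw [Nat.cofinite_eq_atTop]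
    filter_upwards [Filter.eventually_gt_atTop k] with n hn x
    rw [norm_iteratedFDeriv_eq_norm_iteratedDeriv]
    exact hfb n k hn x
  refine ⟨_, hG, ?_⟩
  ext k
  have hsum' : Summable (fun n : ℕ => (1/2 : ℝ) ^ (n + (k + 1))) :=
    (summable_nat_add_iff (k + 1)).2 hsum
  have hH : ContDiff ℝ ∞ (fun x => ∑' n, f (n + (k + 1)) x) := by
    refine contDiff_tsum_of_eventually (v := fun _ n => (1/2 : ℝ) ^ (n + (k + 1)))
      (fun n => hf _) (fun _ _ => hsum') ?_
    intro j _
    rw [Nat.cofinite_eq_atTop]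
    filter_upwards [Filter.eventually_gt_atTop j] with n hn x
    rw [norm_iteratedFDeriv_eq_norm_iteratedDeriv]
    exact hfb _ j (by omega) x
  have hsplit : (fun x => ∑' n, f n x) = fun x => (∑ n ∈ Finset.range (k + 1), f n x) +
      ∑' n, f (n + (k + 1)) x := by
    ext x
    have hs : Summable (fun n => f n x) := by
      rw [← summable_nat_add_iff 1]
      refine Summable.of_norm_bounded ((summable_nat_add_iff 1).2 hsum) fun n => ?_
      simpa using hfb (n + 1) 0 (by omega) x
    exact (hs.sum_add_tsum_nat_add (k + 1)).symm
  have htail : iteratedDeriv k (fun x => ∑' n, f (n + (k + 1)) x) 0 = 0 := by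
    rw [iteratedDeriv_eq_iteratedFDeriv]
    rw [iteratedFDeriv_tsum_apply (N := (k : ℕ∞)) (v := fun _ n => (1/2 : ℝ) ^ (n + (k + 1)))
      (fun n => (hf _).of_le (by exact_mod_cast le_top)) (fun _ _ => hsum') ?_ le_rfl]
    · have : ∀ n, iteratedFDeriv ℝ k (f (n + (k + 1))) 0 = 0 := by
        intro n
        rw [← norm_eq_zero, norm_iteratedFDeriv_eq_norm_iteratedDeriv, norm_eq_zero]
        have h1 := congrArg (PowerSeries.coeff k) (hft (n + (k + 1)))
        rw [coeff_tay, PowerSeries.coeff_C_mul, PowerSeries.coeff_X_pow,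
          if_neg (by omega), mul_zero, div_eq_zero_iff] at h1
        exact h1.resolve_right (by positivity)
      simp [this]
    · intro j n x hj
      have hj : j ≤ k := by exact_mod_cast hj
      rw [norm_iteratedFDeriv_eq_norm_iteratedDeriv]
      exact hfb _ j (by omega) x
  rw [hsplit, tay_add (ContDiff.sum fun i _ => hf i) hH, tay_sum _ _ hf, map_add, map_sum,
    coeff_tay (fun x => ∑' n, f (n + (k + 1)) x), htail, zero_div, add_zero]
  rw [Finset.sum_range_succ, Finset.sum_eq_zero, hft, PowerSeries.coeff_C_mul,
    PowerSeries.coeff_X_pow, if_pos rfl, mul_one, zero_add]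
  intro i hi
  rw [hft, PowerSeries.coeff_C_mul, PowerSeries.coeff_X_pow, if_neg, mul_zero]
  simp at hi; omega

lemma tay_even_odd {f : ℝ → ℝ} (he : ∀ t, f (-t) = f t) {n : ℕ} (hn : Odd n) :
    PowerSeries.coeff n (tay f) = 0 := by
  rw [coeff_tay]
  have h := iteratedDeriv_comp_neg n f 0
  rw [funext he, hn.neg_one_pow, neg_zero, smul_eq_mul] at h
  rw [show iteratedDeriv n f 0 = 0 by linarith, zero_div]

/-- Whitney's theorem on smooth even functions. -/
lemma whitney_even {f : ℝ → ℝ} (hf : ContDiff ℝ ∞ f) (he : ∀ t, f (-t) = f t) :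
    ∃ g : ℝ → ℝ, ContDiff ℝ ∞ g ∧ ∀ t, f t = g (t ^ 2) := by
  obtain ⟨b, hb, hbt⟩ := borel_lemma (PowerSeries.mk fun n => PowerSeries.coeff (2 * n) (tay f))
  have hsq : ContDiff ℝ ∞ (fun t : ℝ => t ^ 2) := contDiff_fun_id.pow 2
  have hbs : ContDiff ℝ ∞ (fun t => b (t ^ 2)) := hb.comp hsq
  have hr : ContDiff ℝ ∞ (fun t => f t - b (t ^ 2)) := hf.sub hbs
  have ht : tay (fun t => f t - b (t ^ 2)) = 0 := by
    ext n
    rcases Nat.even_or_odd n with hn | hn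
    · obtain ⟨m, rfl⟩ := hn
      rw [tay_sub hf hbs, map_sub, tay_comp hb hsq (by simp) (Nat.lt_succ_self (m + m)),
        tay_pow contDiff_fun_id, tay_id, Finset.sum_eq_single m]
      · rw [← pow_mul, PowerSeries.coeff_X_pow, if_pos (by ring), hbt, PowerSeries.coeff_mk,
          two_mul]; simp
      · intro i _ hi
        rw [← pow_mul, PowerSeries.coeff_X_pow, if_neg (by omega), mul_zero]
      · intro h; simp at h
    · rw [tay_even_odd (fun t => by simp [he]) hn]; simp
  refine ⟨fun x => b x + (fun t => f t - b (t ^ 2)) (√x), hb.add (flat_sqrt_smooth hr ht), ?_⟩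
  intro t
  simp only []
  rw [Real.sqrt_sq_eq_abs]
  rcases abs_choice t with h | h <;> rw [h] <;> simp [he]

lemma tay_one_eq (f : ℝ → ℝ) : PowerSeries.coeff 1 (tay f) = deriv f 0 := by
  simp [coeff_tay]

/-- Local smooth inverses. -/
lemma smooth_inverse {τ : ℝ → ℝ} (hτ : ContDiff ℝ ∞ τ) (h0 : τ 0 = 0) (h1 : deriv τ 0 ≠ 0) :
    ∃ σ : ℝ → ℝ, ContDiff ℝ ∞ σ ∧ σ 0 = 0 ∧ deriv σ 0 ≠ 0 ∧
      (∀ᶠ t in 𝓝 0, τ (σ t) = t) ∧ (∀ᶠ s in 𝓝 0, σ (τ s) = s) := by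
  have hd : HasFDerivAt τ
      (ContinuousLinearEquiv.unitsEquivAut ℝ (Units.mk0 (deriv τ 0) h1) : ℝ →L[ℝ] ℝ) 0 := by
    refine (sm_hasDerivAt hτ 0).hasFDerivAt.congr_fderiv ?_
    refine ContinuousLinearMap.ext fun x => ?_
    simp
  have hat : ContDiffAt ℝ ∞ τ 0 := hτ.contDiffAt
  let e := hat.toOpenPartialHomeomorph τ hd (by simp)
  have he : (e : ℝ → ℝ) = τ := rfl
  have hs0 : (0:ℝ) ∈ e.source := hat.mem_toOpenPartialHomeomorph_source hd (by simp)
  have ht0 : (0:ℝ) ∈ e.target := by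
    have := e.map_source hs0
    rwa [he, h0] at this
  have hes0 : e.symm 0 = 0 := by
    have := e.left_inv hs0
    rwa [he, h0] at this
  have hcd : Continuous (deriv τ) := (sm_deriv hτ).continuous
  have hopen : IsOpen {x | deriv τ x ≠ 0} := isOpen_ne_fun hcd continuous_const
  let U : Set ℝ := e.target ∩ e.symm ⁻¹' {x | deriv τ x ≠ 0}
  have hU : IsOpen U := e.isOpen_inter_preimage_symm hopen
  have h0U : (0:ℝ) ∈ U := ⟨ht0, by simpa [hes0] using h1⟩
  have hsm : ContDiffOn ℝ ∞ e.symm U := by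
    intro y hy
    have : HasFDerivAt e
        (ContinuousLinearEquiv.unitsEquivAut ℝ (Units.mk0 (deriv τ (e.symm y)) hy.2) : ℝ →L[ℝ] ℝ)
        (e.symm y) := by
      refine (sm_hasDerivAt hτ (e.symm y)).hasFDerivAt.congr_fderiv ?_
      refine ContinuousLinearMap.ext fun x => ?_
      simp
    exact (e.contDiffAt_symm hy.1 this hτ.contDiffAt).contDiffWithinAt
  obtain ⟨σ, hσ, hσe⟩ := extend_smooth hU h0U hsm
  have hr : ∀ᶠ t in 𝓝 0, τ (σ t) = t := by
    filter_upwards [hσe, e.open_target.mem_nhds ht0] with t ht htt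
    rw [ht]; exact e.right_inv htt
  have hσ0 : σ 0 = 0 := by rw [hσe.self_of_nhds, hes0]
  refine ⟨σ, hσ, hσ0, ?_, hr, ?_⟩
  · intro hz
    have h2 : HasDerivAt τ (deriv τ 0) (σ 0) := by rw [hσ0]; exact sm_hasDerivAt hτ 0
    have h3 := h2.comp 0 (sm_hasDerivAt hσ 0)
    have h4 : HasDerivAt (τ ∘ σ) 1 0 := (hasDerivAt_id (0:ℝ)).congr_of_eventuallyEq hr
    have := h3.unique h4
    rw [hz, mul_zero] at this
    exact zero_ne_one this
  · have ht : Filter.Tendsto τ (𝓝 0) (𝓝 0) := by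
      have := hτ.continuous.tendsto 0
      rwa [h0] at this
    filter_upwards [ht.eventually hσe, e.open_source.mem_nhds hs0] with s hs hss
    rw [hs]; exact e.left_inv hss

/-- `f = o(t^N)` kills the Taylor coefficients up to order `N`. -/
lemma tay_littleO {f : ℝ → ℝ} (hf : ContDiff ℝ ∞ f) {N : ℕ}
    (h : f =o[𝓝 0] fun t => t ^ N) : ∀ n ≤ N, PowerSeries.coeff n (tay f) = 0 := by
  intro n
  induction n using Nat.strong_induction_on with
  | _ n ih =>
    intro hn
    obtain ⟨R, hR, hfR⟩ := taylor_rem hf n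
    have h1 : ∀ t, f t = t ^ n * R t := by
      intro t
      rw [hfR t, Finset.sum_eq_zero, zero_add]
      intro i hi
      rw [ih i (by simpa using hi) (by simp at hi; omega), zero_mul]
    have h2 : PowerSeries.coeff n (tay f) = R 0 := by
      rw [funext h1, tay_mul (contDiff_fun_id.pow n) hR, tay_pow contDiff_fun_id, tay_id,
        PowerSeries.coeff_X_pow_mul', if_pos le_rfl, Nat.sub_self, tay_zero_eq]
    rw [h2]
    have h3 : (fun t : ℝ => t ^ N) =O[𝓝 0] fun t => t ^ n := by
      obtain ⟨d, rfl⟩ := Nat.exists_eq_add_of_le hn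
      simp only [pow_add]
      have : (fun t : ℝ => t ^ d) =O[𝓝 0] fun _ => (1:ℝ) :=
        ((continuous_pow d).tendsto 0).isBigO_one ℝ
      simpa using (Asymptotics.isBigO_refl (fun t : ℝ => t ^ n) (𝓝 0)).mul this
    have h4 := (h.trans_isBigO h3).tendsto_div_nhds_zero
    have h5 : Filter.Tendsto R (𝓝[≠] 0) (𝓝 0) := by
      refine (h4.mono_left nhdsWithin_le_nhds).congr' ?_
      filter_upwards [self_mem_nhdsWithin] with t ht
      have ht : t ≠ 0 := ht
      rw [h1]; field_simp
    exact tendsto_nhds_unique ((hR.continuous.tendsto 0).mono_left nhdsWithin_le_nhds) h5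

/-- Explicit Taylor coefficients of a composition up to order seven. -/
lemma comp_coeffs {f τ : ℝ → ℝ} (hf : ContDiff ℝ ∞ f) (hτ : ContDiff ℝ ∞ τ) (h0 : τ 0 = 0)
    {a b : ℕ → ℝ} (ha : ∀ n, a n = PowerSeries.coeff n (tay τ))
    (hb : ∀ n, b n = PowerSeries.coeff n (tay f)) :
    PowerSeries.coeff 0 (tay (fun s => f (τ s))) = b 0 ∧
    PowerSeries.coeff 1 (tay (fun s => f (τ s))) = b 1 * a 1 ∧
    PowerSeries.coeff 2 (tay (fun s => f (τ s))) = b 1 * a 2 + b 2 * a 1 ^ 2 ∧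
    PowerSeries.coeff 3 (tay (fun s => f (τ s))) =
      b 1 * a 3 + b 2 * (2 * a 1 * a 2) + b 3 * a 1 ^ 3 ∧
    PowerSeries.coeff 4 (tay (fun s => f (τ s))) =
      b 1 * a 4 + b 2 * (2 * a 1 * a 3 + a 2 ^ 2) + b 3 * (3 * a 1 ^ 2 * a 2) + b 4 * a 1 ^ 4 ∧
    PowerSeries.coeff 5 (tay (fun s => f (τ s))) =
      b 1 * a 5 + b 2 * (2 * a 1 * a 4 + 2 * a 2 * a 3) +
      b 3 * (3 * a 1 ^ 2 * a 3 + 3 * a 1 * a 2 ^ 2) + b 4 * (4 * a 1 ^ 3 * a 2) + b 5 * a 1 ^ 5 ∧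
    PowerSeries.coeff 6 (tay (fun s => f (τ s))) =
      b 1 * a 6 + b 2 * (2 * a 1 * a 5 + 2 * a 2 * a 4 + a 3 ^ 2) +
      b 3 * (3 * a 1 ^ 2 * a 4 + 6 * a 1 * a 2 * a 3 + a 2 ^ 3) +
      b 4 * (4 * a 1 ^ 3 * a 3 + 6 * a 1 ^ 2 * a 2 ^ 2) + b 5 * (5 * a 1 ^ 4 * a 2) +
      b 6 * a 1 ^ 6 ∧
    PowerSeries.coeff 7 (tay (fun s => f (τ s))) =
      b 1 * a 7 + b 2 * (2 * a 1 * a 6 + 2 * a 2 * a 5 + 2 * a 3 * a 4) +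
      b 3 * (3 * a 1 ^ 2 * a 5 + 6 * a 1 * a 2 * a 4 + 3 * a 1 * a 3 ^ 2 + 3 * a 2 ^ 2 * a 3) +
      b 4 * (4 * a 1 ^ 3 * a 4 + 12 * a 1 ^ 2 * a 2 * a 3 + 4 * a 1 * a 2 ^ 3) +
      b 5 * (5 * a 1 ^ 4 * a 3 + 10 * a 1 ^ 3 * a 2 ^ 2) + b 6 * (6 * a 1 ^ 5 * a 2) +
      b 7 * a 1 ^ 7 := by
  have key : ∀ n < 8, PowerSeries.coeff n (tay (fun s => f (τ s))) =
      ∑ i ∈ Finset.range 8, b i * PowerSeries.coeff n (tay τ ^ i) := by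
    intro n hn
    rw [tay_comp hf hτ h0 hn]
    exact Finset.sum_congr rfl fun i _ => by rw [hb]
  have a0 : a 0 = 0 := by rw [ha, tay_zero_eq, h0]
  have e1 : ∀ n, PowerSeries.coeff n (tay τ) = a n := fun n => (ha n).symm
  generalize tay τ = T at *
  have hmul : ∀ i n, PowerSeries.coeff n (T ^ (i + 1)) =
      ∑ j ∈ Finset.range (n + 1), PowerSeries.coeff j (T ^ i) * a (n - j) := by
    intro i n
    rw [pow_succ, PowerSeries.coeff_mul, Finset.Nat.sum_antidiagonal_eq_sum_range_succ_mk]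
    simp only [e1]
  have p0 : ∀ n, PowerSeries.coeff n (T ^ 0) = if n = 0 then 1 else 0 := by
    intro n; rw [pow_zero, PowerSeries.coeff_one]
  generalize hc : (fun i n => PowerSeries.coeff n (T ^ i)) = c
  have hc' : ∀ i n, PowerSeries.coeff n (T ^ i) = c i n := fun i n => by rw [← hc]
  simp only [hc'] at hmul p0 key
  have c1_0 : c 1 0 = a 0 := by
    rw [hmul 0 0]; simp [p0]
  have c1_1 : c 1 1 = a 1 := by
    rw [hmul 0 1]; simp [p0]
  have c1_2 : c 1 2 = a 2 := by
    rw [hmul 0 2]; simp [p0]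
  have c1_3 : c 1 3 = a 3 := by
    rw [hmul 0 3]; simp [p0]
  have c1_4 : c 1 4 = a 4 := by
    rw [hmul 0 4]; simp [p0]
  have c1_5 : c 1 5 = a 5 := by
    rw [hmul 0 5]; simp [p0]
  have c1_6 : c 1 6 = a 6 := by
    rw [hmul 0 6]; simp [p0]
  have c1_7 : c 1 7 = a 7 := by
    rw [hmul 0 7]; simp [p0]
  have c2_0 : c 2 0 = 0 := by
    rw [hmul 1 0]; simp [Finset.sum_range_succ, a0, c1_0]
  have c2_1 : c 2 1 = 0 := by
    rw [hmul 1 1]; simp [Finset.sum_range_succ, a0, c1_0, c1_1]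
  have c2_2 : c 2 2 = a 1 ^ 2 := by
    rw [hmul 1 2]; simp [Finset.sum_range_succ, a0, c1_0, c1_1, c1_2]; ring
  have c2_3 : c 2 3 = 2 * a 1 * a 2 := by
    rw [hmul 1 3]; simp [Finset.sum_range_succ, a0, c1_0, c1_1, c1_2, c1_3]; ring
  have c2_4 : c 2 4 = 2 * a 1 * a 3 + a 2 ^ 2 := by
    rw [hmul 1 4]; simp [Finset.sum_range_succ, a0, c1_0, c1_1, c1_2, c1_3, c1_4]; ring
  have c2_5 : c 2 5 = 2 * a 1 * a 4 + 2 * a 2 * a 3 := by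
    rw [hmul 1 5]; simp [Finset.sum_range_succ, a0, c1_0, c1_1, c1_2, c1_3, c1_4, c1_5]; ring
  have c2_6 : c 2 6 = 2 * a 1 * a 5 + 2 * a 2 * a 4 + a 3 ^ 2 := by
    rw [hmul 1 6]; simp [Finset.sum_range_succ, a0, c1_0, c1_1, c1_2, c1_3, c1_4, c1_5, c1_6]; ring
  have c2_7 : c 2 7 = 2 * a 1 * a 6 + 2 * a 2 * a 5 + 2 * a 3 * a 4 := by
    rw [hmul 1 7]; simp [Finset.sum_range_succ, a0, c1_0, c1_1, c1_2, c1_3, c1_4, c1_5, c1_6, c1_7]; ring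
  have c3_0 : c 3 0 = 0 := by
    rw [hmul 2 0]; simp [Finset.sum_range_succ, a0, c2_0]
  have c3_1 : c 3 1 = 0 := by
    rw [hmul 2 1]; simp [Finset.sum_range_succ, a0, c2_0, c2_1]
  have c3_2 : c 3 2 = 0 := by
    rw [hmul 2 2]; simp [Finset.sum_range_succ, a0, c2_0, c2_1, c2_2]
  have c3_3 : c 3 3 = a 1 ^ 3 := by
    rw [hmul 2 3]; simp [Finset.sum_range_succ, a0, c2_0, c2_1, c2_2, c2_3]; ring
  have c3_4 : c 3 4 = 3 * a 1 ^ 2 * a 2 := by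
    rw [hmul 2 4]; simp [Finset.sum_range_succ, a0, c2_0, c2_1, c2_2, c2_3, c2_4]; ring
  have c3_5 : c 3 5 = 3 * a 1 ^ 2 * a 3 + 3 * a 1 * a 2 ^ 2 := by
    rw [hmul 2 5]; simp [Finset.sum_range_succ, a0, c2_0, c2_1, c2_2, c2_3, c2_4, c2_5]; ring
  have c3_6 : c 3 6 = 3 * a 1 ^ 2 * a 4 + 6 * a 1 * a 2 * a 3 + a 2 ^ 3 := by
    rw [hmul 2 6]; simp [Finset.sum_range_succ, a0, c2_0, c2_1, c2_2, c2_3, c2_4, c2_5, c2_6]; ring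
  have c3_7 : c 3 7 = 3 * a 1 ^ 2 * a 5 + 6 * a 1 * a 2 * a 4 + 3 * a 1 * a 3 ^ 2 + 3 * a 2 ^ 2 * a 3 := by
    rw [hmul 2 7]; simp [Finset.sum_range_succ, a0, c2_0, c2_1, c2_2, c2_3, c2_4, c2_5, c2_6, c2_7]; ring
  have c4_0 : c 4 0 = 0 := by
    rw [hmul 3 0]; simp [Finset.sum_range_succ, a0, c3_0]
  have c4_1 : c 4 1 = 0 := by
    rw [hmul 3 1]; simp [Finset.sum_range_succ, a0, c3_0, c3_1]
  have c4_2 : c 4 2 = 0 := by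
    rw [hmul 3 2]; simp [Finset.sum_range_succ, a0, c3_0, c3_1, c3_2]
  have c4_3 : c 4 3 = 0 := by
    rw [hmul 3 3]; simp [Finset.sum_range_succ, a0, c3_0, c3_1, c3_2, c3_3]
  have c4_4 : c 4 4 = a 1 ^ 4 := by
    rw [hmul 3 4]; simp [Finset.sum_range_succ, a0, c3_0, c3_1, c3_2, c3_3, c3_4]; ring
  have c4_5 : c 4 5 = 4 * a 1 ^ 3 * a 2 := by
    rw [hmul 3 5]; simp [Finset.sum_range_succ, a0, c3_0, c3_1, c3_2, c3_3, c3_4, c3_5]; ring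
  have c4_6 : c 4 6 = 4 * a 1 ^ 3 * a 3 + 6 * a 1 ^ 2 * a 2 ^ 2 := by
    rw [hmul 3 6]; simp [Finset.sum_range_succ, a0, c3_0, c3_1, c3_2, c3_3, c3_4, c3_5, c3_6]; ring
  have c4_7 : c 4 7 = 4 * a 1 ^ 3 * a 4 + 12 * a 1 ^ 2 * a 2 * a 3 + 4 * a 1 * a 2 ^ 3 := by
    rw [hmul 3 7]; simp [Finset.sum_range_succ, a0, c3_0, c3_1, c3_2, c3_3, c3_4, c3_5, c3_6, c3_7]; ring
  have c5_0 : c 5 0 = 0 := by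
    rw [hmul 4 0]; simp [Finset.sum_range_succ, a0, c4_0]
  have c5_1 : c 5 1 = 0 := by
    rw [hmul 4 1]; simp [Finset.sum_range_succ, a0, c4_0, c4_1]
  have c5_2 : c 5 2 = 0 := by
    rw [hmul 4 2]; simp [Finset.sum_range_succ, a0, c4_0, c4_1, c4_2]
  have c5_3 : c 5 3 = 0 := by
    rw [hmul 4 3]; simp [Finset.sum_range_succ, a0, c4_0, c4_1, c4_2, c4_3]
  have c5_4 : c 5 4 = 0 := by
    rw [hmul 4 4]; simp [Finset.sum_range_succ, a0, c4_0, c4_1, c4_2, c4_3, c4_4]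
  have c5_5 : c 5 5 = a 1 ^ 5 := by
    rw [hmul 4 5]; simp [Finset.sum_range_succ, a0, c4_0, c4_1, c4_2, c4_3, c4_4, c4_5]; ring
  have c5_6 : c 5 6 = 5 * a 1 ^ 4 * a 2 := by
    rw [hmul 4 6]; simp [Finset.sum_range_succ, a0, c4_0, c4_1, c4_2, c4_3, c4_4, c4_5, c4_6]; ring
  have c5_7 : c 5 7 = 5 * a 1 ^ 4 * a 3 + 10 * a 1 ^ 3 * a 2 ^ 2 := by
    rw [hmul 4 7]; simp [Finset.sum_range_succ, a0, c4_0, c4_1, c4_2, c4_3, c4_4, c4_5, c4_6, c4_7]; ring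
  have c6_0 : c 6 0 = 0 := by
    rw [hmul 5 0]; simp [Finset.sum_range_succ, a0, c5_0]
  have c6_1 : c 6 1 = 0 := by
    rw [hmul 5 1]; simp [Finset.sum_range_succ, a0, c5_0, c5_1]
  have c6_2 : c 6 2 = 0 := by
    rw [hmul 5 2]; simp [Finset.sum_range_succ, a0, c5_0, c5_1, c5_2]
  have c6_3 : c 6 3 = 0 := by
    rw [hmul 5 3]; simp [Finset.sum_range_succ, a0, c5_0, c5_1, c5_2, c5_3]
  have c6_4 : c 6 4 = 0 := by
    rw [hmul 5 4]; simp [Finset.sum_range_succ, a0, c5_0, c5_1, c5_2, c5_3, c5_4]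
  have c6_5 : c 6 5 = 0 := by
    rw [hmul 5 5]; simp [Finset.sum_range_succ, a0, c5_0, c5_1, c5_2, c5_3, c5_4, c5_5]
  have c6_6 : c 6 6 = a 1 ^ 6 := by
    rw [hmul 5 6]; simp [Finset.sum_range_succ, a0, c5_0, c5_1, c5_2, c5_3, c5_4, c5_5, c5_6]; ring
  have c6_7 : c 6 7 = 6 * a 1 ^ 5 * a 2 := by
    rw [hmul 5 7]; simp [Finset.sum_range_succ, a0, c5_0, c5_1, c5_2, c5_3, c5_4, c5_5, c5_6, c5_7]; ring
  have c7_0 : c 7 0 = 0 := by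
    rw [hmul 6 0]; simp [Finset.sum_range_succ, a0, c6_0]
  have c7_1 : c 7 1 = 0 := by
    rw [hmul 6 1]; simp [Finset.sum_range_succ, a0, c6_0, c6_1]
  have c7_2 : c 7 2 = 0 := by
    rw [hmul 6 2]; simp [Finset.sum_range_succ, a0, c6_0, c6_1, c6_2]
  have c7_3 : c 7 3 = 0 := by
    rw [hmul 6 3]; simp [Finset.sum_range_succ, a0, c6_0, c6_1, c6_2, c6_3]
  have c7_4 : c 7 4 = 0 := by
    rw [hmul 6 4]; simp [Finset.sum_range_succ, a0, c6_0, c6_1, c6_2, c6_3, c6_4]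
  have c7_5 : c 7 5 = 0 := by
    rw [hmul 6 5]; simp [Finset.sum_range_succ, a0, c6_0, c6_1, c6_2, c6_3, c6_4, c6_5]
  have c7_6 : c 7 6 = 0 := by
    rw [hmul 6 6]; simp [Finset.sum_range_succ, a0, c6_0, c6_1, c6_2, c6_3, c6_4, c6_5, c6_6]
  have c7_7 : c 7 7 = a 1 ^ 7 := by
    rw [hmul 6 7]; simp [Finset.sum_range_succ, a0, c6_0, c6_1, c6_2, c6_3, c6_4, c6_5, c6_6, c6_7]; ring
  refine ⟨?_, ?_⟩
  · rw [key 0 (by norm_num)]; simp [Finset.sum_range_succ, p0, a0, c1_0, c2_0, c3_0, c4_0, c5_0, c6_0, c7_0]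
    try ring
  refine ⟨?_, ?_⟩
  · rw [key 1 (by norm_num)]; simp [Finset.sum_range_succ, p0, a0, c1_1, c2_1, c3_1, c4_1, c5_1, c6_1, c7_1]
    try ring
  refine ⟨?_, ?_⟩
  · rw [key 2 (by norm_num)]; simp [Finset.sum_range_succ, p0, a0, c1_2, c2_2, c3_2, c4_2, c5_2, c6_2, c7_2]
    try ring
  refine ⟨?_, ?_⟩
  · rw [key 3 (by norm_num)]; simp [Finset.sum_range_succ, p0, a0, c1_3, c2_3, c3_3, c4_3, c5_3, c6_3, c7_3]
    try ring
  refine ⟨?_, ?_⟩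
  · rw [key 4 (by norm_num)]; simp [Finset.sum_range_succ, p0, a0, c1_4, c2_4, c3_4, c4_4, c5_4, c6_4, c7_4]
    try ring
  refine ⟨?_, ?_⟩
  · rw [key 5 (by norm_num)]; simp [Finset.sum_range_succ, p0, a0, c1_5, c2_5, c3_5, c4_5, c5_5, c6_5, c7_5]
    try ring
  refine ⟨?_, ?_⟩
  · rw [key 6 (by norm_num)]; simp [Finset.sum_range_succ, p0, a0, c1_6, c2_6, c3_6, c4_6, c5_6, c6_6, c7_6]
    try ring
  · rw [key 7 (by norm_num)]; simp [Finset.sum_range_succ, p0, a0, c1_7, c2_7, c3_7, c4_7, c5_7, c6_7, c7_7]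
    try ring

/-- Normal form of a function whose odd Taylor coefficients below seven vanish. -/
lemma even_odd_form {Y : ℝ → ℝ} (hY : ContDiff ℝ ∞ Y)
    (h1 : PowerSeries.coeff 1 (tay Y) = 0) (h3 : PowerSeries.coeff 3 (tay Y) = 0)
    (h5 : PowerSeries.coeff 5 (tay Y) = 0) :
    ∃ E h : ℝ → ℝ, ContDiff ℝ ∞ E ∧ ContDiff ℝ ∞ h ∧
      (∀ t, Y t = E (t ^ 2) + t ^ 7 * h (t ^ 2)) ∧ h 0 = PowerSeries.coeff 7 (tay Y) := by
  have hYn : ContDiff ℝ ∞ (fun t => Y (-t)) := hY.comp contDiff_neg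
  have hneg : ∀ n, PowerSeries.coeff n (tay fun t => Y (-t)) =
      (-1) ^ n * PowerSeries.coeff n (tay Y) := by
    intro n
    rw [coeff_tay, coeff_tay, iteratedDeriv_comp_neg, neg_zero, smul_eq_mul, mul_div_assoc]
  have he : ContDiff ℝ ∞ (fun t => (1/2) * (Y t + Y (-t))) := contDiff_const.mul (hY.add hYn)
  have ho : ContDiff ℝ ∞ (fun t => (1/2) * (Y t - Y (-t))) := contDiff_const.mul (hY.sub hYn)
  have hoc : ∀ n, PowerSeries.coeff n (tay fun t => (1/2) * (Y t - Y (-t))) =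
      (1/2) * (PowerSeries.coeff n (tay Y) - (-1) ^ n * PowerSeries.coeff n (tay Y)) := by
    intro n
    rw [tay_mul contDiff_const (hY.sub hYn), tay_const, PowerSeries.coeff_C_mul, tay_sub hY hYn,
      map_sub, hneg]
  obtain ⟨E, hE, hEt⟩ := whitney_even he (fun t => by simp [add_comm])
  obtain ⟨R, hR, hRt⟩ := taylor_rem ho 7
  have hR7 : ∀ t, (1/2) * (Y t - Y (-t)) = t ^ 7 * R t := by
    intro t
    rw [hRt t]
    simp only [hoc]
    simp [Finset.sum_range_succ, h1, h3, h5]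
    norm_num
  have hR0 : R 0 = PowerSeries.coeff 7 (tay Y) := by
    have h := hoc 7
    rw [funext hR7, tay_mul (contDiff_fun_id.pow 7) hR, tay_pow contDiff_fun_id, tay_id,
      PowerSeries.coeff_X_pow_mul', if_pos le_rfl, Nat.sub_self, tay_zero_eq] at h
    rw [h]; ring
  have hRe : ∀ t, R (-t) = R t := by
    intro t
    by_cases ht : t = 0
    · simp [ht]
    · have a1 := hR7 t
      have a2 := hR7 (-t)
      rw [neg_neg] at a2
      have h7 : t ^ 7 ≠ 0 := pow_ne_zero _ ht
      have : t ^ 7 * R (-t) = t ^ 7 * R t := by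
        have : (-t) ^ 7 = - t ^ 7 := by ring
        rw [this] at a2; linarith
      exact mul_left_cancel₀ h7 this
  obtain ⟨h, hh, hht⟩ := whitney_even hR hRe
  refine ⟨E, h, hE, hh, fun t => ?_, ?_⟩
  · rw [← hEt, ← hht, ← hR7]; ring
  · rw [← hR0, hht 0]; norm_num

/-- Taylor coefficients of `Ψ(t², t⁷)`. -/
lemma cusp_coeffs {Ψ : ℝ × ℝ → ℝ} {W : Set (ℝ × ℝ)} (hW : IsOpen W) (h0 : ((0, 0) : ℝ × ℝ) ∈ W)
    (hΨ : ContDiffOn ℝ ∞ Ψ W) :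
    ∃ M : ℝ → ℝ, ContDiff ℝ ∞ M ∧ M =ᶠ[𝓝 0] (fun t => Ψ (t ^ 2, t ^ 7)) ∧
      PowerSeries.coeff 1 (tay M) = 0 ∧ PowerSeries.coeff 3 (tay M) = 0 ∧
      PowerSeries.coeff 5 (tay M) = 0 ∧
      PowerSeries.coeff 2 (tay M) = fderiv ℝ Ψ (0, 0) (1, 0) ∧
      PowerSeries.coeff 7 (tay M) = fderiv ℝ Ψ (0, 0) (0, 1) := by
  have hat : ContDiffAt ℝ ∞ Ψ (0, 0) := hΨ.contDiffAt (hW.mem_nhds h0)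
  have hstr : HasStrictFDerivAt Ψ (fderiv ℝ Ψ (0, 0)) (0, 0) := hat.hasStrictFDerivAt (by simp)
  set D := fderiv ℝ Ψ (0, 0) with hD
  have hc1 : ContDiff ℝ ∞ (fun t : ℝ => ((t ^ 2, t ^ 7) : ℝ × ℝ)) :=
    (contDiff_fun_id.pow 2).prodMk (contDiff_fun_id.pow 7)
  have hc2 : ContDiff ℝ ∞ (fun x : ℝ => ((x, 0) : ℝ × ℝ)) := contDiff_fun_id.prodMk contDiff_const
  have hc3 : ContDiff ℝ ∞ (fun t : ℝ => ((t ^ 2, 0) : ℝ × ℝ)) :=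
    (contDiff_fun_id.pow 2).prodMk contDiff_const
  obtain ⟨M, hM, hMe⟩ := extend_smooth (f := fun t => Ψ (t ^ 2, t ^ 7))
    (U := (fun t : ℝ => ((t ^ 2, t ^ 7) : ℝ × ℝ)) ⁻¹' W) (hW.preimage hc1.continuous)
    (by simpa using h0) (hΨ.comp hc1.contDiffOn (fun _ h => h))
  obtain ⟨E, hE, hEe⟩ := extend_smooth (f := fun x => Ψ (x, 0))
    (U := (fun x : ℝ => ((x, 0) : ℝ × ℝ)) ⁻¹' W) (hW.preimage hc2.continuous)
    (by simpa using h0) (hΨ.comp hc2.contDiffOn (fun _ h => h))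
  have hsq : ContDiff ℝ ∞ (fun t : ℝ => t ^ 2) := contDiff_fun_id.pow 2
  have hEs : ContDiff ℝ ∞ (fun t => E (t ^ 2)) := hE.comp hsq
  have h7 : ContDiff ℝ ∞ (fun t : ℝ => D (0, 1) * t ^ 7) := contDiff_const.mul (contDiff_fun_id.pow 7)
  have hρ : ContDiff ℝ ∞ (fun t => M t - E (t ^ 2) - D (0, 1) * t ^ 7) := (hM.sub hEs).sub h7
  have hsqt : Filter.Tendsto (fun t : ℝ => t ^ 2) (𝓝 0) (𝓝 0) := by
    simpa using hsq.continuous.tendsto 0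
  have hlo : (fun t => M t - E (t ^ 2) - D (0, 1) * t ^ 7) =o[𝓝 0] fun t => t ^ 7 := by
    have hT : Filter.Tendsto (fun t : ℝ => (((t ^ 2, t ^ 7), (t ^ 2, 0)) : (ℝ × ℝ) × (ℝ × ℝ)))
        (𝓝 0) (𝓝 ((0, 0), (0, 0))) := by
      simpa using (hc1.prodMk hc3).continuous.tendsto 0
    have h := hstr.isLittleO.comp_tendsto hT
    refine (h.congr' ?_ (Filter.EventuallyEq.refl _ _)).trans_isBigO ?_
    · filter_upwards [hMe, hsqt.eventually hEe] with t h1 h2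
      rw [h1, h2]
      simp only [Function.comp]
      congr 1
      have : ((t ^ 2, t ^ 7) - (t ^ 2, 0) : ℝ × ℝ) = t ^ 7 • ((0, 1) : ℝ × ℝ) := by
        ext <;> simp
      rw [this, map_smul, smul_eq_mul, mul_comm]
    · refine Asymptotics.IsBigO.of_bound 1 (Filter.Eventually.of_forall fun t => ?_)
      simp [Prod.norm_def]
  have hz := tay_littleO hρ hlo
  have hMc : ∀ n ≤ 7, PowerSeries.coeff n (tay M) =
      PowerSeries.coeff n (tay fun t => E (t ^ 2)) +
        D (0, 1) * PowerSeries.coeff n (PowerSeries.X ^ 7) := by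
    intro n hn
    have := hz n hn
    rw [tay_sub (hM.sub hEs) h7, tay_sub hM hEs,
      tay_mul contDiff_const (contDiff_fun_id.pow 7), tay_const, tay_pow contDiff_fun_id, tay_id,
      map_sub, map_sub, PowerSeries.coeff_C_mul] at this
    linarith
  have hEc : ∀ n ≤ 7, PowerSeries.coeff n (tay fun t => E (t ^ 2)) =
      ∑ i ∈ Finset.range 8, PowerSeries.coeff i (tay E) * if n = 2 * i then 1 else 0 := by
    intro n hn
    rw [tay_comp hE hsq (by simp) (Nat.lt_succ_of_le hn), tay_pow contDiff_fun_id, tay_id]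
    refine Finset.sum_congr rfl fun i _ => ?_
    rw [← pow_mul, PowerSeries.coeff_X_pow]
  have hE1 : PowerSeries.coeff 1 (tay E) = D (1, 0) := by
    rw [tay_one_eq, hEe.deriv_eq]
    have h1 : HasDerivAt (fun x : ℝ => ((x, 0) : ℝ × ℝ)) (1, 0) 0 :=
      (hasDerivAt_id (0:ℝ)).prodMk (hasDerivAt_const 0 0)
    exact (HasFDerivAt.comp_hasDerivAt (f := fun x : ℝ => ((x, 0) : ℝ × ℝ)) (0:ℝ) hstr.hasFDerivAt h1).deriv
  refine ⟨M, hM, hMe, ?_, ?_, ?_, ?_, ?_⟩ <;>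
    rw [hMc _ (by norm_num), hEc _ (by norm_num), PowerSeries.coeff_X_pow] <;>
    simp [Finset.sum_range_succ, hE1]

lemma coeff_linear {γ : ℝ → ℝ × ℝ} (hγ : ContDiff ℝ ∞ γ) (c : ℝ) (L : ℝ × ℝ →L[ℝ] ℝ) (n : ℕ) :
    PowerSeries.coeff n (tay fun s => L (γ (c + s))) = L (iteratedDeriv n γ c) / (n ! : ℝ) := by
  rw [coeff_tay]
  congr 1
  have h1 := congrFun (iteratedDeriv_comp_const_add n (fun x => L (γ x)) c) 0
  rw [h1, add_zero, iteratedDeriv_eq_iteratedFDeriv, iteratedDeriv_eq_iteratedFDeriv]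
  have := L.iteratedFDeriv_comp_left (i := n) (n := n) (f := γ) (x := c)
    (hγ.of_le (by exact_mod_cast le_top)).contDiffAt le_rfl
  rw [show (fun x => L (γ x)) = L ∘ γ from rfl, this]
  rfl

lemma forward_dir (γ : ℝ → ℝ × ℝ) (hγ : ContDiff ℝ (⊤ : ℕ∞) γ) (c : ℝ)
    (H : AEquivCurveAt γ c 2 7) : ∃ k l : ℝ, SevenHalfCuspCond γ c k l := by
  obtain ⟨a, b, ph, W, W', Φ, Ψ, ha, hb, hph, hph0, hphd, hW, hW', hcW, h0W', ⟨hΦs, hΨs, hΦm, hΨm,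
    hli, hri⟩, hΦ0, heq⟩ := H
  have h0ab : (0:ℝ) ∈ Set.Ioo a b := ⟨ha, hb⟩
  -- the local inverse of the parameter change
  obtain ⟨f, hf, hfe⟩ := extend_smooth (f := fun t => ph t - c) isOpen_Ioo h0ab
    (hph.sub contDiffOn_const)
  have hf0 : f 0 = 0 := by rw [hfe.self_of_nhds]; simp [hph0]
  have hfd : deriv f 0 ≠ 0 := by
    rw [hfe.deriv_eq, deriv_sub_const]; exact hphd 0 h0ab
  obtain ⟨τ, hτ, hτ0, hτd, hfτ, -⟩ := smooth_inverse hf hf0 hfd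
  have hτt : Filter.Tendsto τ (𝓝 0) (𝓝 0) := by
    have := hτ.continuous.tendsto 0
    rwa [hτ0] at this
  have hγt : Filter.Tendsto (fun s => γ (c + s)) (𝓝 0) (𝓝 (γ c)) := by
    have : Continuous fun s => γ (c + s) := hγ.continuous.comp (by fun_prop)
    simpa using this.tendsto 0
  have hmain : ∀ᶠ s in 𝓝 0, γ (c + s) = Ψ (τ s ^ 2, τ s ^ 7) := by
    filter_upwards [hfτ, hτt.eventually hfe, hτt.eventually (isOpen_Ioo.mem_nhds h0ab),
      hγt.eventually (hW.mem_nhds hcW)] with s h1 h2 h3 h4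
    have h5 : ph (τ s) = c + s := by linarith
    have h6 := heq (τ s) h3 (by rwa [h5])
    rw [h5] at h6
    rw [← h6, hli _ h4]
  -- the two components
  obtain ⟨M, hM, hMe, hM1, hM3, hM5, hM2, hM7⟩ := cusp_coeffs (Ψ := fun p => (Ψ p).1) hW' h0W'
    (contDiff_fst.comp_contDiffOn hΨs)
  obtain ⟨N, hN, hNe, hN1, hN3, hN5, hN2, hN7⟩ := cusp_coeffs (Ψ := fun p => (Ψ p).2) hW' h0W'
    (contDiff_snd.comp_contDiffOn hΨs)
  have hΨat : DifferentiableAt ℝ Ψ (0, 0) :=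
    (hΨs.contDiffAt (hW'.mem_nhds h0W')).differentiableAt (by simp)
  have hΨ0 : Ψ (0, 0) = γ c := by rw [← hΦ0, hli _ hcW]
  have hΦat : DifferentiableAt ℝ Φ (Ψ (0, 0)) := by
    rw [hΨ0]; exact (hΦs.contDiffAt (hW.mem_nhds hcW)).differentiableAt (by simp)
  set D := fderiv ℝ Ψ (0, 0) with hD
  have hDinj : ∀ v, D v = 0 → v = 0 := by
    intro v hv
    have h1 : HasFDerivAt (Φ ∘ Ψ) ((fderiv ℝ Φ (Ψ (0, 0))).comp D) (0, 0) :=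
      hΦat.hasFDerivAt.comp _ hΨat.hasFDerivAt
    have h2 : HasFDerivAt (Φ ∘ Ψ) (ContinuousLinearMap.id ℝ (ℝ × ℝ)) (0, 0) := by
      refine (hasFDerivAt_id _).congr_of_eventuallyEq ?_
      filter_upwards [hW'.mem_nhds h0W'] with p hp
      exact hri p hp
    have h3 := congrArg (fun L => L v) (h1.unique h2)
    simpa [hv] using h3.symm
  have hfst : ∀ v, fderiv ℝ (fun p => (Ψ p).1) (0, 0) v = (D v).1 := by
    intro v; rw [hΨat.hasFDerivAt.fst.fderiv]; rfl
  have hsnd : ∀ v, fderiv ℝ (fun p => (Ψ p).2) (0, 0) v = (D v).2 := by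
    intro v; rw [hΨat.hasFDerivAt.snd.fderiv]; rfl
  rw [hfst] at hM2 hM7
  rw [hsnd] at hN2 hN7
  have hdet : PowerSeries.coeff 2 (tay M) * PowerSeries.coeff 7 (tay N) -
      PowerSeries.coeff 2 (tay N) * PowerSeries.coeff 7 (tay M) ≠ 0 := by
    rw [hM2, hM7, hN2, hN7]
    intro h
    have hlin : ∀ x y : ℝ, D (x, y) = x • D (1, 0) + y • D (0, 1) := by
      intro x y
      rw [← map_smul, ← map_smul, ← map_add]; simp
    have h1 := hDinj ((D (0, 1)).1, -(D (1, 0)).1) (by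
      rw [hlin]; ext
      · simp; ring
      · simp; linarith)
    have h2 := hDinj ((D (0, 1)).2, -(D (1, 0)).2) (by
      rw [hlin]; ext
      · simp; linarith
      · simp; ring)
    have h3 : D (1, 0) = 0 := by
      simp only [Prod.mk_eq_zero, neg_eq_zero] at h1 h2
      exact Prod.ext h1.2 h2.2
    have h4 := hDinj _ h3
    simp at h4
  have hP : ∀ n, PowerSeries.coeff n (tay fun s => M (τ s)) = (iteratedDeriv n γ c).1 / (n ! : ℝ) := by
    intro n
    rw [← ContinuousLinearMap.coe_fst' (R := ℝ) (M₁ := ℝ) (M₂ := ℝ), ← coeff_linear hγ c]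
    congr 1
    apply tay_congr
    filter_upwards [hmain, hτt.eventually hMe] with s h1 h2
    rw [h2, h1]; rfl
  have hQ : ∀ n, PowerSeries.coeff n (tay fun s => N (τ s)) = (iteratedDeriv n γ c).2 / (n ! : ℝ) := by
    intro n
    rw [← ContinuousLinearMap.coe_snd' (R := ℝ) (M₁ := ℝ) (M₂ := ℝ), ← coeff_linear hγ c]
    congr 1
    apply tay_congr
    filter_upwards [hmain, hτt.eventually hNe] with s h1 h2
    rw [h2, h1]; rfl
  have ha1 : PowerSeries.coeff 1 (tay τ) ≠ 0 := by rwa [tay_one_eq]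
  obtain ⟨-, p1, p2, p3, p4, p5, p6, p7⟩ := comp_coeffs hM hτ hτ0 (fun _ => rfl) (fun _ => rfl)
  obtain ⟨-, q1, q2, q3, q4, q5, q6, q7⟩ := comp_coeffs hN hτ hτ0 (fun _ => rfl) (fun _ => rfl)
  simp only [hP, hQ, hM1, hM3, hM5, hN1, hN3, hN5, zero_mul, zero_add, add_zero]
    at p1 p2 p3 p4 p5 p6 p7 q1 q2 q3 q4 q5 q6 q7
  clear hP hQ hM2 hM7 hN2 hN7
  generalize PowerSeries.coeff 1 (tay τ) = a1 at *
  generalize PowerSeries.coeff 2 (tay τ) = a2 at *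
  generalize PowerSeries.coeff 3 (tay τ) = a3 at *
  generalize PowerSeries.coeff 4 (tay τ) = a4 at *
  generalize PowerSeries.coeff 5 (tay τ) = a5 at *
  generalize PowerSeries.coeff 6 (tay τ) = a6 at *
  generalize PowerSeries.coeff 2 (tay M) = m2 at *
  generalize PowerSeries.coeff 4 (tay M) = m4 at *
  generalize PowerSeries.coeff 6 (tay M) = m6 at *
  generalize PowerSeries.coeff 7 (tay M) = m7 at *
  generalize PowerSeries.coeff 2 (tay N) = n2 at *
  generalize PowerSeries.coeff 4 (tay N) = n4 at *
  generalize PowerSeries.coeff 6 (tay N) = n6 at *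
  generalize PowerSeries.coeff 7 (tay N) = n7 at *
  norm_num [Nat.factorial, div_eq_iff] at p1 p2 p3 p4 p5 p6 p7 q1 q2 q3 q4 q5 q6 q7
  have hmn : ¬ (m2 = 0 ∧ n2 = 0) := by
    rintro ⟨rfl, rfl⟩; simp at hdet
  refine ⟨6 * a2 / a1, 60 * (2 * a1 * a4 + 2 * a2 * a3) / a1 ^ 2 -
    120 * (2 * a1 * a2) * (2 * a1 * a3 + a2 ^ 2) / a1 ^ 4, ?_, ?_, ?_, ?_, ?_⟩
  · exact Prod.ext p1 q1
  · intro h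
    rw [h] at p2 q2
    simp [ha1] at p2 q2
    exact hmn ⟨p2, q2⟩
  · ext
    · simp only [Prod.smul_fst, smul_eq_mul, p2, p3]; field_simp
    · simp only [Prod.smul_snd, smul_eq_mul, q2, q3]; field_simp
  · ext
    · simp only [Prod.smul_fst, Prod.fst_sub, smul_eq_mul, p2, p4, p5]; field_simp; ring
    · simp only [Prod.smul_snd, Prod.snd_sub, smul_eq_mul, q2, q4, q5]; field_simp; ring
  · have : det2 (iteratedDeriv 2 γ c)
        (iteratedDeriv 7 γ c - (7 * (6 * a2 / a1)) • iteratedDeriv 6 γ c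
        - (7 * (60 * (2 * a1 * a4 + 2 * a2 * a3) / a1 ^ 2 -
    120 * (2 * a1 * a2) * (2 * a1 * a3 + a2 ^ 2) / a1 ^ 4) -
          (70 / 3 : ℝ) * (6 * a2 / a1) ^ 3) • iteratedDeriv 4 γ c) =
        10080 * a1 ^ 9 * (m2 * n7 - n2 * m7) := by
      simp only [det2, Prod.smul_fst, Prod.fst_sub, Prod.smul_snd, Prod.snd_sub, smul_eq_mul,
        p2, p4, p6, p7, q2, q4, q6, q7]
      field_simp
      ring
    rw [this]
    exact mul_ne_zero (mul_ne_zero (by norm_num) (pow_ne_zero _ ha1)) hdet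

lemma coeff_linear_sub {γ : ℝ → ℝ × ℝ} (hγ : ContDiff ℝ ∞ γ) (c : ℝ) (L : ℝ × ℝ →L[ℝ] ℝ) (n : ℕ)
    (hn : n ≠ 0) :
    PowerSeries.coeff n (tay fun s => L (γ (c + s)) - L (γ c)) =
      L (iteratedDeriv n γ c) / (n ! : ℝ) := by
  have h1 : ContDiff ℝ ∞ fun s => L (γ (c + s)) :=
    L.contDiff.comp (hγ.comp (contDiff_const.add contDiff_fun_id))
  rw [tay_sub h1 contDiff_const, tay_const, map_sub, PowerSeries.coeff_C, if_neg hn, sub_zero,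
    coeff_linear hγ]

lemma backward_dir (γ : ℝ → ℝ × ℝ) (hγ : ContDiff ℝ (⊤ : ℕ∞) γ) (c k l : ℝ)
    (H : SevenHalfCuspCond γ c k l) : AEquivCurveAt γ c 2 7 := by
  obtain ⟨H1, H2, H3, H5, H7⟩ := H
  set A := iteratedDeriv 2 γ c with hA
  have hN : 0 < A.1 ^ 2 + A.2 ^ 2 := by
    by_contra h
    apply H2
    have h1 : A.1 = 0 := by nlinarith [sq_nonneg A.1, sq_nonneg A.2]
    have h2 : A.2 = 0 := by nlinarith [sq_nonneg A.1, sq_nonneg A.2]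
    exact Prod.ext h1 h2
  let L1 : ℝ × ℝ →L[ℝ] ℝ := A.1 • ContinuousLinearMap.fst ℝ ℝ ℝ + A.2 • ContinuousLinearMap.snd ℝ ℝ ℝ
  let L2 : ℝ × ℝ →L[ℝ] ℝ := A.1 • ContinuousLinearMap.snd ℝ ℝ ℝ - A.2 • ContinuousLinearMap.fst ℝ ℝ ℝ
  have L1a : ∀ v, L1 v = A.1 * v.1 + A.2 * v.2 := fun v => rfl
  have L2a : ∀ v, L2 v = A.1 * v.2 - A.2 * v.1 := fun v => rfl
  have hshift : ContDiff ℝ ∞ fun s => γ (c + s) := hγ.comp (contDiff_const.add contDiff_fun_id)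
  have hX : ContDiff ℝ ∞ fun s => L1 (γ (c + s)) - L1 (γ c) :=
    (L1.contDiff.comp hshift).sub contDiff_const
  have hY : ContDiff ℝ ∞ fun s => L2 (γ (c + s)) - L2 (γ c) :=
    (L2.contDiff.comp hshift).sub contDiff_const
  have Xc := coeff_linear_sub hγ c L1
  have Yc := coeff_linear_sub hγ c L2
  set X : ℝ → ℝ := fun s => L1 (γ (c + s)) - L1 (γ c) with hXdef
  set Y : ℝ → ℝ := fun s => L2 (γ (c + s)) - L2 (γ c) with hYdef
  have hX0 : X 0 = 0 := by simp [hXdef]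
  have hX1 : PowerSeries.coeff 1 (tay X) = 0 := by
    rw [Xc 1 one_ne_zero, iteratedDeriv_one, H1]; simp
  obtain ⟨g, hg, hXg⟩ := taylor_rem hX 2
  have hXg' : ∀ s, X s = s ^ 2 * g s := by
    intro s; rw [hXg s]; simp [Finset.sum_range_succ, hX1, tay_zero_eq, hX0]
  have hg0 : g 0 = PowerSeries.coeff 2 (tay X) := by
    rw [funext hXg', tay_mul (contDiff_fun_id.pow 2) hg, tay_pow contDiff_fun_id, tay_id,
        PowerSeries.coeff_X_pow_mul', if_pos le_rfl, Nat.sub_self, tay_zero_eq]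
  have hg0p : 0 < g 0 := by
    rw [hg0, Xc 2 two_ne_zero, ← hA, L1a]
    norm_num [Nat.factorial]
    nlinarith
  have hgo : IsOpen {s | 0 < g s} := isOpen_lt continuous_const hg.continuous
  obtain ⟨w, hw, hwe⟩ := extend_smooth (f := fun s => √(g s)) hgo hg0p
    (hg.contDiffOn.sqrt (fun s hs => ne_of_gt hs))
  have hw0 : w 0 ≠ 0 := by
    rw [hwe.self_of_nhds]; exact (Real.sqrt_pos.2 hg0p).ne'
  obtain ⟨τ, hτdef⟩ : ∃ τ : ℝ → ℝ, τ = fun s => s * w s := ⟨_, rfl⟩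
  have hτ : ContDiff ℝ ∞ τ := by rw [hτdef]; exact contDiff_fun_id.mul hw
  have hτ0 : τ 0 = 0 := by simp [hτdef]
  have hτd : deriv τ 0 ≠ 0 := by
    rw [← tay_one_eq, hτdef, tay_mul contDiff_fun_id hw, tay_id]
    have := PowerSeries.coeff_succ_X_mul 0 (tay w)
    rw [zero_add] at this
    rwa [this, tay_zero_eq]
  have hXτ : X =ᶠ[𝓝 0] fun s => τ s ^ 2 := by
    filter_upwards [hwe, hgo.mem_nhds hg0p] with s h1 h2
    have h2 : 0 < g s := h2
    rw [hτdef, hXg']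
    simp only [h1]
    rw [mul_pow, Real.sq_sqrt h2.le]
  obtain ⟨σ, hσ, hσ0, hσd, hτσ, hστ⟩ := smooth_inverse hτ hτ0 hτd
  have hσt : Filter.Tendsto σ (𝓝 0) (𝓝 0) := by
    have := hσ.continuous.tendsto 0
    rwa [hσ0] at this
  have hZ : ContDiff ℝ ∞ (fun t => Y (σ t)) := hY.comp hσ
  set Z : ℝ → ℝ := fun t => Y (σ t) with hZdef
  have hYZ : tay Y = tay fun s => Z (τ s) := by
    apply tay_congr
    filter_upwards [hστ] with s hs
    rw [hZdef]; simp only [hs]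
  have hXs : tay X = tay fun s => (fun t : ℝ => t ^ 2) (τ s) := tay_congr hXτ
  have ha1 : PowerSeries.coeff 1 (tay τ) ≠ 0 := by rwa [tay_one_eq]
  obtain ⟨-, p1, p2, p3, p4, p5, p6, p7⟩ := comp_coeffs (f := fun t => t ^ 2)
    (b := fun n => if n = 2 then 1 else 0)
    (contDiff_fun_id.pow 2) hτ hτ0 (fun _ => rfl)
    (fun n => by rw [tay_pow contDiff_fun_id, tay_id, PowerSeries.coeff_X_pow])
  obtain ⟨-, q1, q2, q3, q4, q5, q6, q7⟩ := comp_coeffs hZ hτ hτ0 (fun _ => rfl) (fun _ => rfl)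
  rw [← hYZ] at q1 q2 q3 q4 q5 q6 q7
  rw [← hXs] at p1 p2 p3 p4 p5 p6 p7
  rw [Yc _ (by norm_num)] at q1 q2 q3 q4 q5 q6 q7
  rw [Xc _ (by norm_num)] at p1 p2 p3 p4 p5 p6 p7
  have e1 : L2 (iteratedDeriv 1 γ c) = 0 := by rw [iteratedDeriv_one, H1, map_zero]
  have e2 : L2 (iteratedDeriv 2 γ c) = 0 := by rw [← hA, L2a]; ring
  have e3 : L2 (iteratedDeriv 3 γ c) = 0 := by rw [H3, map_smul, hA, e2, smul_zero]
  have e5 : L2 (iteratedDeriv 5 γ c) = (10 / 3 * k) * L2 (iteratedDeriv 4 γ c) := by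
    have := congrArg L2 H5
    rw [map_sub, map_smul, map_smul, hA, e2, smul_zero, smul_eq_mul] at this
    linarith
  have e7 : L2 (iteratedDeriv 7 γ c) - (7 * k) * L2 (iteratedDeriv 6 γ c)
      - (7 * l - (70 / 3 : ℝ) * k ^ 3) * L2 (iteratedDeriv 4 γ c) ≠ 0 := by
    have : det2 A (iteratedDeriv 7 γ c - (7 * k) • iteratedDeriv 6 γ c
      - (7 * l - (70 / 3 : ℝ) * k ^ 3) • iteratedDeriv 4 γ c) =
      L2 (iteratedDeriv 7 γ c - (7 * k) • iteratedDeriv 6 γ c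
      - (7 * l - (70 / 3 : ℝ) * k ^ 3) • iteratedDeriv 4 γ c) := rfl
    rw [this, map_sub, map_sub, map_smul, map_smul, smul_eq_mul, smul_eq_mul] at H7
    exact H7
  have f3 : L1 (iteratedDeriv 3 γ c) = k * L1 (iteratedDeriv 2 γ c) := by
    rw [H3, map_smul, smul_eq_mul]
  have f5 : L1 (iteratedDeriv 5 γ c) - (10 / 3 * k) * L1 (iteratedDeriv 4 γ c) =
      l * L1 (iteratedDeriv 2 γ c) := by
    have := congrArg L1 H5
    rwa [map_sub, map_smul, map_smul, smul_eq_mul, smul_eq_mul] at this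
  have hb : PowerSeries.coeff 1 (tay Z) = 0 ∧ PowerSeries.coeff 3 (tay Z) = 0 ∧
      PowerSeries.coeff 5 (tay Z) = 0 ∧ PowerSeries.coeff 7 (tay Z) ≠ 0 := by
    clear hg0
    generalize PowerSeries.coeff 1 (tay τ) = a1 at *
    generalize PowerSeries.coeff 2 (tay τ) = a2 at *
    generalize PowerSeries.coeff 3 (tay τ) = a3 at *
    generalize PowerSeries.coeff 4 (tay τ) = a4 at *
    generalize PowerSeries.coeff 5 (tay τ) = a5 at *
    generalize PowerSeries.coeff 6 (tay τ) = a6 at *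
    generalize PowerSeries.coeff 7 (tay τ) = a7 at *
    generalize PowerSeries.coeff 1 (tay Z) = b1 at *
    generalize PowerSeries.coeff 2 (tay Z) = b2 at *
    generalize PowerSeries.coeff 3 (tay Z) = b3 at *
    generalize PowerSeries.coeff 4 (tay Z) = b4 at *
    generalize PowerSeries.coeff 5 (tay Z) = b5 at *
    generalize PowerSeries.coeff 6 (tay Z) = b6 at *
    generalize PowerSeries.coeff 7 (tay Z) = b7 at *
    norm_num [Nat.factorial, div_eq_iff] at p2 p3 p4 p5
    rw [e1] at q1
    rw [e2] at q2
    rw [e3] at q3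
    rw [e5] at q5
    have hb1 : b1 = 0 := by simpa [ha1] using q1.symm
    subst hb1
    have hb2 : b2 = 0 := by simpa [ha1] using q2.symm
    subst hb2
    have hb3 : b3 = 0 := by simpa [ha1] using q3.symm
    subst hb3
    norm_num [Nat.factorial, div_eq_iff] at q4 q5 q6 q7
    rw [p2, p3] at f3
    rw [p2, p4, p5] at f5
    have hk : k = 6 * a2 / a1 := by
      field_simp
      have : a1 * (k * a1) = a1 * (6 * a2) := by linarith
      exact mul_left_cancel₀ ha1 this
    subst hk
    have hl : l = 60 * (2 * a1 * a4 + 2 * a2 * a3) / a1 ^ 2 -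
      120 * (2 * a1 * a2) * (2 * a1 * a3 + a2 ^ 2) / a1 ^ 4 := by
      have h2 : a1 ^ 2 * 2 ≠ 0 := by positivity
      apply mul_right_cancel₀ h2
      rw [← f5]; field_simp; ring
    subst hl
    rw [q4] at q5
    have hb5 : b5 = 0 := by
      have : a1 ^ 2 * b5 = 0 := by
        field_simp at q5
        linarith
      simpa [ha1] using this
    subst hb5
    refine ⟨rfl, rfl, rfl, ?_⟩
    rintro rfl
    apply e7
    rw [q4, q6, q7]
    field_simp
    ring
  obtain ⟨hb1, hb3, hb5, hb7⟩ := hb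
  obtain ⟨E, h, hE, hh, hform, hh0⟩ := even_odd_form hZ hb1 hb3 hb5
  have hh0' : h 0 ≠ 0 := by rw [hh0]; exact hb7
  -- a common interval
  have hcσ : Continuous (deriv σ) := (sm_deriv hσ).continuous
  have hev : ∀ᶠ t in 𝓝 (0:ℝ), (τ (σ t) = t ∧ X (σ t) = τ (σ t) ^ 2) ∧ deriv σ t ≠ 0 :=
    (hτσ.and (hσt.eventually hXτ)).and (hcσ.continuousAt.eventually_ne hσd)
  obtain ⟨ε, hε, hball⟩ := Metric.eventually_nhds_iff.1 hev
  have hx : ∀ t ∈ Set.Ioo (-ε) ε, L1 (γ (c + σ t)) - L1 (γ c) = t ^ 2 := by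
    intro t ht
    obtain ⟨⟨h1, h2⟩, -⟩ := hball (y := t) (by rw [Real.dist_eq, sub_zero, abs_lt]; exact ht)
    rw [h1] at h2; exact h2
  have hy : ∀ t, L2 (γ (c + σ t)) - L2 (γ c) = E (t ^ 2) + t ^ 7 * h (t ^ 2) := hform
  have hE0 : E 0 = 0 := by
    have := hy 0
    simpa [hσ0] using this.symm
  set N := A.1 ^ 2 + A.2 ^ 2 with hNdef
  refine ⟨-ε, ε, fun t => c + σ t, {p | h (L1 p - L1 (γ c)) ≠ 0}, {q | h q.1 ≠ 0},
    fun p => (L1 p - L1 (γ c), (L2 p - L2 (γ c) - E (L1 p - L1 (γ c))) / h (L1 p - L1 (γ c))),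
    fun q => ((γ c).1 + (A.1 * q.1 - A.2 * (h q.1 * q.2 + E q.1)) / N,
      (γ c).2 + (A.2 * q.1 + A.1 * (h q.1 * q.2 + E q.1)) / N),
    by linarith, hε, (contDiff_const.add hσ).contDiffOn, by simp [hσ0], ?_, ?_, ?_, ?_, ?_, ?_, ?_, ?_⟩
  · intro t ht
    rw [deriv_const_add]
    exact (hball (y := t) (by rw [Real.dist_eq, sub_zero, abs_lt]; exact ht)).2
  · exact isOpen_ne_fun (hh.continuous.comp (L1.continuous.sub continuous_const)) continuous_const
  · exact isOpen_ne_fun (hh.continuous.comp continuous_fst) continuous_const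
  · simpa using hh0'
  · exact hh0'
  · have hl1 : ContDiff ℝ ∞ fun p => L1 p - L1 (γ c) := L1.contDiff.sub contDiff_const
    have hl2 : ContDiff ℝ ∞ fun p => L2 p - L2 (γ c) := L2.contDiff.sub contDiff_const
    have hinv1 : ∀ q : ℝ × ℝ, L1 ((γ c).1 + (A.1 * q.1 - A.2 * (h q.1 * q.2 + E q.1)) / N,
      (γ c).2 + (A.2 * q.1 + A.1 * (h q.1 * q.2 + E q.1)) / N) - L1 (γ c) = q.1 := by
      intro q
      rw [L1a, L1a]
      have : N ≠ 0 := hN.ne'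
      field_simp
      rw [hNdef]; ring
    have hinv2 : ∀ q : ℝ × ℝ, L2 ((γ c).1 + (A.1 * q.1 - A.2 * (h q.1 * q.2 + E q.1)) / N,
      (γ c).2 + (A.2 * q.1 + A.1 * (h q.1 * q.2 + E q.1)) / N) - L2 (γ c) =
        h q.1 * q.2 + E q.1 := by
      intro q
      rw [L2a, L2a]
      have : N ≠ 0 := hN.ne'
      field_simp
      rw [hNdef]; ring
    refine ⟨?_, ?_, ?_, ?_, ?_, ?_⟩
    · exact hl1.contDiffOn.prodMk
        ((hl2.sub (hE.comp hl1)).contDiffOn.div (hh.comp hl1).contDiffOn (fun p hp => hp))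
    · have hz : ContDiff ℝ ∞ fun q : ℝ × ℝ => h q.1 * q.2 + E q.1 :=
        ((hh.comp contDiff_fst).mul contDiff_snd).add (hE.comp contDiff_fst)
      exact ((contDiff_const.add (((contDiff_const.mul contDiff_fst).sub
        (contDiff_const.mul hz)).div_const _)).prodMk
        (contDiff_const.add (((contDiff_const.mul contDiff_fst).add
        (contDiff_const.mul hz)).div_const _))).contDiffOn
    · intro p hp; exact hp
    · intro q hq
      change h (L1 _ - _) ≠ 0
      rw [hinv1]; exact hq
    · intro p hp
      have hp : h (L1 p - L1 (γ c)) ≠ 0 := hp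
      have h1 : h (L1 p - L1 (γ c)) *
          ((L2 p - L2 (γ c) - E (L1 p - L1 (γ c))) / h (L1 p - L1 (γ c))) + E (L1 p - L1 (γ c)) =
          L2 p - L2 (γ c) := by field_simp; ring
      have hN' : N ≠ 0 := hN.ne'
      ext
      · simp only [h1]
        rw [L1a, L1a, L2a, L2a]; field_simp; rw [hNdef]; ring
      · simp only [h1]
        rw [L1a, L1a, L2a, L2a]; field_simp; rw [hNdef]; ring
    · intro q hq
      have hq : h q.1 ≠ 0 := hq
      simp only [hinv1, hinv2]
      ext
      · rfl
      · simp only []; field_simp; ring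
  · simp [hE0]
  · intro t ht hW
    have hW : h (L1 (γ (c + σ t)) - L1 (γ c)) ≠ 0 := hW
    rw [hx t ht] at hW
    simp only [hx t ht, hy t]
    ext
    · rfl
    · simp only []; field_simp; ring

end Helpers

/-- Criterion for the 7/2-cusp: a smooth plane curve `γ` has a 7/2-cusp at `c`
(is `𝒜`-equivalent at `c` to `t ↦ (t², t⁷)`) iff there exist `k, l ∈ ℝ` such that
`γ` satisfies the 7/2-cusp conditions at `c` with constants `(k, l)`. -/
theorem stmt14 (γ : ℝ → ℝ × ℝ) (hγ : ContDiff ℝ (⊤ : ℕ∞) γ) (c : ℝ) :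
    AEquivCurveAt γ c 2 7 ↔ ∃ k l : ℝ, SevenHalfCuspCond γ c k l := by
  exact ⟨forward_dir γ hγ c, fun ⟨k, l, h⟩ => backward_dir γ hγ c k l h⟩

end
end
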